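/- For every integer d ≥ 2 there exists a constant α_d ≥ 1 such that for every prime p, every n ≥ 1, and every nonzero d-tensor T : (𝔽_p^n)^d → 𝔽_p, one has prank(T) ≤ α_d · arank(T) · (log(1 + arank(T)) + 1). -/

import Mathlib

/-- A `d`-tensor on `𝔽_p^n`: a multilinear form `T : (𝔽_p^n)^d → 𝔽_p`. -/
abbrev Tensor (p n d : ℕ) :=
  MultilinearMap (ZMod p) (fun _ : Fin d => (Fin n → ZMod p)) (ZMod p)

/-- `T` has partition rank `1` if there exist a partition of `{1,…,d}` into two nonempty
sets and multilinear forms `T₁`, `T₂` on the respective sets of variables with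
`T(x_1,…,x_d) = T₁(x_{i_1},…,x_{i_a})·T₂(x_{j_1},…,x_{j_b})`. -/
def PRankOne {p n d : ℕ} (T : Tensor p n d) : Prop :=
  ∃ A : Finset (Fin d), A.Nonempty ∧ A ≠ Finset.univ ∧
    ∃ (T₁ : MultilinearMap (ZMod p) (fun _ : {i // i ∈ A} => (Fin n → ZMod p)) (ZMod p))
      (T₂ : MultilinearMap (ZMod p) (fun _ : {i // i ∉ A} => (Fin n → ZMod p)) (ZMod p)),
      ∀ x, T x = T₁ (fun i => x i.1) * T₂ (fun i => x i.1)

/-- The partition rank of `T`: the smallest `r` such that `T` is a sum of `r` tensors each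
of partition rank `1` (and `prank 0 = 0`). -/
noncomputable def prank {p n d : ℕ} (T : Tensor p n d) : ℕ :=
  sInf {r | ∃ f : Fin r → Tensor p n d, (∀ i, PRankOne (f i)) ∧ T = ∑ i, f i}

/-- The bias of a `d`-tensor `T` with respect to a nontrivial additive character `χ`:
`bias(T) = E_{x_1,…,x_d ∈ 𝔽_p^n} χ(T(x_1,…,x_d))` (a nonnegative real number, recorded here
via the real part). -/
noncomputable def bias {p n d : ℕ} [NeZero p] (T : Tensor p n d)
    (χ : AddChar (ZMod p) ℂ) : ℂ :=
  (∑ x : Fin d → (Fin n → ZMod p), χ (T x)) / (Fintype.card (Fin d → (Fin n → ZMod p)) : ℂ)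

/-- The analytic rank of a `d`-tensor: `arank(T) = −log_p bias(T)`. -/
noncomputable def arank {p n d : ℕ} [NeZero p] (T : Tensor p n d)
    (χ : AddChar (ZMod p) ℂ) : ℝ :=
  - Real.logb p (bias T χ).re

/-- Finitely many nonzero polynomials over an infinite domain have a common non-root. -/
theorem exists_common_nonroot {σ E α : Type*} [CommRing E] [IsDomain E] [Infinite E]
    (s : Finset α) (f : α → MvPolynomial σ E) (hf : ∀ a ∈ s, f a ≠ 0) :
    ∃ z : σ → E, ∀ a ∈ s, MvPolynomial.eval z (f a) ≠ 0 := by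
  have h : ∏ a ∈ s, f a ≠ 0 := Finset.prod_ne_zero_iff.2 hf
  by_contra! hcon
  apply h
  apply MvPolynomial.funext
  intro z
  obtain ⟨a, ha, hz⟩ := hcon z
  rw [map_prod, map_zero]
  exact Finset.prod_eq_zero ha hz

/-- The exponent vectors of total degree at most `N`. -/
def degSimplex (σ : Type*) [Fintype σ] [DecidableEq σ] (N : ℕ) : Finset (σ →₀ ℕ) :=
  (Finset.range (N + 1)).biUnion fun i => (Finset.univ : Finset σ).finsuppAntidiag i

theorem mem_degSimplex {σ : Type*} [Fintype σ] [DecidableEq σ] {N : ℕ} {a : σ →₀ ℕ} :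
    a ∈ degSimplex σ N ↔ ∑ i, a i ≤ N := by
  simp [degSimplex, Finset.mem_finsuppAntidiag]

theorem card_degSimplex (σ : Type*) [Fintype σ] [DecidableEq σ] (N : ℕ) :
    (degSimplex σ N).card = (Fintype.card σ + N).choose (Fintype.card σ) := by
  rw [degSimplex, Finset.card_biUnion]
  · simp_rw [Finset.card_finsuppAntidiag_nat_eq_multichoose, Finset.card_univ]
    have key : ∀ k N : ℕ, ∑ i ∈ Finset.range (N + 1), k.multichoose i
        = (k + 1).multichoose N := by
      intro k N
      induction N with
      | zero => simp
      | succ N ih =>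
        rw [Finset.sum_range_succ, ih, Nat.multichoose_succ_succ, add_comm]
    rw [key, Nat.multichoose_eq, add_right_comm, Nat.add_sub_cancel]
    exact (Nat.choose_symm_add).symm
  · intro i _ j _ hij
    rw [Function.onFun, Finset.disjoint_left]
    intro a ha hb
    simp only [Finset.mem_finsuppAntidiag] at ha hb
    exact hij (ha.1.symm.trans hb.1)

/-- Polynomials in two groups of variables of degree at most `a` in the first group and at most
`b` in the second. -/
noncomputable def bidegSubmodule (U L E : Type*) [Fintype U] [Fintype L] [Field E] (a b : ℕ) :
    Submodule E (MvPolynomial (U ⊕ L) E) :=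
  MvPolynomial.restrictSupport E {m | ∑ i, m (Sum.inl i) ≤ a ∧ ∑ i, m (Sum.inr i) ≤ b}

section bideg
variable {U L E : Type*} [Fintype U] [Fintype L] [Field E]

theorem bideg_mono {a b a' b' : ℕ} (ha : a ≤ a') (hb : b ≤ b') :
    bidegSubmodule U L E a b ≤ bidegSubmodule U L E a' b' :=
  MvPolynomial.restrictSupport_mono _ fun _ hm => ⟨hm.1.trans ha, hm.2.trans hb⟩

theorem bideg_mul {a b a' b' : ℕ} {p q : MvPolynomial (U ⊕ L) E}
    (hp : p ∈ bidegSubmodule U L E a b) (hq : q ∈ bidegSubmodule U L E a' b') :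
    p * q ∈ bidegSubmodule U L E (a + a') (b + b') := by
  classical
  rw [bidegSubmodule, MvPolynomial.mem_restrictSupport_iff] at *
  intro m hm
  obtain ⟨x, hx, y, hy, rfl⟩ := Finset.mem_add.1 (MvPolynomial.support_mul p q hm)
  have h1 := hp hx
  have h2 := hq hy
  simp only [Set.mem_ofPred_eq, Finsupp.add_apply, Finset.sum_add_distrib] at *
  omega

theorem bideg_C (c : E) (a b : ℕ) : MvPolynomial.C c ∈ bidegSubmodule U L E a b := by
  rw [bidegSubmodule, MvPolynomial.C_apply, MvPolynomial.monomial_mem_restrictSupport]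
  simp

theorem bideg_X_inl (i : U) (b : ℕ) : MvPolynomial.X (Sum.inl i) ∈ bidegSubmodule U L E 1 b := by
  classical
  rw [bidegSubmodule, MvPolynomial.X, MvPolynomial.monomial_mem_restrictSupport]
  simp [Finsupp.single_apply]

theorem bideg_X_inr (i : L) (a : ℕ) : MvPolynomial.X (Sum.inr i) ∈ bidegSubmodule U L E a 1 := by
  classical
  rw [bidegSubmodule, MvPolynomial.X, MvPolynomial.monomial_mem_restrictSupport]
  simp [Finsupp.single_apply]

theorem bideg_prod {α : Type*} (s : Finset α) (f : α → MvPolynomial (U ⊕ L) E) (a b : α → ℕ)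
    (hf : ∀ i ∈ s, f i ∈ bidegSubmodule U L E (a i) (b i)) :
    ∏ i ∈ s, f i ∈ bidegSubmodule U L E (∑ i ∈ s, a i) (∑ i ∈ s, b i) := by
  classical
  induction s using Finset.induction_on with
  | empty => simpa using bideg_C (1 : E) 0 0
  | insert x s hx ih =>
    rw [Finset.prod_insert hx, Finset.sum_insert hx, Finset.sum_insert hx]
    exact bideg_mul (hf x (Finset.mem_insert_self _ _))
      (ih fun i hi => hf i (Finset.mem_insert_of_mem hi))

theorem bideg_pow {a b : ℕ} {p : MvPolynomial (U ⊕ L) E}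
    (hp : p ∈ bidegSubmodule U L E a b) (n : ℕ) :
    p ^ n ∈ bidegSubmodule U L E (n * a) (n * b) := by
  simpa using bideg_prod (Finset.range n) (fun _ => p) (fun _ => a) (fun _ => b) (fun _ _ => hp)

theorem finrank_bideg [DecidableEq U] [DecidableEq L] (a b : ℕ) :
    Module.Finite E (bidegSubmodule U L E a b) ∧
    Module.finrank E (bidegSubmodule U L E a b) =
      (Fintype.card U + a).choose (Fintype.card U) *
      (Fintype.card L + b).choose (Fintype.card L) := by
  let T : Finset (U ⊕ L →₀ ℕ) := (degSimplex U a ×ˢ degSimplex L b).map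
    (Finsupp.sumFinsuppEquivProdFinsupp (α := U) (β := L) (γ := ℕ)).symm.toEmbedding
  have hT : {m : U ⊕ L →₀ ℕ | ∑ i, m (Sum.inl i) ≤ a ∧ ∑ i, m (Sum.inr i) ≤ b} = ↑T := by
    ext m
    simp only [T, Set.mem_ofPred_eq, Finset.coe_map, Set.mem_image, Finset.mem_coe,
      Finset.mem_product, mem_degSimplex, Equiv.coe_toEmbedding]
    constructor
    · intro h
      exact ⟨Finsupp.sumFinsuppEquivProdFinsupp m, by simpa using h, by simp⟩
    · rintro ⟨x, hx, rfl⟩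
      simpa using hx
  have B := MvPolynomial.basisRestrictSupport E
    {m : U ⊕ L →₀ ℕ | ∑ i, m (Sum.inl i) ≤ a ∧ ∑ i, m (Sum.inr i) ≤ b}
  rw [hT] at B
  rw [bidegSubmodule, hT]
  refine ⟨Module.Finite.of_basis B, ?_⟩
  rw [Module.finrank_eq_nat_card_basis B, Nat.card_coe_set_eq, Set.ncard_coe_finset,
    Finset.card_map, Finset.card_product, card_degSimplex, card_degSimplex]

end bideg

theorem exists_add_pow_lt (m c : ℕ) : ∃ A : ℕ, (A + c) ^ m < 2 * A ^ m := by
  refine ⟨2 * m * c + 1, ?_⟩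
  set A := 2 * m * c + 1 with hA
  have hpos : (0 : ℝ) < A + c := by rw [hA]; push_cast; positivity
  have hb := one_add_mul_le_pow (a := -((c : ℝ) / (A + c))) (by
    have : (c : ℝ) / (A + c) ≤ 1 := by
      rw [div_le_one hpos]; linarith [(Nat.cast_nonneg A : (0 : ℝ) ≤ A)]
    linarith) m
  have h1 : (1 : ℝ) + -((c : ℝ) / (A + c)) = A / (A + c) := by field_simp; ring
  have h2 : (1 : ℝ) / 2 < 1 + m * -((c : ℝ) / (A + c)) := by
    have : (m : ℝ) * (c / (A + c)) < 1 / 2 := by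
      rw [← mul_div_assoc, div_lt_iff₀ hpos, hA]
      push_cast
      nlinarith [(Nat.cast_nonneg c : (0 : ℝ) ≤ c)]
    linarith
  have h3 : (1 : ℝ) / 2 < (A : ℝ) ^ m / (A + c) ^ m := by
    rw [← div_pow, ← h1]; exact h2.trans_le hb
  rw [div_lt_div_iff₀ two_pos (by positivity)] at h3
  have : ((A + c) ^ m : ℝ) < 2 * A ^ m := by linarith
  exact_mod_cast this

theorem exists_choose_lt (κ s D B : ℕ) (hD : 1 ≤ D) (hB : B + 1 = 2 * D ^ s * (κ + s).choose s) :
    ∃ A : ℕ, (κ + (A + B)).choose κ * (s + D * A).choose s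
      < (κ + s + A).choose (κ + s) * (B + 1) := by
  obtain ⟨A, hA⟩ := exists_add_pow_lt (κ + s) (κ + B + s)
  refine ⟨A, ?_⟩
  have hfac : 0 < κ.factorial * s.factorial := by positivity
  refine lt_of_mul_lt_mul_left ?_ hfac.le
  have e1 : κ.factorial * (κ + (A + B)).choose κ ≤ (A + (κ + B + s)) ^ κ := by
    rw [← Nat.descFactorial_eq_factorial_mul_choose]
    exact (Nat.descFactorial_le_pow _ _).trans (Nat.pow_le_pow_left (by omega) _)
  have e2 : s.factorial * (s + D * A).choose s ≤ D ^ s * (A + (κ + B + s)) ^ s := by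
    rw [← Nat.descFactorial_eq_factorial_mul_choose, ← mul_pow]
    refine (Nat.descFactorial_le_pow _ _).trans (Nat.pow_le_pow_left ?_ _)
    nlinarith
  have e3 : A ^ (κ + s) ≤ (κ + s).factorial * (κ + s + A).choose (κ + s) := by
    rw [← Nat.descFactorial_eq_factorial_mul_choose]
    exact (Nat.pow_le_pow_left (by omega) _).trans (Nat.pow_sub_le_descFactorial _ _)
  have e4 : (κ + s).choose s * κ.factorial * s.factorial = (κ + s).factorial := by
    have := Nat.choose_mul_factorial_mul_factorial (Nat.le_add_left s κ)
    rw [Nat.add_sub_cancel] at this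
    rw [← this]; ring
  calc κ.factorial * s.factorial * ((κ + (A + B)).choose κ * (s + D * A).choose s)
      = (κ.factorial * (κ + (A + B)).choose κ) * (s.factorial * (s + D * A).choose s) := by ring
    _ ≤ (A + (κ + B + s)) ^ κ * (D ^ s * (A + (κ + B + s)) ^ s) := Nat.mul_le_mul e1 e2
    _ = D ^ s * (A + (κ + B + s)) ^ (κ + s) := by ring
    _ < D ^ s * (2 * A ^ (κ + s)) := Nat.mul_lt_mul_of_pos_left hA (by positivity)
    _ ≤ D ^ s * (2 * ((κ + s).factorial * (κ + s + A).choose (κ + s))) := by gcongr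
    _ = κ.factorial * s.factorial * ((κ + s + A).choose (κ + s) * (B + 1)) := by
      rw [hB, ← e4]; ring

open MvPolynomial in
/-- Dimension counting: a square system of bidegree `(1, D)` and a form of bidegree `(1, 0)`
satisfy an algebraic relation of bounded degree in the form. -/
theorem exists_relation {U L E : Type*} [Fintype U] [Fintype L] [DecidableEq U] [DecidableEq L]
    [Field E] (D B : ℕ) (hD : 1 ≤ D)
    (hB : B + 1 = 2 * D ^ Fintype.card L *
      (Fintype.card U + Fintype.card L).choose (Fintype.card L))
    (g : U ⊕ L → MvPolynomial (U ⊕ L) E) (hg : ∀ i, g i ∈ bidegSubmodule U L E 1 D)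
    (l : MvPolynomial (U ⊕ L) E) (hl : l ∈ bidegSubmodule U L E 1 0) :
    ∃ (P : Finset (U ⊕ L →₀ ℕ)) (q : (U ⊕ L →₀ ℕ) → Polynomial E),
      (∃ a ∈ P, q a ≠ 0) ∧ (∀ a, (q a).natDegree ≤ B) ∧
      ∑ a ∈ P, Polynomial.aeval l (q a) * ∏ i, g i ^ a i = 0 := by
  obtain ⟨A, hA⟩ := exists_choose_lt (Fintype.card U) (Fintype.card L) D B hD hB
  let P := degSimplex (U ⊕ L) A
  let ι := P × Fin (B + 1)
  have hmem : ∀ x : ι, l ^ (x.2 : ℕ) * ∏ i, g i ^ (x.1 : U ⊕ L →₀ ℕ) i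
      ∈ bidegSubmodule U L E (A + B) (D * A) := by
    intro x
    have h1 := bideg_pow hl (x.2 : ℕ)
    have h2 := bideg_prod Finset.univ (fun i => g i ^ (x.1 : U ⊕ L →₀ ℕ) i) _ _
      (fun i _ => bideg_pow (hg i) ((x.1 : U ⊕ L →₀ ℕ) i))
    refine bideg_mono ?_ ?_ (bideg_mul h1 h2)
    · have := mem_degSimplex.1 x.1.2
      have := x.2.2
      simp only [mul_one]
      omega
    · have := mem_degSimplex.1 x.1.2
      rw [mul_zero, zero_add, ← Finset.sum_mul, mul_comm]
      exact Nat.mul_le_mul_left _ this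
  let v : ι → bidegSubmodule U L E (A + B) (D * A) := fun x => ⟨_, hmem x⟩
  obtain ⟨hfin, hdim⟩ := finrank_bideg (U := U) (L := L) (E := E) (A + B) (D * A)
  have hdep : ¬ LinearIndependent E v := by
    intro hv
    have := hv.fintype_card_le_finrank
    rw [hdim, Fintype.card_prod, Fintype.card_coe, card_degSimplex, Fintype.card_sum,
      Fintype.card_fin] at this
    omega
  rw [Fintype.not_linearIndependent_iff] at hdep
  obtain ⟨c, hc, x0, hx0⟩ := hdep
  refine ⟨P, fun a => if h : a ∈ P then
    ∑ b : Fin (B + 1), Polynomial.monomial (b : ℕ) (c (⟨a, h⟩, b)) else 0, ?_, ?_, ?_⟩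
  · refine ⟨x0.1, x0.1.2, fun h => hx0 ?_⟩
    simp only [x0.1.2, dif_pos] at h
    have h2 := congrArg (fun p => Polynomial.coeff p (x0.2 : ℕ)) h
    simpa [Polynomial.finsetSum_coeff, Polynomial.coeff_monomial, Fin.val_inj] using h2
  · intro a
    dsimp only
    split_ifs
    · refine Polynomial.natDegree_sum_le_of_forall_le _ _ fun b _ => ?_
      exact (Polynomial.natDegree_monomial_le _).trans (by omega)
    · simp
  · rw [← Finset.sum_attach]
    have h2 := congrArg Subtype.val hc
    rw [Fintype.sum_prod_type] at h2
    refine Eq.trans ?_ h2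
    simp only [AddSubmonoidClass.coe_finsetSum, Submodule.coe_smul, v,
      Finset.univ_eq_attach]
    refine Finset.sum_congr rfl fun a _ => ?_
    simp only [a.2, dif_pos]
    rw [map_sum, Finset.sum_mul]
    refine Finset.sum_congr rfl fun b _ => ?_
    rw [Polynomial.aeval_monomial, MvPolynomial.algebraMap_eq, MvPolynomial.smul_eq_C_mul]
    ring

/-- The directional derivative along `ω`. -/
noncomputable def dirDeriv {σ E : Type*} [Field E] (ω : σ → E) :
    Derivation E (MvPolynomial σ E) (MvPolynomial σ E) :=
  MvPolynomial.mkDerivation E fun i => MvPolynomial.C (ω i)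

theorem eval_dirDeriv {σ E : Type*} [Field E] [Fintype σ] (ω ζ : σ → E) (p : MvPolynomial σ E) :
    MvPolynomial.eval ζ (dirDeriv ω p)
      = ∑ i, ω i * MvPolynomial.eval ζ (MvPolynomial.pderiv i p) := by
  classical
  induction p using MvPolynomial.induction_on with
  | C a => simp [dirDeriv]
  | add p q hp hq => simp only [map_add, hp, hq, mul_add, Finset.sum_add_distrib]
  | mul_X p j hp =>
    simp only [Derivation.leibniz, map_add, smul_eq_mul, map_mul, hp, mul_add,
      Finset.sum_add_distrib, MvPolynomial.eval_X, MvPolynomial.pderiv_X, Finset.mul_sum]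
    congr 1
    · simp [dirDeriv, MvPolynomial.mkDerivation_X, Pi.single_apply, apply_ite, mul_comm]
    · exact Finset.sum_congr rfl fun i _ => by ring

/-- Restriction of polynomials to the line `ζ + Xω`. -/
noncomputable def lineHom {σ E : Type*} [Field E] (ζ ω : σ → E) :
    MvPolynomial σ E →ₐ[E] Polynomial E :=
  MvPolynomial.aeval fun i => Polynomial.C (ζ i) + Polynomial.X * Polynomial.C (ω i)

theorem lineHom_coeff_zero {σ E : Type*} [Field E] (ζ ω : σ → E) (p : MvPolynomial σ E) :
    (lineHom ζ ω p).coeff 0 = MvPolynomial.eval ζ p := by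
  induction p using MvPolynomial.induction_on with
  | C a => simp [lineHom]
  | add p q hp hq => simp only [map_add, Polynomial.coeff_add, hp, hq]
  | mul_X p j hp =>
    rw [map_mul, Polynomial.mul_coeff_zero, hp, map_mul]
    simp [lineHom]

theorem lineHom_coeff_one {σ E : Type*} [Field E] (ζ ω : σ → E) (p : MvPolynomial σ E) :
    (lineHom ζ ω p).coeff 1 = MvPolynomial.eval ζ (dirDeriv ω p) := by
  induction p using MvPolynomial.induction_on with
  | C a => simp [lineHom, dirDeriv]
  | add p q hp hq => simp only [map_add, Polynomial.coeff_add, hp, hq]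
  | mul_X p j hp =>
    rw [map_mul, Polynomial.mul_coeff_one, hp, lineHom_coeff_zero]
    simp [lineHom, dirDeriv, MvPolynomial.mkDerivation_X, Polynomial.coeff_C]
    ring

theorem relation_at_zero {σ E : Type*} [Fintype σ] [Field E] (g : σ → MvPolynomial σ E)
    (l : MvPolynomial σ E) (P : Finset (σ →₀ ℕ)) (q : (σ →₀ ℕ) → Polynomial E)
    (hrel : ∑ a ∈ P, Polynomial.aeval l (q a) * ∏ i, g i ^ a i = 0)
    (v : ℕ) (hv : ∀ a ∈ P, q a ≠ 0 → v ≤ ∑ i, a i) (ζ ω y : σ → E)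
    (hζ : ∀ i, MvPolynomial.eval ζ (g i) = 0)
    (hω : ∀ i, MvPolynomial.eval ζ (dirDeriv ω (g i)) = y i) :
    ∑ a ∈ P with ∑ i, a i = v, (∏ i, y i ^ a i) * (q a).eval (MvPolynomial.eval ζ l) = 0 := by
  have hh : ∀ i, ∃ h : Polynomial E, lineHom ζ ω (g i) = Polynomial.X * h ∧ h.coeff 0 = y i := by
    intro i
    have h0 : (lineHom ζ ω (g i)).coeff 0 = 0 := by rw [lineHom_coeff_zero, hζ]
    obtain ⟨h, hh⟩ := Polynomial.X_dvd_iff.2 h0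
    refine ⟨h, hh, ?_⟩
    rw [← hω i, ← lineHom_coeff_one, hh, Polynomial.coeff_X_mul]
  choose h hg h0 using hh
  have h1 := congrArg (lineHom ζ ω) hrel
  rw [map_sum, map_zero] at h1
  have h2 : Polynomial.X ^ v * ∑ a ∈ P, Polynomial.aeval (lineHom ζ ω l) (q a) *
      (Polynomial.X ^ (∑ i, a i - v) * ∏ i, h i ^ a i) = 0 := by
    rw [← h1, Finset.mul_sum]
    refine Finset.sum_congr rfl fun a ha => ?_
    by_cases hq : q a = 0
    · simp [hq]
    · have hva := hv a ha hq
      rw [map_mul, map_prod, ← Polynomial.aeval_algHom_apply]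
      simp_rw [map_pow, hg, mul_pow, Finset.prod_mul_distrib, Finset.prod_pow_eq_pow_sum]
      conv_rhs => rw [← Nat.add_sub_cancel' hva, pow_add]
      ring
  have h3 := (mul_eq_zero.1 h2).resolve_left (pow_ne_zero _ Polynomial.X_ne_zero)
  have h4 := congrArg (Polynomial.eval 0) h3
  rw [Polynomial.eval_finsetSum, Polynomial.eval_zero] at h4
  rw [Finset.sum_filter]
  refine Eq.trans ?_ h4
  refine Finset.sum_congr rfl fun a ha => ?_
  have h0' : ∀ i, (h i).eval 0 = y i := fun i => by rw [← Polynomial.coeff_zero_eq_eval_zero, h0]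
  have hl : (Polynomial.aeval (lineHom ζ ω l) (q a)).eval 0
      = (q a).eval (MvPolynomial.eval ζ l) := by
    rw [← lineHom_coeff_zero ζ ω l, Polynomial.coeff_zero_eq_eval_zero,
      ← Polynomial.coe_aeval_eq_eval, ← Polynomial.coe_aeval_eq_eval,
      ← Polynomial.aeval_algHom_apply]
  by_cases hq : q a = 0
  · simp only [hq, map_zero, zero_mul, Polynomial.eval_zero, mul_zero, ite_self]
  have hva := hv a ha hq
  rw [Polynomial.eval_mul, Polynomial.eval_mul, hl, Polynomial.eval_prod, Polynomial.eval_pow,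
    Polynomial.eval_X]
  simp_rw [Polynomial.eval_pow, h0']
  split_ifs with hs
  · simp [hs, mul_comm]
  · rw [zero_pow (by omega)]; simp

theorem eval_det_generic_mul {α ι E : Type*} [Fintype α] [DecidableEq α] [Fintype ι] [Field E]
    (c : α × ι → E) (J : Matrix ι α E) :
    MvPolynomial.eval c
      (Matrix.mvPolynomialX α ι E *
        J.map (MvPolynomial.C : E →+* MvPolynomial (α × ι) E)).det
      = ((Matrix.of fun s i => c (s, i) : Matrix α ι E) * J).det := by
  rw [RingHom.map_det, RingHom.mapMatrix_apply, Matrix.map_mul]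
  congr 2
  · ext; simp
  · ext; simp

/-- Square case of `card_nonsingular_zeros_le`. -/
theorem card_nonsingular_zeros_le_of_square {U L E : Type*} [Fintype U] [Fintype L]
    [DecidableEq U] [DecidableEq L] [Field E] [Infinite E] (D : ℕ) (hD : 1 ≤ D)
    (g : U ⊕ L → MvPolynomial (U ⊕ L) E) (hg : ∀ i, g i ∈ bidegSubmodule U L E 1 D)
    (S : Finset (U ⊕ L → E)) (hz : ∀ ζ ∈ S, ∀ i, MvPolynomial.eval ζ (g i) = 0)
    (hinj : ∀ ζ ∈ S, ∀ ξ ∈ S, (∀ u, ζ (Sum.inl u) = ξ (Sum.inl u)) → ζ = ξ)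
    (hJ : ∀ ζ ∈ S, ∀ y : U ⊕ L → E, ∃ ω, ∀ i, MvPolynomial.eval ζ (dirDeriv ω (g i)) = y i) :
    S.card ≤ 2 * D ^ Fintype.card L *
      (Fintype.card U + Fintype.card L).choose (Fintype.card L) := by
  classical
  obtain ⟨c, hc⟩ : ∃ c : U → E, ∀ x ∈ S.offDiag,
      MvPolynomial.eval c (∑ u, MvPolynomial.C (x.1 (Sum.inl u) - x.2 (Sum.inl u)) *
        MvPolynomial.X u) ≠ 0 := by
    apply exists_common_nonroot
    rintro ⟨ζ, ξ⟩ hx h0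
    rw [Finset.mem_offDiag] at hx
    refine hx.2.2 (hinj _ hx.1 _ hx.2.1 fun u => ?_)
    have := congrArg (MvPolynomial.eval (Pi.single u 1)) h0
    simpa [Pi.single_apply, sub_eq_zero] using this
  let l : MvPolynomial (U ⊕ L) E :=
    ∑ u, MvPolynomial.C (c u) * MvPolynomial.X (Sum.inl u)
  have hl : l ∈ bidegSubmodule U L E 1 0 := by
    refine Submodule.sum_mem _ fun u _ => ?_
    simpa using bideg_mul (bideg_C (c u) 0 0) (bideg_X_inl u 0)
  have hlinj : Set.InjOn (fun ζ => MvPolynomial.eval ζ l) S := by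
    intro ζ hζ ξ hξ h
    by_contra hne
    refine hc (ζ, ξ) (Finset.mem_offDiag.2 ⟨hζ, hξ, hne⟩) ?_
    simp only [l, map_sum, map_mul, MvPolynomial.eval_C, MvPolynomial.eval_X] at h ⊢
    simp only [sub_mul, Finset.sum_sub_distrib]
    rw [sub_eq_zero]
    simpa [mul_comm] using h
  set N := 2 * D ^ Fintype.card L *
      (Fintype.card U + Fintype.card L).choose (Fintype.card L) with hN
  have hNpos : 0 < N := by
    have := Nat.choose_pos (Nat.le_add_left (Fintype.card L) (Fintype.card U))
    positivity
  obtain ⟨P, q, ⟨a1, ha1, hqa1⟩, hdeg, hrel⟩ :=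
    exists_relation D (N - 1) hD (by omega) g hg l hl
  obtain ⟨a0, ha0, hmin⟩ := Finset.exists_min_image (P.filter fun a => q a ≠ 0)
    (fun a => ∑ i, a i) ⟨a1, Finset.mem_filter.2 ⟨ha1, hqa1⟩⟩
  rw [Finset.mem_filter] at ha0
  set v := ∑ i, a0 i with hv
  obtain ⟨b, hb⟩ : ∃ b, (q a0).coeff b ≠ 0 := by
    by_contra! h
    exact ha0.2 (Polynomial.ext (by simpa using h))
  obtain ⟨y, hy⟩ : ∃ y : U ⊕ L → E, ∀ x ∈ ({()} : Finset Unit), MvPolynomial.eval y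
      (∑ a ∈ P with ∑ i, a i = v, MvPolynomial.monomial a ((q a).coeff b)) ≠ 0 := by
    refine exists_common_nonroot ({()} : Finset Unit) (fun _ => _) fun _ _ h => hb ?_
    have := congrArg (MvPolynomial.coeff a0) h
    rw [MvPolynomial.coeff_sum] at this
    simp only [MvPolynomial.coeff_monomial, MvPolynomial.coeff_zero] at this
    rw [Finset.sum_ite_eq'] at this
    rw [if_pos (Finset.mem_filter.2 ⟨ha0.1, hv.symm⟩)] at this
    exact this
  replace hy := hy () (Finset.mem_singleton_self _)
  let Q : Polynomial E := ∑ a ∈ P with ∑ i, a i = v, Polynomial.C (∏ i, y i ^ a i) * q a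
  have hQ : Q ≠ 0 := by
    intro h
    apply hy
    have := congrArg (fun p => Polynomial.coeff p b) h
    simp only [Q, Polynomial.finsetSum_coeff, Polynomial.coeff_C_mul, Polynomial.coeff_zero]
      at this
    rw [map_sum, ← this]
    refine Finset.sum_congr rfl fun a _ => ?_
    rw [MvPolynomial.eval_monomial, Finsupp.prod_fintype _ _ (by simp), mul_comm]
  have hroot : ∀ ζ ∈ S, Q.IsRoot (MvPolynomial.eval ζ l) := by
    intro ζ hζ
    obtain ⟨ω, hω⟩ := hJ ζ hζ y
    have := relation_at_zero g l P q hrel v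
      (fun a ha hq => hmin a (Finset.mem_filter.2 ⟨ha, hq⟩)) ζ ω y (hz ζ hζ) hω
    rw [Polynomial.IsRoot, Polynomial.eval_finsetSum]
    refine Eq.trans (Finset.sum_congr rfl fun a _ => ?_) this
    rw [Polynomial.eval_mul, Polynomial.eval_C]
  have hQdeg : Q.natDegree ≤ N - 1 := by
    refine Polynomial.natDegree_sum_le_of_forall_le _ _ fun a _ => ?_
    exact (Polynomial.natDegree_C_mul_le _ _).trans (hdeg a)
  calc S.card = (S.image fun ζ => MvPolynomial.eval ζ l).card :=
        (Finset.card_image_of_injOn hlinj).symm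
    _ ≤ Q.roots.toFinset.card := by
        refine Finset.card_le_card fun x hx => ?_
        obtain ⟨ζ, hζ, rfl⟩ := Finset.mem_image.1 hx
        rw [Multiset.mem_toFinset, Polynomial.mem_roots hQ]
        exact hroot ζ hζ
    _ ≤ Q.natDegree := (Multiset.toFinset_card_le _).trans (Polynomial.card_roots' Q)
    _ ≤ N := by omega

/-- A Bezout type bound for the nonsingular common zeros, with distinct first components, of a
system of bidegree `(1, D)`. -/
theorem card_nonsingular_zeros_le {U L E ι : Type*} [Fintype U] [Fintype L] [Fintype ι]
    [DecidableEq U] [DecidableEq L] [Field E] [Infinite E] (D : ℕ) (hD : 1 ≤ D)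
    (g : ι → MvPolynomial (U ⊕ L) E) (hg : ∀ i, g i ∈ bidegSubmodule U L E 1 D)
    (S : Finset (U ⊕ L → E)) (hz : ∀ ζ ∈ S, ∀ i, MvPolynomial.eval ζ (g i) = 0)
    (hinj : ∀ ζ ∈ S, ∀ ξ ∈ S, (∀ u, ζ (Sum.inl u) = ξ (Sum.inl u)) → ζ = ξ)
    (hJ : ∀ ζ ∈ S, ∀ ω : U ⊕ L → E,
      (∀ i, MvPolynomial.eval ζ (dirDeriv ω (g i)) = 0) → ω = 0) :
    S.card ≤ 2 * D ^ Fintype.card L *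
      (Fintype.card U + Fintype.card L).choose (Fintype.card L) := by
  classical
  let J : (U ⊕ L → E) → Matrix ι (U ⊕ L) E := fun ζ =>
    Matrix.of fun i s => MvPolynomial.eval ζ (MvPolynomial.pderiv s (g i))
  have hJ' : ∀ ζ ω i, MvPolynomial.eval ζ (dirDeriv ω (g i)) = (J ζ).mulVec ω i := by
    intro ζ ω i
    rw [eval_dirDeriv]
    exact Finset.sum_congr rfl fun s _ => mul_comm _ _
  obtain ⟨c, hc⟩ : ∃ c : (U ⊕ L) × ι → E, ∀ ζ ∈ S, MvPolynomial.eval c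
      (Matrix.mvPolynomialX (U ⊕ L) ι E *
        (J ζ).map (MvPolynomial.C : E →+* MvPolynomial ((U ⊕ L) × ι) E)).det ≠ 0 := by
    apply exists_common_nonroot
    intro ζ hζ h0
    have hker : LinearMap.ker (Matrix.mulVecLin (J ζ)) = ⊥ := by
      rw [LinearMap.ker_eq_bot']
      intro ω hω
      exact hJ ζ hζ ω fun i => by rw [hJ']; exact congrFun hω i
    obtain ⟨R, hR⟩ := LinearMap.exists_leftInverse_of_injective _ hker
    let C := LinearMap.toMatrix' R
    have hCJ : C * J ζ = 1 := by
      have := congrArg LinearMap.toMatrix' hR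
      rw [LinearMap.toMatrix'_comp, ← Matrix.toLin'_apply', LinearMap.toMatrix'_toLin'] at this
      simpa using this
    have := congrArg (MvPolynomial.eval fun x : (U ⊕ L) × ι => C x.1 x.2) h0
    rw [eval_det_generic_mul, map_zero] at this
    change (C * J ζ).det = 0 at this
    rw [hCJ, Matrix.det_one] at this
    exact one_ne_zero this
  let C : Matrix (U ⊕ L) ι E := Matrix.of fun s i => c (s, i)
  have hdet : ∀ ζ ∈ S, IsUnit (C * J ζ).det := by
    intro ζ hζ
    have := hc ζ hζ
    rw [eval_det_generic_mul] at this
    exact this.isUnit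
  refine card_nonsingular_zeros_le_of_square D hD (fun s => ∑ i, C s i • g i)
    (fun s => Submodule.sum_mem _ fun i _ => Submodule.smul_mem _ _ (hg i)) S
    (fun ζ hζ s => ?_) hinj (fun ζ hζ y => ⟨(C * J ζ)⁻¹.mulVec y, fun s => ?_⟩)
  · rw [map_sum]
    exact Finset.sum_eq_zero fun i _ => by rw [MvPolynomial.smul_eval, hz ζ hζ, mul_zero]
  · simp only [map_sum]
    simp_rw [Derivation.map_smul, MvPolynomial.smul_eval, hJ']
    change C.mulVec _ s = y s
    rw [Matrix.mulVec_mulVec, Matrix.mulVec_mulVec,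
      Matrix.mul_nonsing_inv _ (hdet ζ hζ), Matrix.one_mulVec]

section contraction
variable {F : Type*} [Field F] {n k : ℕ}

/-- Contraction of the array `t` with the vectors `z 0, …, z k`; the last index stays free. -/
def contract {R : Type*} [CommRing R] [Algebra F R] (t : (Fin (k + 1) → Fin n) → Fin n → F)
    (z : ℕ → Fin n → R) (w : Fin n) : R :=
  ∑ i : Fin (k + 1) → Fin n, algebraMap F R (t i w) * ∏ m : Fin (k + 1), z m (i m)

/-- The matrix of the bilinear form left by contracting all slots of `t` except `i` and the last
one. -/
def slotMatrix {R : Type*} [CommRing R] [Algebra F R] (t : (Fin (k + 1) → Fin n) → Fin n → F)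
    (i : ℕ) (z : ℕ → Fin n → R) : Matrix (Fin n) (Fin n) R :=
  Matrix.of fun l w => contract t (Function.update z i (Pi.single l 1)) w

variable {R : Type*} [CommRing R] [Algebra F R] (t : (Fin (k + 1) → Fin n) → Fin n → F)

theorem contract_congr {z z' : ℕ → Fin n → R} (h : ∀ m < k + 1, z m = z' m) :
    contract t z = contract t z' := by
  funext w
  refine Finset.sum_congr rfl fun i _ => ?_
  congr 1
  exact Finset.prod_congr rfl fun m _ => by rw [h m m.2]

theorem contract_update (z : ℕ → Fin n → R) (i : Fin (k + 1)) (y : Fin n → R) (w : Fin n) :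
    contract t (Function.update z i y) w = ∑ j : Fin (k + 1) → Fin n, algebraMap F R (t j w) *
      (y (j i) * ∏ m ∈ Finset.univ.erase i, z m (j m)) := by
  refine Finset.sum_congr rfl fun j _ => ?_
  rw [← Finset.mul_prod_erase _ _ (Finset.mem_univ i), Function.update_self]
  congr 2
  refine Finset.prod_congr rfl fun m hm => ?_
  rw [Function.update_of_ne]
  exact fun h => (Finset.mem_erase.1 hm).1 (Fin.val_injective h)

theorem contract_update_eq_vecMul (z : ℕ → Fin n → R) {i : ℕ} (hi : i < k + 1) (y : Fin n → R) :
    contract t (Function.update z i y) = Matrix.vecMul y (slotMatrix t i z) := by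
  funext w
  rw [contract_update t z ⟨i, hi⟩]
  simp only [Matrix.vecMul, dotProduct, slotMatrix, Matrix.of_apply]
  simp_rw [contract_update t z ⟨i, hi⟩, Finset.mul_sum]
  rw [Finset.sum_comm]
  refine Finset.sum_congr rfl fun j _ => ?_
  rw [Finset.sum_eq_single (j ⟨i, hi⟩)]
  · simp; ring
  · intro l _ hl
    rw [Pi.single_eq_of_ne hl.symm]; ring
  · simp

theorem contract_eq_vecMul (z : ℕ → Fin n → R) {i : ℕ} (hi : i < k + 1) :
    contract t z = Matrix.vecMul (z i) (slotMatrix t i z) := by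
  rw [← contract_update_eq_vecMul t z hi, Function.update_eq_self]

theorem slotMatrix_congr {i : ℕ} {z z' : ℕ → Fin n → R}
    (h : ∀ m < k + 1, m ≠ i → z m = z' m) : slotMatrix t i z = slotMatrix t i z' := by
  ext l w
  refine congrFun (contract_congr t fun m hm => ?_) w
  by_cases hmi : m = i
  · subst hmi; simp
  · simp [hmi, h m hm]

theorem contract_map {S : Type*} [CommRing S] [Algebra F S] (φ : R →ₐ[F] S)
    (z : ℕ → Fin n → R) (w : Fin n) :
    φ (contract t z w) = contract t (fun m l => φ (z m l)) w := by
  simp [contract, map_sum, map_prod]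

theorem slotMatrix_map {S : Type*} [CommRing S] [Algebra F S] (φ : R →ₐ[F] S) (i : ℕ)
    (z : ℕ → Fin n → R) :
    (slotMatrix t i z).map φ = slotMatrix t i (fun m l => φ (z m l)) := by
  ext l w
  simp only [slotMatrix, Matrix.map_apply, Matrix.of_apply, contract_map]
  congr 1
  funext m j
  by_cases hmi : m = i
  · subst hmi
    by_cases hj : j = l
    · subst hj; simp
    · simp [hj]
  · simp [hmi]

theorem contract_smul (z : ℕ → Fin n → R) (c : ℕ → R) :
    contract t (fun m => c m • z m) = (∏ m : Fin (k + 1), c m) • contract t z := by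
  funext w
  simp only [contract, Pi.smul_apply, smul_eq_mul, Finset.prod_mul_distrib, Finset.mul_sum]
  exact Finset.sum_congr rfl fun i _ => by ring

theorem slotMatrix_smul (i : ℕ) (z : ℕ → Fin n → R) (c : ℕ → R) :
    slotMatrix t i (fun m => c m • z m)
      = (∏ m : Fin (k + 1), Function.update c i 1 m) • slotMatrix t i z := by
  ext l w
  simp only [slotMatrix, Matrix.of_apply, Matrix.smul_apply]
  rw [← Pi.smul_apply, ← contract_smul]
  congr 1
  funext m
  by_cases hmi : m = i
  · subst hmi; simp
  · simp [hmi]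

theorem contract_derivation (D : Derivation F R R) (z : ℕ → Fin n → R) (w : Fin n) :
    D (contract t z w)
      = ∑ m : Fin (k + 1), contract t (Function.update z m fun l => D (z m l)) w := by
  classical
  have hprod : ∀ (s : Finset (Fin (k + 1))) (f : Fin (k + 1) → R),
      D (∏ m ∈ s, f m) = ∑ m ∈ s, D (f m) * ∏ j ∈ s.erase m, f j := by
    intro s f
    induction s using Finset.induction_on with
    | empty => simp
    | insert a s ha ih =>
      rw [Finset.prod_insert ha, Derivation.leibniz, ih, Finset.sum_insert ha,
        Finset.erase_insert ha, smul_eq_mul, smul_eq_mul, Finset.mul_sum, add_comm]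
      congr 1
      · ring
      · refine Finset.sum_congr rfl fun m hm => ?_
        have hne : a ≠ m := fun h => ha (h ▸ hm)
        rw [Finset.erase_insert_of_ne hne, Finset.prod_insert
          (fun h => ha (Finset.mem_of_mem_erase h))]
        ring
  simp_rw [contract_update t z]
  rw [Finset.sum_comm, contract, map_sum]
  refine Finset.sum_congr rfl fun i _ => ?_
  rw [Derivation.leibniz, Derivation.map_algebraMap, smul_zero, add_zero, hprod, smul_eq_mul,
    Finset.mul_sum]

end contraction

section matrices
variable {n : ℕ}

theorem exists_rows_linearIndependent {m n K : Type*} [Fintype m] [Fintype n] [Field K]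
    (M : Matrix m n K) {ρ : ℕ} (hρ : ρ ≤ M.rank) :
    ∃ J : Fin ρ → m, LinearIndependent K fun b => M (J b) := by
  obtain ⟨f, hf, -, hli⟩ := Submodule.exists_fun_fin_finrank_span_eq K (Set.range M.row)
  rw [Matrix.rank_eq_finrank_span_row] at hρ
  choose J hJ using hf
  refine ⟨fun b => J (Fin.castLE hρ b), ?_⟩
  have := hli.comp (Fin.castLE hρ) (Fin.castLE_injective hρ)
  have e : (fun b => M (J (Fin.castLE hρ b))) = f ∘ Fin.castLE hρ := funext fun b => hJ _
  rw [e]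
  exact this

theorem exists_minor_ne_zero {m n K : Type*} [Fintype m] [Fintype n] [Field K]
    (M : Matrix m n K) {ρ : ℕ} (hρ : ρ ≤ M.rank) :
    ∃ (J : Fin ρ → m) (I : Fin ρ → n), (M.submatrix J I).det ≠ 0 := by
  obtain ⟨J, hJ⟩ := exists_rows_linearIndependent M hρ
  have h1 : (Matrix.transpose (M.submatrix J id)).rank = ρ := by
    rw [Matrix.rank_transpose, LinearIndependent.rank_matrix (M := M.submatrix J id) hJ, Fintype.card_fin]
  obtain ⟨I, hI⟩ := exists_rows_linearIndependent _ h1.ge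
  refine ⟨J, I, ?_⟩
  have := Matrix.linearIndependent_rows_iff_isUnit.1
    (show LinearIndependent K (Matrix.transpose (M.submatrix J I)).row from hI)
  rw [Matrix.isUnit_iff_isUnit_det, Matrix.det_transpose] at this
  exact this.ne_zero

variable {R : Type*} [CommRing R] {ρ : ℕ}

/-- The square matrix of the vectors `Γ b` multiplied by `M`, restricted to the columns `I`. -/
def pivot (M : Matrix (Fin n) (Fin n) R) (Γ : Fin ρ → Fin n → R) (I : Fin ρ → Fin n) :
    Matrix (Fin ρ) (Fin ρ) R :=
  Matrix.of fun b c => Matrix.vecMul (Γ b) M (I c)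

/-- Coefficients expressing the projection of `τ` along the span of `Γ`. -/
def pivotCoeff (M : Matrix (Fin n) (Fin n) R) (Γ : Fin ρ → Fin n → R) (I : Fin ρ → Fin n)
    (τ : Fin n → R) : Fin ρ → R :=
  Matrix.vecMul (fun c => Matrix.vecMul τ M (I c)) (pivot M Γ I).adjugate

/-- The multiple of `τ` modified by a combination of the `Γ b` so that its product with `M`
vanishes on the columns `I`. -/
def pivotStep (M : Matrix (Fin n) (Fin n) R) (Γ : Fin ρ → Fin n → R) (I : Fin ρ → Fin n)
    (τ : Fin n → R) : Fin n → R :=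
  (pivot M Γ I).det • τ - ∑ b, pivotCoeff M Γ I τ b • Γ b

theorem vecMul_pivotStep (M : Matrix (Fin n) (Fin n) R) (Γ : Fin ρ → Fin n → R)
    (I : Fin ρ → Fin n) (τ : Fin n → R) (c : Fin ρ) :
    Matrix.vecMul (pivotStep M Γ I τ) M (I c) = 0 := by
  have h1 : Matrix.vecMul (∑ b, pivotCoeff M Γ I τ b • Γ b) M (I c)
      = Matrix.vecMul (pivotCoeff M Γ I τ) (pivot M Γ I) c := by
    rw [Matrix.sum_vecMul, Finset.sum_apply]
    simp [Matrix.vecMul, dotProduct, pivot, Finset.mul_sum, mul_assoc]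
  rw [pivotStep, Matrix.sub_vecMul, Pi.sub_apply, h1, Matrix.smul_vecMul, Pi.smul_apply,
    pivotCoeff, Matrix.vecMul_vecMul, Matrix.adjugate_mul, Matrix.vecMul_smul, Matrix.vecMul_one]
  simp

theorem pivot_map {S : Type*} [CommRing S] (φ : R →+* S) (M : Matrix (Fin n) (Fin n) R)
    (Γ : Fin ρ → Fin n → R) (I : Fin ρ → Fin n) :
    (pivot M Γ I).map φ = pivot (M.map φ) (fun b l => φ (Γ b l)) I := by
  ext b c
  simp [pivot, Matrix.vecMul, dotProduct, map_sum]

theorem pivot_det_map {S : Type*} [CommRing S] (φ : R →+* S) (M : Matrix (Fin n) (Fin n) R)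
    (Γ : Fin ρ → Fin n → R) (I : Fin ρ → Fin n) :
    φ (pivot M Γ I).det = (pivot (M.map φ) (fun b l => φ (Γ b l)) I).det := by
  rw [RingHom.map_det, RingHom.mapMatrix_apply, pivot_map]

theorem pivotCoeff_map {S : Type*} [CommRing S] (φ : R →+* S) (M : Matrix (Fin n) (Fin n) R)
    (Γ : Fin ρ → Fin n → R) (I : Fin ρ → Fin n) (τ : Fin n → R) (b : Fin ρ) :
    φ (pivotCoeff M Γ I τ b)
      = pivotCoeff (M.map φ) (fun b l => φ (Γ b l)) I (fun l => φ (τ l)) b := by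
  rw [pivotCoeff, RingHom.map_vecMul, pivotCoeff, ← pivot_map]
  have := RingHom.map_adjugate φ (pivot M Γ I)
  rw [RingHom.mapMatrix_apply, RingHom.mapMatrix_apply] at this
  rw [← this]
  congr 2
  funext c
  simp [Matrix.vecMul, dotProduct, map_sum]

theorem pivotStep_map {S : Type*} [CommRing S] (φ : R →+* S) (M : Matrix (Fin n) (Fin n) R)
    (Γ : Fin ρ → Fin n → R) (I : Fin ρ → Fin n) (τ : Fin n → R) (l : Fin n) :
    φ (pivotStep M Γ I τ l)
      = pivotStep (M.map φ) (fun b l => φ (Γ b l)) I (fun l => φ (τ l)) l := by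
  simp only [pivotStep, Pi.sub_apply, Pi.smul_apply, smul_eq_mul, map_sub, map_mul,
    pivot_det_map, Finset.sum_apply, map_sum, pivotCoeff_map]

variable {K : Type*} [Field K]

theorem le_rank_of_pivot_ne_zero {M : Matrix (Fin n) (Fin n) K} {Γ : Fin ρ → Fin n → K}
    {I : Fin ρ → Fin n} (h : (pivot M Γ I).det ≠ 0) : ρ ≤ M.rank := by
  have h1 : pivot M Γ I = (Matrix.of Γ * M).submatrix id I := rfl
  have h2 := Matrix.rank_of_det_ne_zero h
  rw [Fintype.card_fin] at h2
  calc ρ = (pivot M Γ I).rank := h2.symm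
    _ ≤ (Matrix.of Γ * M).rank := by rw [h1]; exact Matrix.rank_submatrix_le _ _ _
    _ ≤ M.rank := Matrix.rank_mul_le_right _ _

theorem sum_smul_vecMul_eq_zero_of_pivot {M : Matrix (Fin n) (Fin n) K} {Γ : Fin ρ → Fin n → K}
    {I : Fin ρ → Fin n} (h : (pivot M Γ I).det ≠ 0) (c : Fin ρ → K)
    (hc : ∀ j, (∑ b, c b • Matrix.vecMul (Γ b) M) (I j) = 0) : c = 0 := by
  refine Matrix.eq_zero_of_vecMul_eq_zero h ?_
  funext j
  rw [Pi.zero_apply, ← hc j, Finset.sum_apply]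
  rfl

theorem vecMul_eq_zero_of_pivot {M : Matrix (Fin n) (Fin n) K} {Γ : Fin ρ → Fin n → K}
    {I : Fin ρ → Fin n} (h : (pivot M Γ I).det ≠ 0) (hM : M.rank ≤ ρ) {y : Fin n → K}
    (hy : ∀ c, Matrix.vecMul y M (I c) = 0) : Matrix.vecMul y M = 0 := by
  have hli : LinearIndependent K fun b => Matrix.vecMul (Γ b) M := by
    rw [Fintype.linearIndependent_iff]
    intro c hc
    exact congrFun (sum_smul_vecMul_eq_zero_of_pivot h c fun j => by rw [hc]; rfl)
  have hle : Submodule.span K (Set.range fun b => Matrix.vecMul (Γ b) M)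
      ≤ LinearMap.range (Matrix.vecMulLinear M) := by
    rw [Submodule.span_le]
    rintro _ ⟨b, rfl⟩
    exact ⟨Γ b, rfl⟩
  have heq := Submodule.eq_of_le_of_finrank_le hle (by
    rw [finrank_span_eq_card hli, Fintype.card_fin]
    refine le_trans (le_of_eq ?_) hM
    rw [← Matrix.rank_transpose, Matrix.rank, Matrix.mulVecLin_transpose])
  have hmem : Matrix.vecMul y M ∈ Submodule.span K (Set.range fun b => Matrix.vecMul (Γ b) M) := by
    rw [heq]; exact ⟨y, rfl⟩
  obtain ⟨c, hc⟩ := (Submodule.mem_span_range_iff_exists_fun K).1 hmem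
  have hc0 : c = 0 := sum_smul_vecMul_eq_zero_of_pivot h c fun j => by rw [hc, hy]
  rw [← hc, hc0]
  simp

theorem vecMul_pivotStep_eq_zero {M : Matrix (Fin n) (Fin n) K} {Γ : Fin ρ → Fin n → K}
    {I : Fin ρ → Fin n} (h : (pivot M Γ I).det ≠ 0) (hM : M.rank ≤ ρ) (τ : Fin n → K) :
    Matrix.vecMul (pivotStep M Γ I τ) M = 0 :=
  vecMul_eq_zero_of_pivot h hM (vecMul_pivotStep M Γ I τ)

theorem pivotStep_of_vecMul_eq_zero (M : Matrix (Fin n) (Fin n) R) (Γ : Fin ρ → Fin n → R)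
    (I : Fin ρ → Fin n) {τ : Fin n → R} (h : Matrix.vecMul τ M = 0) :
    pivotStep M Γ I τ = (pivot M Γ I).det • τ := by
  have : pivotCoeff M Γ I τ = 0 := by
    rw [pivotCoeff, h]
    exact Matrix.zero_vecMul _
  simp [pivotStep, this]

theorem pivot_smul (M : Matrix (Fin n) (Fin n) R) (Γ : Fin ρ → Fin n → R) (I : Fin ρ → Fin n)
    (c : R) : pivot (c • M) Γ I = c • pivot M Γ I := by
  ext b j
  simp [pivot, Matrix.vecMul_smul]

end matrices

section tower
variable {F : Type*} [Field F] {n k : ℕ} (t : (Fin (k + 1) → Fin n) → Fin n → F)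

section ring
variable {R : Type*} [CommRing R] [Algebra F R]

/-- The sequence that follows `x` before `i` and `a` from `i` on. -/
def mix {V : Type*} (i : ℕ) (x a : ℕ → V) : ℕ → V := fun m => if m < i then x m else a m

/-- The matrix of the slots `i` and last, when the slots before `i` are filled from `x` and the
slots after `i` from `a`. -/
def baseMatrix (a : ℕ → Fin n → R) (i : ℕ) (x : ℕ → Fin n → R) : Matrix (Fin n) (Fin n) R :=
  slotMatrix t i (mix i x a)

theorem baseMatrix_congr {a : ℕ → Fin n → R} {i : ℕ} {x y : ℕ → Fin n → R}
    (h : ∀ m < i, x m = y m) : baseMatrix t a i x = baseMatrix t a i y := by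
  refine slotMatrix_congr t fun m _ _ => ?_
  by_cases hm : m < i
  · simp [mix, hm, h m hm]
  · simp [mix, hm]

theorem baseMatrix_map {S : Type*} [CommRing S] [Algebra F S] (φ : R →ₐ[F] S)
    (a : ℕ → Fin n → R) (i : ℕ) (x : ℕ → Fin n → R) :
    (baseMatrix t a i x).map φ
      = baseMatrix t (fun m l => φ (a m l)) i (fun m l => φ (x m l)) := by
  rw [baseMatrix, slotMatrix_map, baseMatrix]
  congr 1
  funext m l
  by_cases hm : m < i <;> simp [mix, hm]

theorem contract_mix_succ (a : ℕ → Fin n → R) {i : ℕ} (hi : i < k + 1) (x : ℕ → Fin n → R) :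
    contract t (mix (i + 1) x a) = Matrix.vecMul (x i) (baseMatrix t a i x) := by
  rw [contract_eq_vecMul t _ hi]
  congr 1
  · simp [mix]
  · refine slotMatrix_congr t fun m _ hm => ?_
    have : m < i + 1 ↔ m < i := by omega
    simp [mix, this]

variable {ρ : ℕ → ℕ} (I : ∀ m, Fin (ρ m) → Fin n) (Γ : ∀ m, Fin (ρ m) → Fin n → R)
  (τ a : ℕ → Fin n → R)

/-- Successive modification of the seeds `τ` by the vectors `Γ`, each step killing the columns
`I` of the current matrix. -/
def tower (i : ℕ) : Fin n → R :=
  pivotStep (slotMatrix t i fun m => if _h : m < i then tower m else a m) (Γ i) (I i) (τ i)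
termination_by i

/-- The pivot determinant at step `i` of `tower`. -/
def towerDet (i : ℕ) : R :=
  (pivot (baseMatrix t a i (tower t I Γ τ a)) (Γ i) (I i)).det

theorem tower_eq (i : ℕ) : tower t I Γ τ a i
    = pivotStep (baseMatrix t a i (tower t I Γ τ a)) (Γ i) (I i) (τ i) := by
  rw [tower]
  rfl

theorem tower_map {S : Type*} [CommRing S] [Algebra F S] (φ : R →ₐ[F] S) (i : ℕ) :
    (fun l => φ (tower t I Γ τ a i l))
      = tower t I (fun m b l => φ (Γ m b l)) (fun m l => φ (τ m l)) (fun m l => φ (a m l)) i := by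
  induction i using Nat.strong_induction_on with
  | _ i ih =>
    funext l
    rw [tower_eq, tower_eq]
    have := pivotStep_map (φ : R →+* S) (baseMatrix t a i (tower t I Γ τ a)) (Γ i) (I i) (τ i) l
    refine this.trans ?_
    rw [← (baseMatrix_map t φ a i (tower t I Γ τ a)).trans (baseMatrix_congr t ih)]
    rfl

theorem baseMatrix_tower_map {S : Type*} [CommRing S] [Algebra F S] (φ : R →ₐ[F] S) (i : ℕ) :
    (baseMatrix t a i (tower t I Γ τ a)).map φ = baseMatrix t (fun m l => φ (a m l)) i
      (tower t I (fun m b l => φ (Γ m b l)) (fun m l => φ (τ m l)) (fun m l => φ (a m l))) :=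
  (baseMatrix_map t φ a i _).trans
    (baseMatrix_congr t fun m _ => tower_map t I Γ τ a φ m)

theorem towerDet_map {S : Type*} [CommRing S] [Algebra F S] (φ : R →ₐ[F] S) (i : ℕ) :
    φ (towerDet t I Γ τ a i) = towerDet t I (fun m b l => φ (Γ m b l)) (fun m l => φ (τ m l))
      (fun m l => φ (a m l)) i := by
  have := pivot_det_map (φ : R →+* S) (baseMatrix t a i (tower t I Γ τ a)) (Γ i) (I i)
  refine this.trans ?_
  rw [towerDet, ← baseMatrix_tower_map]
  rfl

end ring

variable {E : Type*} [Field E] [Algebra F E] (a : ℕ → Fin n → E)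

theorem baseMatrix_smul (i : ℕ) {c : ℕ → E} (hc : ∀ m < i, c m ≠ 0) (x : ℕ → Fin n → E) :
    ∃ s : E, s ≠ 0 ∧ baseMatrix t a i (fun m => c m • x m) = s • baseMatrix t a i x := by
  refine ⟨∏ m : Fin (k + 1), Function.update (mix i c 1) i 1 m, ?_, ?_⟩
  · refine Finset.prod_ne_zero_iff.2 fun m _ => ?_
    by_cases hm : (m : ℕ) = i
    · simp [hm]
    · by_cases hmi : (m : ℕ) < i
      · simp [hm, hmi, mix, hc _ hmi]
      · simp [hm, hmi, mix]
  · rw [baseMatrix, baseMatrix, ← slotMatrix_smul]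
    congr 1
    funext m
    by_cases hm : m < i <;> simp [mix, hm]

theorem rank_smul_of_ne_zero {s : E} (hs : s ≠ 0) (M : Matrix (Fin n) (Fin n) E) :
    (s • M).rank = M.rank :=
  Matrix.rank_smul_of_mem_nonZeroDivisors M (mem_nonZeroDivisors_of_ne_zero hs)

/-- Sequences whose matrices have successively maximal ranks, each vector lying in the kernel of
the corresponding matrix. -/
def extremal : ℕ → Set (ℕ → Fin n → E)
  | 0 => Set.univ
  | i + 1 => {x | x ∈ extremal i ∧
      (∀ y ∈ extremal i, (baseMatrix t a i y).rank ≤ (baseMatrix t a i x).rank) ∧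
      Matrix.vecMul (x i) (baseMatrix t a i x) = 0}

/-- The maximal rank at step `i`. -/
noncomputable def maxRank (i : ℕ) : ℕ :=
  sSup ((fun x => (baseMatrix t a i x).rank) '' extremal t a i)

theorem extremal_congr {i : ℕ} {x y : ℕ → Fin n → E} (h : ∀ m < i, x m = y m) :
    x ∈ extremal t a i ↔ y ∈ extremal t a i := by
  induction i with
  | zero => simp [extremal]
  | succ i ih =>
    have h' : ∀ m < i, x m = y m := fun m hm => h m (by omega)
    simp only [extremal, Set.mem_ofPred_eq, ih h', baseMatrix_congr t h', h i (by omega)]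

theorem vecMul_eq_zero_of_mem_extremal {i m : ℕ} (hm : m < i) {x : ℕ → Fin n → E}
    (hx : x ∈ extremal t a i) : Matrix.vecMul (x m) (baseMatrix t a m x) = 0 := by
  induction i with
  | zero => omega
  | succ i ih =>
    rcases Nat.lt_succ_iff_lt_or_eq.1 hm with h | rfl
    · exact ih h hx.1
    · exact hx.2.2

theorem bddAbove_ranks (i : ℕ) :
    BddAbove ((fun x => (baseMatrix t a i x).rank) '' extremal t a i) := by
  refine ⟨n, ?_⟩
  rintro _ ⟨x, _, rfl⟩
  exact (Matrix.rank_le_card_width _).trans (Fintype.card_fin n).le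

theorem rank_le_maxRank {i : ℕ} {x : ℕ → Fin n → E} (hx : x ∈ extremal t a i) :
    (baseMatrix t a i x).rank ≤ maxRank t a i :=
  le_csSup (bddAbove_ranks t a i) ⟨x, hx, rfl⟩

theorem mem_extremal_succ {i : ℕ} {x : ℕ → Fin n → E} (hx : x ∈ extremal t a i)
    (hr : maxRank t a i ≤ (baseMatrix t a i x).rank)
    (h0 : Matrix.vecMul (x i) (baseMatrix t a i x) = 0) : x ∈ extremal t a (i + 1) :=
  ⟨hx, fun _ hy => (rank_le_maxRank t a hy).trans hr, h0⟩

theorem exists_rank_eq_maxRank (i : ℕ) :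
    ∃ x ∈ extremal t a i, (baseMatrix t a i x).rank = maxRank t a i := by
  have key : ∀ i, (extremal t a i).Nonempty →
      ∃ x ∈ extremal t a i, (baseMatrix t a i x).rank = maxRank t a i := fun i hi =>
    Nat.sSup_mem (hi.image _) (bddAbove_ranks t a i)
  refine key i ?_
  induction i with
  | zero => exact ⟨0, trivial⟩
  | succ i ih =>
    obtain ⟨x, hx, hr⟩ := key i ih
    have hc : ∀ m < i, Function.update x i 0 m = x m := fun m hm => by
      rw [Function.update_of_ne hm.ne]
    refine ⟨Function.update x i 0, mem_extremal_succ t a ((extremal_congr t a hc).2 hx) ?_ ?_⟩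
    · rw [baseMatrix_congr t hc, hr]
    · rw [Function.update_self, Matrix.zero_vecMul]

theorem rank_eq_maxRank_of_mem {i m : ℕ} (hm : m < i) {x : ℕ → Fin n → E}
    (hx : x ∈ extremal t a i) : (baseMatrix t a m x).rank = maxRank t a m := by
  induction i with
  | zero => omega
  | succ i ih =>
    rcases Nat.lt_succ_iff_lt_or_eq.1 hm with h | rfl
    · exact ih h hx.1
    · obtain ⟨y, hy, hr⟩ := exists_rank_eq_maxRank t a m
      exact le_antisymm (rank_le_maxRank t a hx.1) (hr ▸ hx.2.1 y hy)

theorem smul_mem_extremal {i : ℕ} {x : ℕ → Fin n → E} (hx : x ∈ extremal t a i) {c : ℕ → E}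
    (hc : ∀ m < i, c m ≠ 0) : (fun m => c m • x m) ∈ extremal t a i := by
  induction i with
  | zero => trivial
  | succ i ih =>
    have hc' : ∀ m < i, c m ≠ 0 := fun m hm => hc m (by omega)
    obtain ⟨s, hs, h⟩ := baseMatrix_smul t a i hc' x
    refine mem_extremal_succ t a (ih hx.1 hc') ?_ ?_
    · rw [h, rank_smul_of_ne_zero hs, rank_eq_maxRank_of_mem t a (Nat.lt_succ_self i) hx]
    · rw [h, Matrix.smul_vecMul, Matrix.vecMul_smul, hx.2.2, smul_zero, smul_zero]

variable {ρ : ℕ → ℕ} (I : ∀ m, Fin (ρ m) → Fin n) (Γ : ∀ m, Fin (ρ m) → Fin n → E)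

theorem tower_of_chain {j : ℕ} {x : ℕ → Fin n → E}
    (hx : ∀ m < j, Matrix.vecMul (x m) (baseMatrix t a m x) = 0)
    (hp : ∀ m < j, (pivot (baseMatrix t a m x) (Γ m) (I m)).det ≠ 0) {τ : ℕ → Fin n → E}
    (hτ : ∀ m < j, τ m = x m) :
    (∀ m < j, towerDet t I Γ τ a m ≠ 0) ∧
      ∃ s : E, s ≠ 0 ∧ baseMatrix t a j (tower t I Γ τ a) = s • baseMatrix t a j x := by
  have key : ∀ m < j, ∃ c : E, c ≠ 0 ∧ tower t I Γ τ a m = c • x m ∧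
      towerDet t I Γ τ a m ≠ 0 := by
    intro m
    induction m using Nat.strong_induction_on with
    | _ m ih =>
      intro hm
      have ih' : ∀ l, ∃ c : E, l < m → c ≠ 0 ∧ tower t I Γ τ a l = c • x l := fun l => by
        by_cases hl : l < m
        · obtain ⟨c, h1, h2, -⟩ := ih l hl (hl.trans hm)
          exact ⟨c, fun _ => ⟨h1, h2⟩⟩
        · exact ⟨0, fun h => absurd h hl⟩
      choose c hc using ih'
      obtain ⟨s, hs, h⟩ := baseMatrix_smul t a m (fun l hl => (hc l hl).1) x
      have hbase : baseMatrix t a m (tower t I Γ τ a) = s • baseMatrix t a m x :=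
        (baseMatrix_congr t fun l hl => (hc l hl).2).trans h
      have hdet : towerDet t I Γ τ a m ≠ 0 := by
        rw [towerDet, hbase, pivot_smul, Matrix.det_smul]
        exact mul_ne_zero (pow_ne_zero _ hs) (hp m hm)
      refine ⟨_, hdet, ?_, hdet⟩
      rw [tower_eq, towerDet, hτ m hm, pivotStep_of_vecMul_eq_zero]
      rw [hbase, Matrix.vecMul_smul, hx m hm, smul_zero]
  refine ⟨fun m hm => (key m hm).choose_spec.2.2, ?_⟩
  have key' : ∀ l, ∃ c : E, l < j → c ≠ 0 ∧ tower t I Γ τ a l = c • x l := fun l => by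
    by_cases hl : l < j
    · obtain ⟨c, h1, h2, -⟩ := key l hl
      exact ⟨c, fun _ => ⟨h1, h2⟩⟩
    · exact ⟨0, fun h => absurd h hl⟩
  choose c hc using key'
  obtain ⟨s, hs, h⟩ := baseMatrix_smul t a j (fun l hl => (hc l hl).1) x
  exact ⟨s, hs, (baseMatrix_congr t fun l hl => (hc l hl).2).trans h⟩

theorem tower_mem_extremal {i : ℕ} (hρ : ∀ m < i, maxRank t a m = ρ m) {τ : ℕ → Fin n → E}
    (hdet : ∀ m < i, towerDet t I Γ τ a m ≠ 0) : tower t I Γ τ a ∈ extremal t a i := by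
  induction i with
  | zero => trivial
  | succ i ih =>
    have hi := ih (fun m hm => hρ m (by omega)) fun m hm => hdet m (by omega)
    refine mem_extremal_succ t a hi ?_ ?_
    · rw [hρ i (by omega)]
      exact le_rank_of_pivot_ne_zero (hdet i (by omega))
    · have hr := rank_le_maxRank t a hi
      rw [hρ i (by omega)] at hr
      conv_lhs => rw [tower_eq]
      exact vecMul_pivotStep_eq_zero (hdet i (by omega)) hr _

end tower

section generalPosition
variable {F : Type*} [Field F] {n k : ℕ} (t : (Fin (k + 1) → Fin n) → Fin n → F)
variable {E : Type*} [Field E] [Algebra F E]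

theorem pivot_single {R : Type*} [CommRing R] {ρ : ℕ} (M : Matrix (Fin n) (Fin n) R)
    (J I : Fin ρ → Fin n) : pivot M (fun b => Pi.single (J b) 1) I = M.submatrix J I := by
  ext b c
  simp [pivot]

theorem le_rank_of_minor {m n K : Type*} [Fintype m] [Fintype n] [Field K] {M : Matrix m n K}
    {r : ℕ} {J : Fin r → m} {I : Fin r → n} (h : (M.submatrix J I).det ≠ 0) : r ≤ M.rank := by
  have h2 := Matrix.rank_of_det_ne_zero h
  rw [Fintype.card_fin] at h2
  exact h2.symm.le.trans (Matrix.rank_submatrix_le _ _ _)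

theorem exists_extremal_with_minors [NeZero n] (a : ℕ → Fin n → E) {ρ : ℕ → ℕ} {j r : ℕ}
    (hρ : ∀ m < j, maxRank t a m = ρ m) (hr : r ≤ maxRank t a j) :
    ∃ x ∈ extremal t a j, ∃ J I : ∀ m, Fin (ρ m) → Fin n,
      (∀ m < j, ((baseMatrix t a m x).submatrix (J m) (I m)).det ≠ 0) ∧
      ∃ J' I' : Fin r → Fin n, ((baseMatrix t a j x).submatrix J' I').det ≠ 0 := by
  obtain ⟨x, hx, hxr⟩ := exists_rank_eq_maxRank t a j
  have h1 : ∀ m, ∃ J I : Fin (ρ m) → Fin n,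
      m < j → ((baseMatrix t a m x).submatrix J I).det ≠ 0 := by
    intro m
    by_cases hm : m < j
    · obtain ⟨J, I, h⟩ := exists_minor_ne_zero (baseMatrix t a m x) (ρ := ρ m)
        (by rw [rank_eq_maxRank_of_mem t a hm hx, hρ m hm])
      exact ⟨J, I, fun _ => h⟩
    · exact ⟨fun _ => 0, fun _ => 0, fun h => absurd h hm⟩
  choose J I h using h1
  obtain ⟨J', I', h'⟩ := exists_minor_ne_zero (baseMatrix t a j x) (ρ := r) (by rw [hxr]; exact hr)
  exact ⟨x, hx, J, I, h, J', I', h'⟩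

theorem exists_general_position [Infinite E] [NeZero n] {β : Type*} (B : Finset β)
    (A : β → ℕ → Fin n → E) {ρ : ℕ → ℕ} {j r : ℕ}
    (hρ : ∀ v ∈ B, ∀ m < j, maxRank t (A v) m = ρ m) (hr : ∀ v ∈ B, r ≤ maxRank t (A v) j) :
    ∃ (τ : ℕ → Fin n → E) (Γ : ∀ m, Fin (ρ m) → Fin n → E), ∀ v ∈ B,
      ∃ (x : ℕ → Fin n → E) (I : ∀ m, Fin (ρ m) → Fin n) (lam : ∀ m, Fin (ρ m) → E),
        x ∈ extremal t (A v) j ∧ (∀ m < j, x m = τ m + ∑ b, lam m b • Γ m b) ∧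
        (∀ m < j, (pivot (baseMatrix t (A v) m x) (Γ m) (I m)).det ≠ 0) ∧
        r ≤ (baseMatrix t (A v) j x).rank := by
  have h0 : ∀ v, ∃ (x : ℕ → Fin n → E) (J I : ∀ m, Fin (ρ m) → Fin n) (J' I' : Fin r → Fin n),
      v ∈ B → x ∈ extremal t (A v) j ∧
      (∀ m < j, ((baseMatrix t (A v) m x).submatrix (J m) (I m)).det ≠ 0) ∧
      ((baseMatrix t (A v) j x).submatrix J' I').det ≠ 0 := by
    intro v
    by_cases hv : v ∈ B
    · obtain ⟨x, hx, J, I, h1, J', I', h2⟩ :=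
        exists_extremal_with_minors t (A v) (hρ v hv) (hr v hv)
      exact ⟨x, J, I, J', I', fun _ => ⟨hx, h1, h2⟩⟩
    · exact ⟨0, fun _ _ => 0, fun _ _ => 0, fun _ => 0, fun _ => 0, fun h => absurd h hv⟩
  choose x J I J' I' h0 using h0
  let σ := (ℕ × Fin n) ⊕ ((m : ℕ) × Fin (ρ m) × Fin n)
  let ΓX : ∀ m, Fin (ρ m) → Fin n → MvPolynomial σ E :=
    fun m b l => MvPolynomial.X (Sum.inr ⟨m, b, l⟩)
  let τX : ℕ → Fin n → MvPolynomial σ E := fun m l => MvPolynomial.X (Sum.inl (m, l))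
  let AX : β → ℕ → Fin n → MvPolynomial σ E := fun v m l => MvPolynomial.C (A v m l)
  let f : β → MvPolynomial σ E := fun v =>
    (∏ m ∈ Finset.range j, towerDet t (I v) ΓX τX (AX v) m) *
      ((baseMatrix t (AX v) j (tower t (I v) ΓX τX (AX v))).submatrix (J' v) (I' v)).det
  have hf : ∀ v (z : σ → E), MvPolynomial.eval z (f v)
      = (∏ m ∈ Finset.range j, towerDet t (I v) (fun m b l => z (Sum.inr ⟨m, b, l⟩))
          (fun m l => z (Sum.inl (m, l))) (A v) m) *
        ((baseMatrix t (A v) j (tower t (I v) (fun m b l => z (Sum.inr ⟨m, b, l⟩))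
          (fun m l => z (Sum.inl (m, l))) (A v))).submatrix (J' v) (I' v)).det := by
    intro v z
    let φ : MvPolynomial σ E →ₐ[F] E := (MvPolynomial.aeval z).restrictScalars F
    have hφ : ∀ q, MvPolynomial.eval z q = φ q := fun q =>
      (MvPolynomial.aeval_eq_eval z ▸ rfl : _)
    have e1 : (fun m b l => φ (ΓX m b l)) = fun m b l => z (Sum.inr ⟨m, b, l⟩) := by
      funext m b l; rw [← hφ]; exact MvPolynomial.eval_X _
    have e2 : (fun m l => φ (τX m l)) = fun m l => z (Sum.inl (m, l)) := by
      funext m l; rw [← hφ]; exact MvPolynomial.eval_X _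
    have e3 : (fun m l => φ (AX v m l)) = A v := by
      funext m l; rw [← hφ]; exact MvPolynomial.eval_C _
    have e4 := baseMatrix_tower_map t (I v) ΓX τX (AX v) φ j
    rw [e1, e2, e3] at e4
    rw [hφ, map_mul, map_prod]
    congr 1
    · refine Finset.prod_congr rfl fun m _ => ?_
      rw [towerDet_map, e1, e2, e3]
    · rw [AlgHom.map_det, AlgHom.mapMatrix_apply, ← Matrix.submatrix_map, e4]
  have hne : ∀ v ∈ B, f v ≠ 0 := by
    intro v hv h
    obtain ⟨hx, h1, h2⟩ := h0 v hv
    have := hf v (Sum.elim (fun c => x v c.1 c.2) fun c => (Pi.single (J v c.1 c.2.1) 1 :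
      Fin n → E) c.2.2)
    rw [h, map_zero] at this
    simp only [Sum.elim_inl, Sum.elim_inr] at this
    obtain ⟨h3, s, hs, h4⟩ := tower_of_chain t (A v) (I v)
      (fun m b l => (Pi.single (J v m b) 1 : Fin n → E) l)
      (fun m hm => vecMul_eq_zero_of_mem_extremal t (A v) hm hx)
      (fun m hm => by
        have := pivot_single (baseMatrix t (A v) m (x v)) (J v m) (I v m)
        exact this ▸ h1 m hm) (τ := fun m l => x v m l) (fun m _ => rfl)
    refine mul_ne_zero (Finset.prod_ne_zero_iff.2 fun m hm => h3 m (Finset.mem_range.1 hm)) ?_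
      this.symm
    rw [h4, Matrix.submatrix_smul]
    simp only [Pi.smul_apply]
    rw [Matrix.det_smul]
    exact mul_ne_zero (pow_ne_zero _ hs) h2
  obtain ⟨z, hz⟩ := exists_common_nonroot B f hne
  refine ⟨fun m l => z (Sum.inl (m, l)), fun m b l => z (Sum.inr ⟨m, b, l⟩), fun v hv => ?_⟩
  have hzv := hz v hv
  rw [hf] at hzv
  set Γ : ∀ m, Fin (ρ m) → Fin n → E := fun m b l => z (Sum.inr ⟨m, b, l⟩)
  set τ : ℕ → Fin n → E := fun m l => z (Sum.inl (m, l))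
  have hd : ∀ m < j, towerDet t (I v) Γ τ (A v) m ≠ 0 := fun m hm =>
    Finset.prod_ne_zero_iff.1 (left_ne_zero_of_mul hzv) m (Finset.mem_range.2 hm)
  have hm := right_ne_zero_of_mul hzv
  have hmem := tower_mem_extremal t (A v) (I v) Γ (hρ v hv) hd
  set c : ℕ → E := fun m => (towerDet t (I v) Γ τ (A v) m)⁻¹ with hc
  have hc0 : ∀ m < j, c m ≠ 0 := fun m hm => inv_ne_zero (hd m hm)
  refine ⟨fun m => c m • tower t (I v) Γ τ (A v) m, I v, fun m b =>
    -(c m * pivotCoeff (baseMatrix t (A v) m (tower t (I v) Γ τ (A v))) (Γ m) (I v m) (τ m) b),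
    smul_mem_extremal t (A v) hmem hc0, fun m hm => ?_, fun m hm => ?_, ?_⟩
  · beta_reduce
    rw [tower_eq, pivotStep, smul_sub, smul_smul]
    have : c m * (pivot (baseMatrix t (A v) m (tower t (I v) Γ τ (A v))) (Γ m) (I v m)).det = 1 :=
      inv_mul_cancel₀ (hd m hm)
    rw [this, one_smul, Finset.smul_sum, sub_eq_add_neg, ← Finset.sum_neg_distrib]
    congr 1
    exact Finset.sum_congr rfl fun b _ => by rw [smul_smul, neg_smul]
  · obtain ⟨s, hs, h⟩ := baseMatrix_smul t (A v) m (fun l hl => hc0 l (hl.trans hm))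
      (tower t (I v) Γ τ (A v))
    rw [h, pivot_smul, Matrix.det_smul]
    exact mul_ne_zero (pow_ne_zero _ hs) (hd m hm)
  · obtain ⟨s, hs, h⟩ := baseMatrix_smul t (A v) j hc0 (tower t (I v) Γ τ (A v))
    rw [h, rank_smul_of_ne_zero hs]
    exact le_rank_of_minor hm

end generalPosition

section jets
variable {F : Type*} [Field F] {n k : ℕ} (t : (Fin (k + 1) → Fin n) → Fin n → F)
variable {E : Type*} [Field E] [Algebra F E]

theorem eval_derivation_contract {σ : Type*} (ω ζ : σ → E)
    (z : ℕ → Fin n → MvPolynomial σ E) (w : Fin n) :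
    MvPolynomial.eval ζ (dirDeriv ω (contract t z w))
      = ∑ m : Fin (k + 1), Matrix.vecMul (fun l => MvPolynomial.eval ζ (dirDeriv ω (z m l)))
          (slotMatrix t m fun m l => MvPolynomial.eval ζ (z m l)) w := by
  have h1 := contract_derivation t ((dirDeriv ω).restrictScalars F) z w
  rw [Derivation.restrictScalars_apply] at h1
  rw [h1, map_sum]
  refine Finset.sum_congr rfl fun m _ => ?_
  have h2 := contract_map t ((MvPolynomial.aeval ζ).restrictScalars F)
    (Function.update z m fun l => dirDeriv ω (z m l)) w
  have hφ : ∀ q, (MvPolynomial.aeval ζ : MvPolynomial σ E →ₐ[E] E).restrictScalars F q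
      = MvPolynomial.eval ζ q := fun q => by
    rw [AlgHom.restrictScalars_apply, MvPolynomial.aeval_eq_eval]
  simp only [hφ] at h2
  refine h2.trans ?_
  rw [← contract_update_eq_vecMul t _ m.2]
  congr 1
  funext m' l
  by_cases hm : m' = m
  · subst hm; simp
  · simp [hm]

theorem eval_contract {σ : Type*} (ζ : σ → E) (z : ℕ → Fin n → MvPolynomial σ E) (w : Fin n) :
    MvPolynomial.eval ζ (contract t z w)
      = contract t (fun m l => MvPolynomial.eval ζ (z m l)) w := by
  have h2 := contract_map t ((MvPolynomial.aeval ζ).restrictScalars F) z w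
  have hφ : ∀ q, (MvPolynomial.aeval ζ : MvPolynomial σ E →ₐ[E] E).restrictScalars F q
      = MvPolynomial.eval ζ q := fun q => by
    rw [AlgHom.restrictScalars_apply, MvPolynomial.aeval_eq_eval]
  simpa only [hφ] using h2

theorem affine_mem_bideg {U L α : Type*} [Fintype U] [Fintype L] [Fintype α] (c : E)
    (e : α → U ⊕ L) (d : α → E) {a : ℕ} (b : ℕ)
    (he : ∀ i, (MvPolynomial.X (e i) : MvPolynomial (U ⊕ L) E) ∈ bidegSubmodule U L E a b) :
    MvPolynomial.C c + ∑ i, MvPolynomial.X (e i) * MvPolynomial.C (d i)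
      ∈ bidegSubmodule U L E a b := by
  refine Submodule.add_mem _ (bideg_C _ _ _) (Submodule.sum_mem _ fun i _ => ?_)
  rw [mul_comm, ← MvPolynomial.smul_eq_C_mul]
  exact Submodule.smul_mem _ _ (he i)

theorem contract_mem_bideg {U L : Type*} [Fintype U] [Fintype L]
    (z : ℕ → Fin n → MvPolynomial (U ⊕ L) E) (w : Fin n) {j : ℕ} (hj : j < k + 1)
    (hz : ∀ m l, z m l ∈ bidegSubmodule U L E (if m = j then 1 else 0) 1) :
    contract t z w ∈ bidegSubmodule U L E 1 (k + 1) := by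
  refine Submodule.sum_mem _ fun i _ => ?_
  have h1 := bideg_prod Finset.univ (fun m : Fin (k + 1) => z m (i m)) _ _ fun m _ => hz m (i m)
  have h2 : (∑ m : Fin (k + 1), if (m : ℕ) = j then 1 else 0) = 1 := by
    rw [Finset.sum_eq_single ⟨j, hj⟩]
    · simp
    · intro m _ hm
      rw [if_neg fun h => hm (Fin.ext h)]
    · simp
  rw [h2] at h1
  simp only [Finset.sum_const, Finset.card_univ, Fintype.card_fin, smul_eq_mul, mul_one] at h1
  rw [IsScalarTower.algebraMap_apply F E (MvPolynomial (U ⊕ L) E), ← Algebra.smul_def]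
  exact Submodule.smul_mem _ _ h1

/-- The span of the partial contractions with the vectors `Γ` in slots before `j`. -/
def tangentSpan {ρ : ℕ → ℕ} (Γ : ∀ m, Fin (ρ m) → Fin n → E) (j : ℕ) (a x : ℕ → Fin n → E) :
    Submodule E (Fin n → E) :=
  Submodule.span E (Set.range fun c : (m : Fin j) × Fin (ρ m) =>
    Matrix.vecMul (Γ c.1 c.2) (slotMatrix t c.1 (mix j x a)))

theorem finrank_tangentSpan_le {ρ : ℕ → ℕ} (Γ : ∀ m, Fin (ρ m) → Fin n → E) (j : ℕ)
    (a x : ℕ → Fin n → E) :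
    Module.finrank E (tangentSpan t Γ j a x) ≤ ∑ m ∈ Finset.range j, ρ m := by
  refine (finrank_range_le_card _).trans ?_
  simp [Finset.sum_range]

theorem tangent_eq_zero {κ : ℕ} {ρ : ℕ → ℕ} (I : ∀ m, Fin (ρ m) → Fin n)
    (Γ : ∀ m, Fin (ρ m) → Fin n → E) {j : ℕ} (hj0 : 0 < j) (hj : j < k + 1)
    (A x : ℕ → Fin n → E) (M : Fin κ → Fin n → E)
    (hp : ∀ m < j, (pivot (baseMatrix t A m x) (Γ m) (I m)).det ≠ 0)
    (hM : ∀ ω : Fin κ → E, Matrix.vecMul (∑ c, ω c • M c) (baseMatrix t A j x)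
      ∈ tangentSpan t Γ j A x → ω = 0)
    (u : Fin κ → E) (lam : (m : Fin j) × Fin (ρ m) → E) (γ : ℕ → Fin n → E)
    (hγ : ∀ m : Fin j, γ m = ∑ b, lam ⟨m, b⟩ • Γ m b)
    (h : ∀ i < j, ∑ m : Fin (k + 1), Matrix.vecMul
      (mix (i + 1) γ (Function.update 0 j (∑ c, u c • M c)) m)
      (slotMatrix t m (mix (i + 1) x A)) = 0) :
    u = 0 ∧ lam = 0 := by
  have hu : u = 0 := by
    apply hM
    have h1 := h (j - 1) (by omega)
    rw [Nat.sub_add_cancel hj0, ← Finset.add_sum_erase _ _ (Finset.mem_univ ⟨j, hj⟩)] at h1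
    simp only [mix, lt_irrefl, if_false, Function.update_self] at h1
    rw [baseMatrix, eq_neg_of_add_eq_zero_left h1]
    refine Submodule.neg_mem _ (Submodule.sum_mem _ fun m hm => ?_)
    have hmj : (m : ℕ) ≠ j := fun h => (Finset.mem_erase.1 hm).1 (Fin.ext h)
    by_cases hlt : (m : ℕ) < j
    · rw [if_pos hlt, hγ ⟨m, hlt⟩, Matrix.sum_vecMul]
      refine Submodule.sum_mem _ fun b _ => ?_
      rw [Matrix.smul_vecMul]
      exact Submodule.smul_mem _ _ (Submodule.subset_span ⟨⟨⟨m, hlt⟩, b⟩, rfl⟩)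
    · rw [if_neg hlt, Function.update_of_ne hmj, Pi.zero_apply, Matrix.zero_vecMul]
      exact Submodule.zero_mem _
  refine ⟨hu, ?_⟩
  have key : ∀ m : ℕ, ∀ hm : m < j, (fun b => lam ⟨⟨m, hm⟩, b⟩) = 0 := by
    intro m
    induction m using Nat.strong_induction_on with
    | _ m ih =>
      intro hm
      have h1 := h m hm
      rw [Finset.sum_eq_single ⟨m, by omega⟩] at h1
      · simp only [mix, Nat.lt_succ_self, if_true] at h1
        have h2 : slotMatrix t m (mix (m + 1) x A) = baseMatrix t A m x := by
          refine slotMatrix_congr t fun l _ hl => ?_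
          have : l < m + 1 ↔ l < m := by omega
          simp [mix, this]
        rw [h2, hγ ⟨m, hm⟩] at h1
        refine sum_smul_vecMul_eq_zero_of_pivot (hp m hm) _ fun c => ?_
        rw [Matrix.sum_vecMul] at h1
        simp only [Matrix.smul_vecMul] at h1
        rw [h1, Pi.zero_apply]
      · intro l _ hl
        have hlm : (l : ℕ) ≠ m := fun h => hl (Fin.ext h)
        rcases lt_or_ge (l : ℕ) (m + 1) with hlt | hge
        · have hlj : (l : ℕ) < j := by omega
          have : γ l = 0 := by
            rw [hγ ⟨l, hlj⟩]
            refine Finset.sum_eq_zero fun b _ => ?_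
            have := congrFun (ih l (by omega) hlj) b
            simp only [Pi.zero_apply] at this
            rw [this, zero_smul]
          simp [mix, hlt, this]
        · have hz : mix (m + 1) γ (Function.update 0 j (∑ c, u c • M c)) l = 0 := by
            simp only [mix, if_neg (not_lt.2 hge), hu]
            by_cases hlj : (l : ℕ) = j
            · simp [hlj]
            · simp [hlj]
          rw [hz, Matrix.zero_vecMul]
      · simp
  funext ⟨m, b⟩
  exact congrFun (key m m.2) b

theorem card_jets_le [Infinite E] {κ : ℕ} {ρ : ℕ → ℕ} {j : ℕ} (hj0 : 0 < j) (hj : j < k + 1)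
    (a τ : ℕ → Fin n → E) (Γ : ∀ m, Fin (ρ m) → Fin n → E) (v₀ : Fin n → E)
    (M : Fin κ → Fin n → E) {β : Type*} (P : Finset β) (u : β → Fin κ → E)
    (hinj : ∀ p ∈ P, ∀ q ∈ P, u p = u q → p = q) (v : β → Fin n → E)
    (hv : ∀ p ∈ P, v p = v₀ + ∑ c, u p c • M c) (x : β → ℕ → Fin n → E)
    (I : β → ∀ m, Fin (ρ m) → Fin n) (lam : β → ∀ m, Fin (ρ m) → E)
    (hx : ∀ p ∈ P, ∀ m < j, x p m = τ m + ∑ b, lam p m b • Γ m b)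
    (hchain : ∀ p ∈ P, ∀ m < j, Matrix.vecMul (x p m)
      (baseMatrix t (Function.update a j (v p)) m (x p)) = 0)
    (hp : ∀ p ∈ P, ∀ m < j,
      (pivot (baseMatrix t (Function.update a j (v p)) m (x p)) (Γ m) (I p m)).det ≠ 0)
    (hM : ∀ p ∈ P, ∀ ω : Fin κ → E,
      Matrix.vecMul (∑ c, ω c • M c) (baseMatrix t (Function.update a j (v p)) j (x p))
        ∈ tangentSpan t Γ j (Function.update a j (v p)) (x p) → ω = 0) :
    P.card ≤ 2 * (k + 1) ^ (∑ m ∈ Finset.range j, ρ m) *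
      (κ + ∑ m ∈ Finset.range j, ρ m).choose (∑ m ∈ Finset.range j, ρ m) := by
  classical
  let L := (m : Fin j) × Fin (ρ m)
  have hL : Fintype.card L = ∑ m ∈ Finset.range j, ρ m := by
    simp [L, Finset.sum_range]
  let ζ : β → Fin κ ⊕ L → E := fun p => Sum.elim (u p) fun c => lam p c.1 c.2
  let xP : ℕ → Fin n → MvPolynomial (Fin κ ⊕ L) E := fun m l =>
    if h : m < j then MvPolynomial.C (τ m l) +
      ∑ b : Fin (ρ m), MvPolynomial.X (Sum.inr ⟨⟨m, h⟩, b⟩) * MvPolynomial.C (Γ m b l) else 0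
  let vP : Fin n → MvPolynomial (Fin κ ⊕ L) E := fun l => MvPolynomial.C (v₀ l) +
    ∑ c, MvPolynomial.X (Sum.inl c) * MvPolynomial.C (M c l)
  let AP : ℕ → Fin n → MvPolynomial (Fin κ ⊕ L) E :=
    Function.update (fun m l => MvPolynomial.C (a m l)) j vP
  let g : Fin j × Fin n → MvPolynomial (Fin κ ⊕ L) E :=
    fun i => contract t (mix (i.1 + 1) xP AP) i.2
  have hbid : ∀ i, g i ∈ bidegSubmodule (Fin κ) L E 1 (k + 1) := by
    intro i
    refine contract_mem_bideg t _ _ hj fun m l => ?_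
    by_cases h1 : m < i.1 + 1
    · have h2 : m < j := by omega
      simp only [mix, if_pos h1, xP, dif_pos h2, if_neg h2.ne]
      exact affine_mem_bideg _ _ _ _ fun b => bideg_X_inr _ _
    · simp only [mix, if_neg h1, AP]
      by_cases h2 : m = j
      · subst h2
        simp only [Function.update_self, if_true, vP]
        exact affine_mem_bideg _ _ _ _ fun b => bideg_X_inl _ _
      · rw [Function.update_of_ne h2, if_neg h2]
        exact bideg_C _ _ _
  have heval : ∀ p ∈ P, ∀ i : Fin j,
      (fun m l => MvPolynomial.eval (ζ p) (mix ((i : ℕ) + 1) xP AP m l))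
        = mix ((i : ℕ) + 1) (x p) (Function.update a j (v p)) := by
    intro p hpP i
    funext m l
    by_cases h1 : m < (i : ℕ) + 1
    · have h2 : m < j := by omega
      simp only [mix, if_pos h1, xP, dif_pos h2, hx p hpP m h2]
      simp [ζ]
    · simp only [mix, if_neg h1, AP]
      by_cases h2 : m = j
      · subst h2
        simp [vP, hv p hpP, ζ]
      · simp [Function.update_of_ne h2]
  have hderiv : ∀ p, ∀ ω : Fin κ ⊕ L → E, ∀ i : Fin j, ∀ m,
      (fun l => MvPolynomial.eval (ζ p) (dirDeriv ω (mix ((i : ℕ) + 1) xP AP m l)))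
        = mix ((i : ℕ) + 1) (fun m => if h : m < j then ∑ b, ω (Sum.inr ⟨⟨m, h⟩, b⟩) • Γ m b
          else 0) (Function.update 0 j (∑ c, ω (Sum.inl c) • M c)) m := by
    intro p ω i m
    have hC : ∀ c : E, dirDeriv ω (MvPolynomial.C c) = 0 := fun c => by
      rw [dirDeriv, ← MvPolynomial.algebraMap_eq, Derivation.map_algebraMap]
    have hX : ∀ s, dirDeriv ω (MvPolynomial.X s) = MvPolynomial.C (ω s) := fun s => by
      rw [dirDeriv, MvPolynomial.mkDerivation_X]
    funext l
    by_cases h1 : m < (i : ℕ) + 1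
    · have h2 : m < j := by omega
      simp only [mix, if_pos h1, xP, dif_pos h2]
      simp [hC, hX, Derivation.leibniz, mul_comm]
    · simp only [mix, if_neg h1, AP]
      by_cases h2 : m = j
      · subst h2
        simp [vP, hC, hX, Derivation.leibniz, mul_comm]
      · simp [Function.update_of_ne h2, hC]
  have hcard : (P.image ζ).card = P.card := by
    refine Finset.card_image_of_injOn fun p hpP q hqP hpq => hinj p hpP q hqP ?_
    funext c
    exact congrFun hpq (Sum.inl c)
  rw [← hcard, ← hL]
  refine (card_nonsingular_zeros_le (k + 1) (Nat.succ_pos k) g hbid (P.image ζ) ?_ ?_ ?_).trans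
    (by rw [Fintype.card_fin])
  · intro z hz i
    obtain ⟨p, hpP, rfl⟩ := Finset.mem_image.1 hz
    rw [eval_contract, heval p hpP, contract_mix_succ t _ (by omega), hchain p hpP _ i.1.2]
    rfl
  · intro z hz z' hz' h
    obtain ⟨p, hpP, rfl⟩ := Finset.mem_image.1 hz
    obtain ⟨q, hqP, rfl⟩ := Finset.mem_image.1 hz'
    rw [hinj p hpP q hqP (funext h)]
  · intro z hz ω hω
    obtain ⟨p, hpP, rfl⟩ := Finset.mem_image.1 hz
    obtain ⟨h1, h2⟩ := tangent_eq_zero t (I p) Γ hj0 hj (Function.update a j (v p)) (x p) M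
      (hp p hpP) (hM p hpP) (fun c => ω (Sum.inl c)) (fun c => ω (Sum.inr c))
      (fun m => if h : m < j then ∑ b, ω (Sum.inr ⟨⟨m, h⟩, b⟩) • Γ m b else 0)
      (fun m => by simp) fun i hi => by
        funext w
        have := hω (⟨i, hi⟩, w)
        rw [eval_derivation_contract] at this
        rw [heval p hpP ⟨i, hi⟩] at this
        rw [Finset.sum_apply]
        refine Eq.trans (Finset.sum_congr rfl fun m _ => ?_) this
        rw [hderiv p ω ⟨i, hi⟩ m]
    funext s
    rcases s with c | c
    · exact congrFun h1 c
    · exact congrFun h2 c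

end jets

section transverse
variable {F E : Type*} [Field F] [Field E] [Algebra F E] {n : ℕ}

theorem rank_map_algebraMap {m n : Type*} [Fintype m] [Fintype n] (M : Matrix m n F) :
    (M.map (algebraMap F E)).rank = M.rank := by
  refine le_antisymm ?_ ?_
  · obtain ⟨J, I, h⟩ := exists_minor_ne_zero (M.map (algebraMap F E)) le_rfl
    refine le_rank_of_minor (J := J) (I := I) fun h0 => h ?_
    rw [Matrix.submatrix_map, ← RingHom.mapMatrix_apply, ← RingHom.map_det, h0, map_zero]
  · obtain ⟨J, I, h⟩ := exists_minor_ne_zero M le_rfl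
    refine le_rank_of_minor (J := J) (I := I) ?_
    rw [Matrix.submatrix_map, ← RingHom.mapMatrix_apply, ← RingHom.map_det]
    exact (map_ne_zero _).2 h

variable (E) in
/-- Entrywise extension of scalars. -/
def extendVec (v : Fin n → F) : Fin n → E := fun l => algebraMap F E (v l)

open Classical in
theorem card_points_le [Fintype F] (W : Submodule E (Fin n → E)) :
    (Finset.univ.filter fun v : Fin n → F => extendVec E v ∈ W).card
      ≤ Fintype.card F ^ Module.finrank E W := by
  let WF : Submodule F (Fin n → F) :=
    { carrier := {v | extendVec E v ∈ W}
      add_mem' := fun {v w} hv hw => by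
        have : extendVec E (v + w) = extendVec E v + extendVec E w := by
          funext l; simp [extendVec]
        simp only [Set.mem_ofPred_eq, this]
        exact W.add_mem hv hw
      zero_mem' := by
        have : extendVec E (0 : Fin n → F) = 0 := by
          funext l; simp [extendVec]
        simp only [Set.mem_ofPred_eq, this]
        exact W.zero_mem
      smul_mem' := fun c v hv => by
        have : extendVec E (c • v) = algebraMap F E c • extendVec E v := by
          funext l; simp [extendVec]
        simp only [Set.mem_ofPred_eq, this]
        exact W.smul_mem _ hv }
  have hcard : (Finset.univ.filter fun v : Fin n → F => extendVec E v ∈ W).card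
      = Fintype.card F ^ Module.finrank F WF := by
    rw [← Module.card_eq_pow_finrank (K := F) (V := WF), Fintype.card_subtype]
    rfl
  rw [hcard]
  refine Nat.pow_le_pow_right Fintype.card_pos ?_
  let b := Module.finBasis F WF
  let M : Matrix (Fin (Module.finrank F WF)) (Fin n) F := Matrix.of fun i => (b i : Fin n → F)
  have hli : LinearIndependent F M.row :=
    b.linearIndependent.map' WF.subtype (Submodule.ker_subtype _)
  have h1 := LinearIndependent.rank_matrix hli
  rw [Fintype.card_fin, ← rank_map_algebraMap (E := E), Matrix.rank_eq_finrank_span_row] at h1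
  rw [← h1]
  refine Submodule.finrank_mono (Submodule.span_le.2 ?_)
  rintro _ ⟨i, rfl⟩
  exact (b i).2

/-- `M` extends to a family of vectors linearly independent modulo `W`. -/
def Transverse {κ : ℕ} (W : Submodule E (Fin n → E)) (M : Fin κ → Fin n → F) : Prop :=
  ∀ ω : Fin κ → E, ∑ c, ω c • extendVec E (M c) ∈ W → ω = 0

theorem transverse_cons {κ : ℕ} {W : Submodule E (Fin n → E)} {v : Fin n → F}
    {M : Fin κ → Fin n → F} (hv : extendVec E v ∉ W)
    (hM : Transverse (W ⊔ Submodule.span E {extendVec E v}) M) :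
    Transverse W (Fin.cons v M : Fin (κ + 1) → Fin n → F) := by
  intro ω hω
  rw [Fin.sum_univ_succ] at hω
  simp only [Fin.cons_zero, Fin.cons_succ] at hω
  have h1 : (fun c => ω (Fin.succ c)) = 0 := by
    refine hM _ ?_
    have h2 : ω 0 • extendVec E v ∈ W ⊔ Submodule.span E {extendVec E v} :=
      Submodule.smul_mem _ _ (Submodule.mem_sup_right (Submodule.mem_span_singleton_self _))
    have h3 := Submodule.sub_mem _ (Submodule.mem_sup_left hω) h2
    rwa [add_sub_cancel_left] at h3
  have h2 : ∀ c, ω (Fin.succ c) = 0 := fun c => congrFun h1 c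
  simp only [h2, zero_smul, Finset.sum_const_zero, add_zero] at hω
  have h3 : ω 0 = 0 := by
    by_contra h
    exact hv ((Submodule.smul_mem_iff _ h).1 hω)
  funext c
  refine Fin.cases h3 (fun c => h2 c) c

open Classical in
theorem card_not_transverse_le [Fintype F] (κ : ℕ) (W : Submodule E (Fin n → E)) {w : ℕ}
    (hw : Module.finrank E W ≤ w) :
    (Finset.univ.filter fun M : Fin κ → Fin n → F => ¬ Transverse W M).card * Fintype.card F ^ n
      + Fintype.card F ^ (n * κ) * Fintype.card F ^ w
      ≤ Fintype.card F ^ (n * κ) * Fintype.card F ^ (w + κ) := by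
  set q := Fintype.card F with hq
  have hq2 : 2 ≤ q := Fintype.one_lt_card
  induction κ generalizing W w with
  | zero =>
    have : (Finset.univ.filter fun M : Fin 0 → Fin n → F => ¬ Transverse W M) = ∅ := by
      refine Finset.filter_eq_empty_iff.2 fun M _ => not_not.2 fun ω _ => Subsingleton.elim _ _
    rw [this]
    simp
  | succ κ ih =>
    set G : (Fin n → F) → ℕ := fun v =>
      (Finset.univ.filter fun M : Fin κ → Fin n → F =>
        ¬ Transverse W (Fin.cons v M : Fin (κ + 1) → Fin n → F)).card with hG
    have hsum : (Finset.univ.filter fun M : Fin (κ + 1) → Fin n → F => ¬ Transverse W M).card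
        = ∑ v, G v := by
      simp only [hG, Finset.card_filter]
      rw [← Fintype.sum_prod_type' (f := fun (v : Fin n → F) (M : Fin κ → Fin n → F) =>
        if ¬ Transverse W (Fin.cons v M : Fin (κ + 1) → Fin n → F) then 1 else 0)]
      exact (Fintype.sum_equiv (Fin.consEquiv fun _ => Fin n → F) _ _ fun _ => rfl).symm
    have hstep : ∀ v, G v * q ^ n + q ^ (n * κ) * q ^ (w + 1) ≤ q ^ (n * κ) * q ^ (w + 1 + κ)
        + (if extendVec E v ∈ W then 1 else 0) * (q ^ (n * κ) * q ^ n) := by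
      intro v
      by_cases hv : extendVec E v ∈ W
      · rw [if_pos hv, one_mul, add_comm]
        refine add_le_add (Nat.mul_le_mul_left _ (Nat.pow_le_pow_right (by omega) (by omega)))
          (Nat.mul_le_mul_right _ ?_)
        refine (Finset.card_filter_le _ _).trans ?_
        simp [pow_mul, hq]
      · rw [if_neg hv, zero_mul, add_zero]
        refine le_trans ?_ (ih (W ⊔ Submodule.span E {extendVec E v}) (w := w + 1) ?_)
        · refine Nat.add_le_add_right (Nat.mul_le_mul_right _ (Finset.card_le_card ?_)) _
          intro M hM
          simp only [Finset.mem_filter, Finset.mem_univ, true_and] at hM ⊢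
          exact fun h => hM (transverse_cons hv h)
        · refine (Submodule.finrank_add_le_finrank_add_finrank _ _).trans ?_
          exact add_le_add hw (finrank_span_le_card _ |>.trans (by simp))
    have htot := Finset.sum_le_sum fun v (_ : v ∈ (Finset.univ : Finset (Fin n → F))) => hstep v
    have hlast : ∑ v : Fin n → F, (if extendVec E v ∈ W then 1 else 0) * (q ^ (n * κ) * q ^ n)
        = (Finset.univ.filter fun v : Fin n → F => extendVec E v ∈ W).card
          * (q ^ (n * κ) * q ^ n) := by
      rw [← Finset.sum_mul, ← Finset.card_filter]
    rw [Finset.sum_add_distrib, Finset.sum_add_distrib, hlast, ← Finset.sum_mul,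
      ← hsum] at htot
    simp only [Finset.sum_const, Finset.card_univ, Fintype.card_fun, Fintype.card_fin, ← hq,
      smul_eq_mul] at htot
    have hpts := (card_points_le (F := F) W).trans (Nat.pow_le_pow_right (by omega) hw)
    rw [← hq] at hpts
    have e1 : q ^ (n * (κ + 1)) = q ^ n * q ^ (n * κ) := by rw [← pow_add]; ring_nf
    have e2 : q ^ (w + 1) = q * q ^ w := by ring
    have e3 : q ^ (w + 1 + κ) = q ^ (w + (κ + 1)) := by ring_nf
    rw [e3] at htot
    rw [e2] at htot
    rw [e1]
    have h5 := Nat.mul_le_mul_right (q ^ (n * κ) * q ^ n) hpts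
    have h6 := Nat.mul_le_mul_right (q ^ n * q ^ (n * κ) * q ^ w) hq2
    nlinarith

open Classical in
theorem card_transverse_ge [Fintype F] {κ : ℕ} (W : Submodule E (Fin n → E))
    (hw : Module.finrank E W + κ + 1 ≤ n) :
    Fintype.card F ^ (n * κ)
      ≤ 2 * (Finset.univ.filter fun M : Fin κ → Fin n → F => Transverse W M).card := by
  have h1 := card_not_transverse_le (F := F) κ W le_rfl
  have hq2 : 2 ≤ Fintype.card F := Fintype.one_lt_card
  have h2 := Finset.card_filter_add_card_filter_not (s := (Finset.univ : Finset (Fin κ → Fin n → F)))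
    (fun M => Transverse W M)
  rw [Finset.card_univ, Fintype.card_fun, Fintype.card_fun, Fintype.card_fin, Fintype.card_fin,
    ← pow_mul] at h2
  set q := Fintype.card F
  set bad := (Finset.univ.filter fun M : Fin κ → Fin n → F => ¬ Transverse W M).card
  have h3 : bad * q ^ n ≤ q ^ (n * κ) * q ^ (n - 1) :=
    (Nat.le_of_add_right_le h1).trans
      (Nat.mul_le_mul_left _ (Nat.pow_le_pow_right (by omega) (by omega)))
  have h4 : q ^ n = q * q ^ (n - 1) := by
    rw [← pow_succ']; congr 1; omega
  rw [h4, ← mul_assoc] at h3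
  have h5 := Nat.le_of_mul_le_mul_right h3 (pow_pos (by omega) _)
  nlinarith

theorem finrank_comap_le {V V' : Type*} [AddCommGroup V] [Module E V] [FiniteDimensional E V]
    [AddCommGroup V'] [Module E V'] [FiniteDimensional E V'] (f : V →ₗ[E] V')
    (S : Submodule E V') :
    Module.finrank E (S.comap f) + Module.finrank E (LinearMap.range f)
      ≤ Module.finrank E V + Module.finrank E S := by
  have h1 := LinearMap.finrank_range_add_finrank_ker (S.mkQ ∘ₗ f)
  have h2 : LinearMap.ker (S.mkQ ∘ₗ f) = S.comap f := by
    rw [LinearMap.ker_comp, Submodule.ker_mkQ]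
  have h3 := LinearMap.finrank_range_add_finrank_ker (S.mkQ.domRestrict (LinearMap.range f))
  have h4 : LinearMap.range (S.mkQ.domRestrict (LinearMap.range f))
      = LinearMap.range (S.mkQ ∘ₗ f) := by
    rw [LinearMap.range_domRestrict, LinearMap.range_comp]
  have h5 : Module.finrank E (LinearMap.ker (S.mkQ.domRestrict (LinearMap.range f)))
      ≤ Module.finrank E S := by
    rw [LinearMap.ker_domRestrict, Submodule.ker_mkQ]
    exact LinearMap.finrank_le_finrank_of_injective (f :=
      (LinearMap.range f).subtype.restrict (p := Submodule.comap _ S) (q := S) fun x hx => hx)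
      fun x y h => by
        have := congrArg Subtype.val h
        exact Subtype.ext (Subtype.ext this)
  rw [h2] at h1
  rw [h4] at h3
  omega

end transverse

section highRank
variable {F : Type*} [Field F] {n k : ℕ} (t : (Fin (k + 1) → Fin n) → Fin n → F)
variable (E : Type*) [Field E] [Algebra F E]

/-- The base sequence `a` over the extension field, with the entry `j` replaced by `v`. -/
def baseAt (a : ℕ → Fin n → F) (j : ℕ) (v : Fin n → F) : ℕ → Fin n → E :=
  Function.update (fun m => extendVec E (a m)) j (extendVec E v)

open Classical in
theorem card_high_rank_le [Fintype F] [Infinite E] [NeZero n] (a : ℕ → Fin n → F) {ρ : ℕ → ℕ}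
    {j κ r : ℕ} (hj0 : 0 < j) (hj : j < k + 1) (hκ : ∑ m ∈ Finset.range j, ρ m + κ + 1 ≤ r)
    (B : Finset (Fin n → F)) (hρ : ∀ v ∈ B, ∀ m < j, maxRank t (baseAt E a j v) m = ρ m)
    (hr : ∀ v ∈ B, r ≤ maxRank t (baseAt E a j v) j) :
    B.card * Fintype.card F ^ κ ≤ 2 * (2 * (k + 1) ^ (∑ m ∈ Finset.range j, ρ m) *
      (κ + ∑ m ∈ Finset.range j, ρ m).choose (∑ m ∈ Finset.range j, ρ m)) *
      Fintype.card F ^ n := by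
  obtain ⟨τ, Γ, h0⟩ := exists_general_position t B (baseAt E a j) hρ hr
  have h1 : ∀ v, ∃ (x : ℕ → Fin n → E) (I : ∀ m, Fin (ρ m) → Fin n) (lam : ∀ m, Fin (ρ m) → E),
      v ∈ B → x ∈ extremal t (baseAt E a j v) j ∧
        (∀ m < j, x m = τ m + ∑ b, lam m b • Γ m b) ∧
        (∀ m < j, (pivot (baseMatrix t (baseAt E a j v) m x) (Γ m) (I m)).det ≠ 0) ∧
        r ≤ (baseMatrix t (baseAt E a j v) j x).rank := by
    intro v
    by_cases hv : v ∈ B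
    · obtain ⟨x, I, lam, h⟩ := h0 v hv
      exact ⟨x, I, lam, fun _ => h⟩
    · exact ⟨0, fun _ _ => 0, 0, fun h => absurd h hv⟩
  choose x I lam h1 using h1
  set s := ∑ m ∈ Finset.range j, ρ m with hs
  set NB := 2 * (k + 1) ^ s * (κ + s).choose s
  let W : (Fin n → F) → Submodule E (Fin n → E) := fun v =>
    (tangentSpan t Γ j (baseAt E a j v) (x v)).comap
      (Matrix.vecMulLinear (baseMatrix t (baseAt E a j v) j (x v)))
  have hW : ∀ v ∈ B, Module.finrank E (W v) + κ + 1 ≤ n := by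
    intro v hv
    have e1 := finrank_comap_le (Matrix.vecMulLinear (baseMatrix t (baseAt E a j v) j (x v)))
      (tangentSpan t Γ j (baseAt E a j v) (x v))
    have e2 : Module.finrank E (LinearMap.range
        (Matrix.vecMulLinear (baseMatrix t (baseAt E a j v) j (x v))))
        = (baseMatrix t (baseAt E a j v) j (x v)).rank := by
      rw [← Matrix.rank_transpose, Matrix.rank, Matrix.mulVecLin_transpose]
    have e3 := finrank_tangentSpan_le t Γ j (baseAt E a j v) (x v)
    have e4 := (h1 v hv).2.2.2
    rw [e2, Module.finrank_fin_fun] at e1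
    change Module.finrank E (W v) + _ ≤ _ at e1
    omega
  let T : Finset ((Fin n → F) × (Fin κ → Fin n → F) × (Fin κ → F)) :=
    (B ×ˢ Finset.univ).filter fun p => Transverse (W p.1) p.2.1
  have hT : B.card * (Fintype.card F ^ (n * κ) * Fintype.card F ^ κ) ≤ 2 * T.card := by
    have e1 : T.card = ∑ v ∈ B, (Finset.univ.filter fun M : Fin κ → Fin n → F =>
        Transverse (W v) M).card * Fintype.card F ^ κ := by
      rw [Finset.card_filter, Finset.sum_product]
      refine Finset.sum_congr rfl fun v _ => ?_
      rw [← Finset.univ_product_univ, Finset.sum_product, Finset.card_filter, Finset.sum_mul]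
      refine Finset.sum_congr rfl fun M _ => ?_
      refine (Finset.sum_const (s := (Finset.univ : Finset (Fin κ → F)))
        (if Transverse (W v) M then 1 else 0)).trans ?_
      rw [Finset.card_univ, Fintype.card_fun, Fintype.card_fin, smul_eq_mul, mul_comm]
    rw [e1, Finset.mul_sum, ← smul_eq_mul, ← Finset.sum_const]
    refine Finset.sum_le_sum fun v hv => ?_
    rw [← mul_assoc]
    exact Nat.mul_le_mul_right _ (card_transverse_ge (W v) (hW v hv))
  have hfib : T.card ≤ NB * (Finset.univ : Finset ((Fin n → F) × (Fin κ → Fin n → F))).card := by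
    refine Finset.card_le_mul_card_image_of_maps_to
      (f := fun p => (p.1 - ∑ c, p.2.2 c • p.2.1 c, p.2.1)) (fun p _ => Finset.mem_univ _) _ ?_
    rintro ⟨v₀, M⟩ -
    have hmem : ∀ p ∈ T.filter fun p => (p.1 - ∑ c, p.2.2 c • p.2.1 c, p.2.1) = (v₀, M),
        p.1 ∈ B ∧ Transverse (W p.1) M ∧ p.2.1 = M ∧ p.1 = v₀ + ∑ c, p.2.2 c • M c := by
      intro p hp
      simp only [T, Finset.mem_filter, Finset.mem_product, Finset.mem_univ, and_true,
        Prod.mk.injEq] at hp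
      obtain ⟨⟨h2, h3⟩, h4, h5⟩ := hp
      refine ⟨h2, h5 ▸ h3, h5, ?_⟩
      rw [← h4, h5, sub_add_cancel]
    refine card_jets_le t hj0 hj (fun m => extendVec E (a m)) τ Γ (extendVec E v₀)
      (fun c => extendVec E (M c)) _ (fun p => extendVec E p.2.2) ?_ (fun p => extendVec E p.1) ?_
      (fun p => x p.1) (fun p => I p.1) (fun p => lam p.1) ?_ ?_ ?_ ?_
    · intro p hp p' hp' h
      obtain ⟨-, -, e1, e2⟩ := hmem p hp
      obtain ⟨-, -, e1', e2'⟩ := hmem p' hp'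
      have e3 : p.2.2 = p'.2.2 := funext fun c =>
        (algebraMap F E).injective (congrFun h c)
      rw [e3] at e2
      exact Prod.ext (e2.trans e2'.symm) (Prod.ext (e1.trans e1'.symm) e3)
    · intro p hp
      obtain ⟨-, -, -, e2⟩ := hmem p hp
      funext l
      have := congrArg (algebraMap F E) (congrFun e2 l)
      simpa [extendVec, Algebra.smul_def] using this
    · exact fun p hp => (h1 p.1 (hmem p hp).1).2.1
    · exact fun p hp m hm =>
        vecMul_eq_zero_of_mem_extremal t _ hm (h1 p.1 (hmem p hp).1).1
    · exact fun p hp => (h1 p.1 (hmem p hp).1).2.2.1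
    · exact fun p hp ω hω => (hmem p hp).2.1 ω hω
  rw [Finset.card_univ, Fintype.card_prod, Fintype.card_fun, Fintype.card_fun, Fintype.card_fun,
    Fintype.card_fin, Fintype.card_fin, ← pow_mul] at hfib
  have hq : 0 < Fintype.card F ^ (n * κ) := pow_pos Fintype.card_pos _
  refine Nat.le_of_mul_le_mul_left ?_ hq
  nlinarith

end highRank

section selection

theorem choose_mul_four_pow_le (κ s : ℕ) : (κ + s).choose s * 4 ^ κ ≤ 5 ^ (κ + s) := by
  have h := add_pow (1 : ℕ) 4 (κ + s)
  have h1 := Finset.single_le_sum (f := fun m => 1 ^ m * 4 ^ (κ + s - m) * (κ + s).choose m)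
    (fun _ _ => Nat.zero_le _) (Finset.mem_range.2 (show s < κ + s + 1 by omega))
  simp only [Nat.cast_id] at h
  rw [← h] at h1
  simpa [mul_comm] using h1

theorem mul_pow_le_of_binomial_bound {b N q D s κ m : ℕ} (hq : 2 ≤ q)
    (h : b * q ^ (3 * κ) ≤ 2 * (2 * D ^ s * (3 * κ + s).choose s) * N)
    (hm : 2 + 5 * D * s + m ≤ 2 * κ) : b * q ^ m ≤ N := by
  have h1 := choose_mul_four_pow_le (3 * κ) s
  have h2 : 5 ^ (3 * κ) ≤ 2 ^ κ * 4 ^ (3 * κ) := by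
    rw [pow_mul, pow_mul, ← mul_pow]
    exact Nat.pow_le_pow_left (by norm_num) _
  have h3 : (5 * D) ^ s ≤ 2 ^ (5 * D * s) := by
    rw [pow_mul]
    exact Nat.pow_le_pow_left Nat.lt_two_pow_self.le _
  have h4 : b * q ^ (3 * κ) * 4 ^ (3 * κ) ≤ 2 ^ (2 + 5 * D * s + κ) * N * 4 ^ (3 * κ) := by
    calc b * q ^ (3 * κ) * 4 ^ (3 * κ)
        ≤ 2 * (2 * D ^ s * (3 * κ + s).choose s) * N * 4 ^ (3 * κ) := Nat.mul_le_mul_right _ h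
      _ = 4 * D ^ s * N * ((3 * κ + s).choose s * 4 ^ (3 * κ)) := by ring
      _ ≤ 4 * D ^ s * N * 5 ^ (3 * κ + s) := Nat.mul_le_mul_left _ h1
      _ = 4 * N * (5 * D) ^ s * 5 ^ (3 * κ) := by rw [pow_add, mul_pow]; ring
      _ ≤ 4 * N * 2 ^ (5 * D * s) * (2 ^ κ * 4 ^ (3 * κ)) :=
        Nat.mul_le_mul (Nat.mul_le_mul_left _ h3) h2
      _ = 2 ^ (2 + 5 * D * s + κ) * N * 4 ^ (3 * κ) := by rw [pow_add, pow_add]; ring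
  have h5 := Nat.le_of_mul_le_mul_right h4 (by positivity)
  have h6 : 2 ^ (2 + 5 * D * s + κ) ≤ q ^ (3 * κ - m) :=
    (Nat.pow_le_pow_left hq _).trans (Nat.pow_le_pow_right (by omega) (by omega))
  have h7 : q ^ (3 * κ) = q ^ m * q ^ (3 * κ - m) := by rw [← pow_add]; congr 1; omega
  have h8 := h5.trans (Nat.mul_le_mul_right N h6)
  rw [h7, ← mul_assoc, mul_comm _ N] at h8
  exact Nat.le_of_mul_le_mul_right h8 (by positivity)

theorem card_mul_le_of_fibers {ι V : Type*} [Fintype ι] [DecidableEq ι] [Fintype V]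
    [DecidableEq V] [Nonempty V] (S : Finset (ι → V)) (j : ι) (Q : ℕ)
    (h : ∀ a : ι → V, (Finset.univ.filter fun v => Function.update a j v ∈ S).card * Q
      ≤ Fintype.card V) : S.card * Q ≤ Fintype.card (ι → V) := by
  let e : (ι → V) × V ≃ (ι → V) × V := Function.Involutive.toPerm
    (fun p => (Function.update p.1 j p.2, p.1 j)) fun p => by simp
  have h1 : ∑ a : ι → V, (Finset.univ.filter fun v => Function.update a j v ∈ S).card
      = S.card * Fintype.card V := by
    simp only [Finset.card_filter]
    rw [← Fintype.sum_prod_type' (f := fun (a : ι → V) (v : V) =>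
      if Function.update a j v ∈ S then 1 else 0)]
    refine (Fintype.sum_equiv e _ (fun p : (ι → V) × V => if p.1 ∈ S then 1 else 0)
      fun _ => rfl).trans ?_
    rw [Fintype.sum_prod_type]
    rw [Finset.sum_comm]
    simp [mul_comm]
  have h2 := Finset.sum_le_sum fun a (_ : a ∈ (Finset.univ : Finset (ι → V))) => h a
  rw [← Finset.sum_mul, h1, Finset.sum_const, Finset.card_univ, smul_eq_mul] at h2
  have h3 : S.card * Q * Fintype.card V ≤ Fintype.card (ι → V) * Fintype.card V := by
    rwa [mul_right_comm]
  exact Nat.le_of_mul_le_mul_right h3 Fintype.card_pos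

variable {F : Type*} [Field F] {n k : ℕ} (t : (Fin (k + 1) → Fin n) → Fin n → F)
variable (E : Type*) [Field E] [Algebra F E]

/-- Extension by zero of a finite sequence. -/
def extendSeq (a : Fin (k + 1) → Fin n → F) : ℕ → Fin n → F :=
  fun m => if h : m < k + 1 then a ⟨m, h⟩ else 0

theorem extendSeq_update (a : Fin (k + 1) → Fin n → F) (j : Fin (k + 1)) (v : Fin n → F) :
    extendSeq (Function.update a j v) = Function.update (extendSeq a) j v := by
  funext m
  by_cases hm : m < k + 1
  · by_cases hj : m = j
    · subst hj
      simp only [extendSeq, Function.update_self, dif_pos hm, Fin.eta]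
    · have : (⟨m, hm⟩ : Fin (k + 1)) ≠ j := fun h => hj (congrArg Fin.val h)
      simp [extendSeq, hm, hj, this]
  · have : m ≠ j := fun h => hm (h ▸ j.2)
    simp [extendSeq, hm, this]

/-- The maximal rank at step `i` for a base sequence with entries in `F`. -/
noncomputable def baseRank (a : Fin (k + 1) → Fin n → F) (i : ℕ) : ℕ :=
  maxRank t (fun m => extendVec E (extendSeq a m)) i

theorem baseRank_update (a : Fin (k + 1) → Fin n → F) (j : Fin (k + 1)) (v : Fin n → F) (i : ℕ) :
    baseRank t E (Function.update a j v) i = maxRank t (baseAt E (extendSeq a) j v) i := by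
  rw [baseRank, extendSeq_update]
  congr 1
  funext m
  by_cases hm : m = j
  · subst hm; simp [baseAt]
  · simp [baseAt, hm]

theorem baseRank_zero (a : Fin (k + 1) → Fin n → F) :
    baseRank t E a 0 = (slotMatrix t 0 (extendSeq a)).rank := by
  obtain ⟨x, -, hx⟩ := exists_rank_eq_maxRank t (fun m => extendVec E (extendSeq a m)) 0
  rw [baseRank, ← hx, ← rank_map_algebraMap (F := F) (E := E) (slotMatrix t 0 (extendSeq a))]
  have := slotMatrix_map t (Algebra.ofId F E) 0 (extendSeq a)
  exact congrArg Matrix.rank this.symm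

open Classical in
theorem card_kernel_mul_le [Fintype F] (M : Matrix (Fin n) (Fin n) F) {r : ℕ} (hr : r ≤ M.rank) :
    (Finset.univ.filter fun v : Fin n → F => Matrix.vecMul v M = 0).card * Fintype.card F ^ r
      ≤ Fintype.card (Fin n → F) := by
  have h1 := LinearMap.finrank_range_add_finrank_ker (Matrix.vecMulLinear M)
  have h2 : Module.finrank F (LinearMap.range (Matrix.vecMulLinear M)) = M.rank := by
    rw [← Matrix.rank_transpose, Matrix.rank, Matrix.mulVecLin_transpose]
  have h3 : (Finset.univ.filter fun v : Fin n → F => Matrix.vecMul v M = 0).card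
      = Fintype.card F ^ Module.finrank F (LinearMap.ker (Matrix.vecMulLinear M)) := by
    rw [← Module.card_eq_pow_finrank, Fintype.card_subtype]
    exact congrArg _ (Finset.filter_congr fun v _ => by simp [LinearMap.mem_ker])
  rw [h3, ← pow_add, Fintype.card_fun, Fintype.card_fin]
  refine Nat.pow_le_pow_right Fintype.card_pos ?_
  rw [Module.finrank_fin_fun] at h1
  omega

open Classical in
theorem card_small_rank_ge [Fintype F] {r : ℕ}
    (hr : Fintype.card (Fin (k + 1) → Fin n → F) ≤ (Finset.univ.filter fun x :
      Fin (k + 1) → Fin n → F => contract t (extendSeq x) = 0).card * Fintype.card F ^ r) :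
    Fintype.card (Fin (k + 1) → Fin n → F) ≤ (Finset.univ.filter fun a :
      Fin (k + 1) → Fin n → F => baseRank t E a 0 ≤ r).card * Fintype.card F ^ (r + 1) := by
  have hq : 2 ≤ Fintype.card F := Fintype.one_lt_card
  set Z := Finset.univ.filter fun x : Fin (k + 1) → Fin n → F => contract t (extendSeq x) = 0
  have h1 := Finset.card_filter_add_card_filter_not (s := Z) (fun a => baseRank t E a 0 ≤ r)
  have h2 : (Z.filter fun a => baseRank t E a 0 ≤ r).card
      ≤ (Finset.univ.filter fun a : Fin (k + 1) → Fin n → F => baseRank t E a 0 ≤ r).card :=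
    Finset.card_le_card (Finset.filter_subset_filter _ (Finset.subset_univ _))
  have h3 : (Z.filter fun a => ¬ baseRank t E a 0 ≤ r).card * Fintype.card F ^ (r + 1)
      ≤ Fintype.card (Fin (k + 1) → Fin n → F) := by
    refine card_mul_le_of_fibers _ 0 _ fun a => ?_
    by_cases ha : baseRank t E a 0 ≤ r
    · have : (Finset.univ.filter fun v => Function.update a 0 v ∈
          Z.filter fun a => ¬ baseRank t E a 0 ≤ r) = ∅ := by
        refine Finset.filter_eq_empty_iff.2 fun v _ hv => (Finset.mem_filter.1 hv).2 ?_
        rw [baseRank_zero, extendSeq_update]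
        rw [baseRank_zero] at ha
        refine le_trans (le_of_eq (congrArg _ (slotMatrix_congr t fun m _ hm => ?_))) ha
        rw [Function.update_of_ne (by simpa using hm)]
      rw [this, Finset.card_empty, zero_mul]
      exact Nat.zero_le _
    · rw [baseRank_zero, not_le] at ha
      refine le_trans (Nat.mul_le_mul_right _ (Finset.card_le_card ?_))
        (card_kernel_mul_le (slotMatrix t 0 (extendSeq a)) ha)
      intro v hv
      have h4 := (Finset.mem_filter.1 (Finset.mem_filter.1 (Finset.mem_filter.1 hv).2).1).2
      rw [extendSeq_update] at h4
      refine Finset.mem_filter.2 ⟨Finset.mem_univ _, ?_⟩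
      rw [← contract_update_eq_vecMul t _ (Nat.succ_pos k)]
      exact h4
  rw [pow_succ] at h3 ⊢
  set Q := Fintype.card F ^ r
  set q := Fintype.card F
  have h5 := Nat.mul_le_mul_right (Q * q) (h1 ▸ Nat.add_le_add_right h2 _)
  have h6 := Nat.mul_le_mul_right q hr
  have h7 := Nat.mul_le_mul_left (Fintype.card (Fin (k + 1) → Fin n → F)) hq
  nlinarith

/-- Coefficients of the rank bounds. -/
def rankConst (k : ℕ) : ℕ → ℕ
  | 0 => 1
  | 1 => 1
  | j + 1 => j * rankConst k j
      + 3 * (4 + 5 * (k + 1) * (j * rankConst k j) + j * rankConst k j + j)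

open Classical in
theorem card_bounded_rank_ge [Fintype F] [Infinite E] [NeZero n] {r : ℕ}
    (hr : Fintype.card (Fin (k + 1) → Fin n → F) ≤ (Finset.univ.filter fun x :
      Fin (k + 1) → Fin n → F => contract t (extendSeq x) = 0).card * Fintype.card F ^ r)
    (j : ℕ) (hj : j < k + 1) :
    Fintype.card (Fin (k + 1) → Fin n → F) ≤ (Finset.univ.filter fun a :
      Fin (k + 1) → Fin n → F => ∀ i < j + 1, baseRank t E a i ≤ rankConst k (j + 1) * (r + 1)).card
        * Fintype.card F ^ (r + (j + 1)) := by
  have hq : 2 ≤ Fintype.card F := Fintype.one_lt_card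
  induction j with
  | zero =>
    refine (card_small_rank_ge t E hr).trans (Nat.mul_le_mul_right _ (Finset.card_le_card ?_))
    intro a ha
    refine Finset.mem_filter.2 ⟨Finset.mem_univ _, fun i hi => ?_⟩
    obtain rfl : i = 0 := by omega
    have := (Finset.mem_filter.1 ha).2
    have h1 : rankConst k (0 + 1) = 1 := rfl
    rw [h1]
    omega
  | succ j ih =>
    have ih := ih (by omega)
    set N := Fintype.card (Fin (k + 1) → Fin n → F)
    set q := Fintype.card F
    set T := rankConst k (j + 1) * (r + 1) with hT
    set T' := rankConst k (j + 1 + 1) * (r + 1) with hT'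
    set J := j + 1 with hJ
    set κ := 2 + 5 * (k + 1) * (J * T) + J * T + r + J + 1 with hκ
    have hTT' : J * T + 3 * κ ≤ T' := by
      have : rankConst k (J + 1) = J * rankConst k J
        + 3 * (4 + 5 * (k + 1) * (J * rankConst k J) + J * rankConst k J + J) := by
          rw [hJ]; rfl
      rw [hT', this, hκ, hT]
      nlinarith [Nat.zero_le (r * J)]
    have hTle : T ≤ T' := by nlinarith
    set G := Finset.univ.filter fun a : Fin (k + 1) → Fin n → F =>
      ∀ i < J, baseRank t E a i ≤ T
    set G' := Finset.univ.filter fun a : Fin (k + 1) → Fin n → F =>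
      ∀ i < J + 1, baseRank t E a i ≤ T'
    let bad : (Fin J → Fin (T + 1)) → Finset (Fin (k + 1) → Fin n → F) := fun ρ =>
      Finset.univ.filter fun a => (∀ i : Fin J, baseRank t E a i = ρ i) ∧
        T' + 1 ≤ baseRank t E a J
    have hcover : G ⊆ G' ∪ Finset.univ.biUnion bad := by
      intro a ha
      have ha := (Finset.mem_filter.1 ha).2
      by_cases h : baseRank t E a J ≤ T'
      · refine Finset.mem_union_left _ (Finset.mem_filter.2 ⟨Finset.mem_univ _, fun i hi => ?_⟩)
        rcases Nat.lt_succ_iff_lt_or_eq.1 hi with h1 | rfl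
        · exact (ha i h1).trans hTle
        · exact h
      · refine Finset.mem_union_right _ (Finset.mem_biUnion.2
          ⟨fun i => ⟨baseRank t E a i, Nat.lt_succ_of_le (ha i i.2)⟩, Finset.mem_univ _, ?_⟩)
        exact Finset.mem_filter.2 ⟨Finset.mem_univ _, fun i => rfl, by omega⟩
    have hbad : ∀ ρ, (bad ρ).card * q ^ (J * T + r + J + 1) ≤ N := by
      intro ρ
      refine card_mul_le_of_fibers _ ⟨J, hj⟩ _ fun a => ?_
      set ρ' : ℕ → ℕ := fun m => if h : m < J then ρ ⟨m, h⟩ else 0 with hρ'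
      have hs : ∑ m ∈ Finset.range J, ρ' m ≤ J * T := by
        refine (Finset.sum_le_card_nsmul _ _ T fun m hm => ?_).trans (by simp)
        rw [hρ']
        simp only [dif_pos (Finset.mem_range.1 hm)]
        exact Nat.lt_succ_iff.1 (ρ _).2
      have key := card_high_rank_le t E (extendSeq a) (ρ := ρ') (j := J) (κ := 3 * κ)
        (r := T' + 1) (Nat.succ_pos j) hj (by omega)
        (Finset.univ.filter fun v => Function.update a ⟨J, hj⟩ v ∈ bad ρ)
        (fun v hv m hm => by
          have := (Finset.mem_filter.1 (Finset.mem_filter.1 hv).2).2.1 ⟨m, hm⟩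
          rw [baseRank_update] at this
          rw [this, hρ']
          simp only [dif_pos hm])
        (fun v hv => by
          have := (Finset.mem_filter.1 (Finset.mem_filter.1 hv).2).2.2
          rwa [baseRank_update] at this)
      refine (mul_pow_le_of_binomial_bound hq key ?_).trans (by simp)
      have := Nat.mul_le_mul_left (5 * (k + 1)) hs
      omega
    have hcount : (Finset.univ.biUnion bad).card * q ^ (r + (J + 1)) ≤ N := by
      have h1 : (Finset.univ.biUnion bad).card * q ^ (J * T + r + J + 1) ≤ (T + 1) ^ J * N := by
        refine (Nat.mul_le_mul_right _ Finset.card_biUnion_le).trans ?_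
        rw [Finset.sum_mul]
        refine (Finset.sum_le_card_nsmul _ _ N fun ρ _ => hbad ρ).trans ?_
        simp
      have h2 : (T + 1) ^ J ≤ q ^ (J * T) := by
        rw [mul_comm J, pow_mul]
        exact Nat.pow_le_pow_left ((Nat.lt_two_pow_self (n := T)).trans_le
          (Nat.pow_le_pow_left hq _)) _
      have h3 : q ^ (J * T + r + J + 1) = q ^ (r + (J + 1)) * q ^ (J * T) := by
        rw [← pow_add]; congr 1; ring
      have h4 := h1.trans (Nat.mul_le_mul_right N h2)
      rw [h3, ← mul_assoc, mul_comm (q ^ (J * T)) N] at h4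
      exact Nat.le_of_mul_le_mul_right h4 (by positivity)
    have h1 := (Finset.card_le_card hcover).trans (Finset.card_union_le _ _)
    have h2 := Nat.mul_le_mul_right (q ^ (r + (J + 1))) h1
    have h3 : q ^ (r + (J + 1)) = q ^ (r + J) * q := by rw [← add_assoc, pow_succ]
    have h4 := Nat.mul_le_mul_right q ih
    have h5 := Nat.mul_le_mul_left N hq
    rw [add_mul] at h2
    rw [mul_assoc, ← h3] at h4
    change N ≤ G'.card * _
    omega

theorem exists_base_of_bounded_rank [Fintype F] [Infinite E] [NeZero n] {r : ℕ} [DecidableEq F]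
    (hr : Fintype.card (Fin (k + 1) → Fin n → F) ≤ (Finset.univ.filter fun x :
      Fin (k + 1) → Fin n → F => contract t (extendSeq x) = 0).card * Fintype.card F ^ r) :
    ∃ a : ℕ → Fin n → F, ∀ i ≤ k,
      maxRank t (fun m => extendVec E (a m)) i ≤ rankConst k (k + 1) * (r + 1) := by
  classical
  have h := card_bounded_rank_ge t E (by convert hr) k (Nat.lt_succ_self k)
  have hpos : 0 < (Finset.univ.filter fun a : Fin (k + 1) → Fin n → F =>
      ∀ i < k + 1, baseRank t E a i ≤ rankConst k (k + 1) * (r + 1)).card := by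
    by_contra h0
    rw [Nat.eq_zero_of_not_pos h0, zero_mul] at h
    exact absurd h (not_le.2 Fintype.card_pos)
  obtain ⟨a, ha⟩ := Finset.card_pos.1 hpos
  exact ⟨extendSeq a, fun i hi => (Finset.mem_filter.1 ha).2 i (Nat.lt_succ_of_le hi)⟩

end selection

section splitting
variable {R : Type*} [CommRing R] {n : ℕ}

/-- Functions of a sequence of indices that factor into functions of two disjoint nonempty sets of
coordinates in `[i, L]`. -/
def IsSplit (i L : ℕ) (f : (ℕ → Fin n) → R) : Prop :=
  ∃ S S' : Finset ℕ, S.Nonempty ∧ S'.Nonempty ∧ Disjoint S S' ∧ S ⊆ Finset.Icc i L ∧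
    S' ⊆ Finset.Icc i L ∧ ∃ u v : (ℕ → Fin n) → R,
      DependsOn u (S : Set ℕ) ∧ DependsOn v (S' : Set ℕ) ∧ f = u * v

/-- Sums of at most `N` split functions. -/
def IsSplitSum (i L N : ℕ) (f : (ℕ → Fin n) → R) : Prop :=
  ∃ l : List ((ℕ → Fin n) → R), l.length ≤ N ∧ (∀ g ∈ l, IsSplit i L g) ∧ f = l.sum

theorem IsSplit.map {S : Type*} [CommRing S] {i L : ℕ} {f : (ℕ → Fin n) → R}
    (h : IsSplit i L f) (φ : R →+* S) : IsSplit i L fun j => φ (f j) := by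
  obtain ⟨S, S', h1, h2, h3, h4, h5, u, v, hu, hv, rfl⟩ := h
  exact ⟨S, S', h1, h2, h3, h4, h5, fun j => φ (u j), fun j => φ (v j),
    fun _ _ h => congrArg φ (hu h), fun _ _ h => congrArg φ (hv h), funext fun j => by simp⟩

theorem IsSplitSum.map {S : Type*} [CommRing S] {i L N : ℕ} {f : (ℕ → Fin n) → R}
    (h : IsSplitSum i L N f) (φ : R →+* S) : IsSplitSum i L N fun j => φ (f j) := by
  obtain ⟨l, h1, h2, rfl⟩ := h
  refine ⟨l.map fun g j => φ (g j), by simpa using h1, ?_, ?_⟩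
  · intro g hg
    obtain ⟨g', hg', rfl⟩ := List.mem_map.1 hg
    exact (h2 g' hg').map φ
  · clear h1 h2
    funext j
    induction l with
    | nil => simp
    | cons g l ih => simp [ih]

theorem isSplitSum_zero (i L : ℕ) : IsSplitSum i L 0 (0 : (ℕ → Fin n) → R) :=
  ⟨[], le_rfl, by simp, rfl⟩

theorem IsSplitSum.add {i L N N' : ℕ} {f g : (ℕ → Fin n) → R} (hf : IsSplitSum i L N f)
    (hg : IsSplitSum i L N' g) : IsSplitSum i L (N + N') (f + g) := by
  obtain ⟨l, h1, h2, rfl⟩ := hf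
  obtain ⟨l', h1', h2', rfl⟩ := hg
  refine ⟨l ++ l', by simp; omega, ?_, by simp⟩
  intro g hg
  rcases List.mem_append.1 hg with h | h
  exacts [h2 g h, h2' g h]

theorem IsSplitSum.mono {i L N N' : ℕ} {f : (ℕ → Fin n) → R} (hf : IsSplitSum i L N f)
    (h : N ≤ N') : IsSplitSum i L N' f := by
  obtain ⟨l, h1, h2, rfl⟩ := hf
  exact ⟨l, h1.trans h, h2, rfl⟩

theorem IsSplit.isSplitSum {i L : ℕ} {f : (ℕ → Fin n) → R} (hf : IsSplit i L f) :
    IsSplitSum i L 1 f :=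
  ⟨[f], le_rfl, by simpa using hf, by simp⟩

theorem isSplitSum_sum {i L : ℕ} {α : Type*} (s : Finset α) (f : α → (ℕ → Fin n) → R)
    (hf : ∀ a ∈ s, IsSplit i L (f a)) : IsSplitSum i L s.card (∑ a ∈ s, f a) := by
  classical
  induction s using Finset.induction_on with
  | empty => exact isSplitSum_zero i L
  | insert a s ha ih =>
    rw [Finset.sum_insert ha, Finset.card_insert_of_notMem ha, add_comm s.card]
    exact (hf a (Finset.mem_insert_self a s)).isSplitSum.add
      (ih fun b hb => hf b (Finset.mem_insert_of_mem hb))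

/-- Differentiating a sum of split functions along the variables indexed by a new coordinate. -/
theorem IsSplitSum.derivation {F : Type*} [Field F] [Algebra F R] {i L N : ℕ} (hi : i ≤ L)
    {f : (ℕ → Fin n) → R} (hf : IsSplitSum (i + 1) L N f) (D : Fin n → Derivation F R R) (h : R) :
    IsSplitSum i L (2 * N) fun j => h * D (j i) (f j) - D (j i) h * f j := by
  obtain ⟨l, h1, h2, rfl⟩ := hf
  refine IsSplitSum.mono ?_ (Nat.mul_le_mul_left 2 h1)
  clear h1
  induction l with
  | nil =>
    have e : (fun j : ℕ → Fin n => h * D (j i) (([] : List ((ℕ → Fin n) → R)).sum j)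
        - D (j i) h * ([] : List ((ℕ → Fin n) → R)).sum j) = 0 := by
      funext j
      simp
    rw [e]
    exact isSplitSum_zero i L
  | cons g l ih =>
    have ih := ih fun g hg => h2 g (List.mem_cons_of_mem _ hg)
    obtain ⟨S, S', hS, hS', hd, hSi, hSi', u, v, hu, hv, rfl⟩ := h2 g List.mem_cons_self
    have hsub : Finset.Icc (i + 1) L ⊆ Finset.Icc i L := Finset.Icc_subset_Icc_left (by omega)
    have hiS : i ∉ S := fun h => by have := Finset.mem_Icc.1 (hSi h); omega
    have hiS' : i ∉ S' := fun h => by have := Finset.mem_Icc.1 (hSi' h); omega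
    have hiL : i ∈ Finset.Icc i L := Finset.mem_Icc.2 ⟨le_rfl, hi⟩
    have e : (fun j => h * D (j i) (((u * v) :: l).sum j) - D (j i) h * ((u * v) :: l).sum j)
        = ((fun j => h * D (j i) (u j) - D (j i) h * u j) * v
          + u * fun j => h * D (j i) (v j))
          + fun j => h * D (j i) (l.sum j) - D (j i) h * l.sum j := by
      funext j
      simp only [List.sum_cons, Pi.add_apply, Pi.mul_apply, map_add, Derivation.leibniz,
        smul_eq_mul]
      ring
    rw [e, List.length_cons, mul_add_one, add_comm]
    refine IsSplitSum.mono ((IsSplitSum.add (IsSplit.isSplitSum ?_)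
      (IsSplit.isSplitSum ?_)).add ih) (by omega)
    · refine ⟨insert i S, S', Finset.insert_nonempty _ _, hS', Finset.disjoint_insert_left.2
        ⟨hiS', hd⟩, Finset.insert_subset hiL (hSi.trans hsub), hSi'.trans hsub, _, _, ?_, hv, rfl⟩
      intro x y hxy
      beta_reduce
      rw [hu fun m hm => hxy m (by simp_all), hxy i (by simp)]
    · refine ⟨S, insert i S', hS, Finset.insert_nonempty _ _, Finset.disjoint_insert_right.2
        ⟨hiS, hd⟩, hSi.trans hsub, Finset.insert_subset hiL (hSi'.trans hsub), _, _, hu, ?_, rfl⟩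
      intro x y hxy
      beta_reduce
      rw [hv fun m hm => hxy m (by simp_all), hxy i (by simp)]

end splitting

section polynomialTower
variable {F : Type*} [Field F] {n k : ℕ} (t : (Fin (k + 1) → Fin n) → Fin n → F)

section ring
variable {R : Type*} [CommRing R] [Algebra F R]

theorem contract_update_zero (z : ℕ → Fin n → R) {m : ℕ} (hm : m < k + 1) :
    contract t (Function.update z m 0) = 0 := by
  rw [contract_update_eq_vecMul t z hm, Matrix.zero_vecMul]

/-- The contraction with `W 0, …, W (i - 1)` in the first slots and unit vectors in the others. -/
def mixedEntry (W : ℕ → Fin n → R) (i : ℕ) (j : ℕ → Fin n) : R :=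
  contract t (mix i W fun m => Pi.single (j m) 1) (j (k + 1))

theorem mixedEntry_dependsOn (W : ℕ → Fin n → R) (i : ℕ) (hi : i ≤ k + 1) :
    DependsOn (mixedEntry t W i) (Finset.Icc i (k + 1) : Set ℕ) := by
  intro x y hxy
  rw [mixedEntry, mixedEntry, hxy (k + 1) (by simpa using hi)]
  refine congrFun (contract_congr t fun m hm => ?_) _
  by_cases h : m < i
  · simp [mix, h]
  · simp only [mix, if_neg h]
    rw [hxy m (by simp; omega)]

theorem mixedEntry_zero (W : ℕ → Fin n → R) (j : ℕ → Fin n) :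
    mixedEntry t W 0 j = algebraMap F R (t (fun m => j m) (j (k + 1))) := by
  rw [mixedEntry, contract, Finset.sum_eq_single fun m : Fin (k + 1) => j m]
  · simp [mix]
  · intro i _ hi
    obtain ⟨m, hm⟩ := Function.ne_iff.1 hi
    rw [Finset.prod_eq_zero (Finset.mem_univ m), mul_zero]
    simp [mix, hm]
  · simp

theorem mixedEntry_vecMul (W : ℕ → Fin n → R) {i : ℕ} (hi : i < k + 1) (j : ℕ → Fin n)
    (l : Fin n) :
    slotMatrix t i (mix (i + 1) W fun m => Pi.single (j m) 1) l (j (k + 1))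
      = mixedEntry t W i (Function.update j i l) := by
  rw [mixedEntry, slotMatrix, Matrix.of_apply, Function.update_of_ne (by omega)]
  refine congrFun (contract_congr t fun m hm => ?_) _
  by_cases h : m = i
  · subst h; simp [mix]
  · by_cases h' : m < i
    · simp [mix, h, h', h'.trans (Nat.lt_succ_self i)]
    · simp [mix, h, h', show ¬ m < i + 1 by omega]

theorem derivation_mixedEntry (W : ℕ → Fin n → R) {i : ℕ} (hi : i < k + 1) (j : ℕ → Fin n)
    (D : Derivation F R R) (hD : ∀ m < i, ∀ l, D (W m l) = 0) :
    D (mixedEntry t W (i + 1) j)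
      = ∑ l, D (W i l) * mixedEntry t W i (Function.update j i l) := by
  rw [mixedEntry, contract_derivation, Finset.sum_eq_single ⟨i, hi⟩]
  · rw [contract_update_eq_vecMul t _ hi]
    simp only [Matrix.vecMul, dotProduct]
    refine Finset.sum_congr rfl fun l _ => ?_
    rw [mixedEntry_vecMul t W hi]
    simp [mix]
  · intro m _ hm
    have hm' : (m : ℕ) ≠ i := fun h => hm (Fin.ext h)
    have : (fun l => D (mix (i + 1) W (fun m => Pi.single (j m) 1) m l)) = 0 := by
      funext l
      by_cases h : (m : ℕ) < i
      · simp [mix, h.trans (Nat.lt_succ_self i), hD m h]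
      · simp only [mix, if_neg (show ¬ (m : ℕ) < i + 1 by omega), Pi.single_apply]
        split_ifs <;> simp
    rw [this, contract_update_zero t _ m.2]
    rfl
  · simp

theorem tower_congr {ρ : ℕ → ℕ} (I : ∀ m, Fin (ρ m) → Fin n) (Γ : ∀ m, Fin (ρ m) → Fin n → R)
    {τ τ' : ℕ → Fin n → R} (a : ℕ → Fin n → R) {i : ℕ} (h : ∀ m ≤ i, τ m = τ' m) :
    tower t I Γ τ a i = tower t I Γ τ' a i := by
  induction i using Nat.strong_induction_on with
  | _ i ih =>
    rw [tower_eq, tower_eq, h i le_rfl,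
      baseMatrix_congr t fun m hm => ih m hm fun l hl => h l (hl.trans hm.le)]

/-- The constants of a derivation. -/
def Derivation.constants (D : Derivation F R R) : Subalgebra F R where
  carrier := {x | D x = 0}
  mul_mem' {x y} hx hy := by
    change D (x * y) = 0
    rw [D.leibniz, show D x = 0 from hx, show D y = 0 from hy]
    simp
  add_mem' {x y} hx hy := by
    change D (x + y) = 0
    rw [map_add, show D x = 0 from hx, show D y = 0 from hy, add_zero]
  algebraMap_mem' := D.map_algebraMap

/-- The constants of `D` contain the tower as long as they contain its data. -/
theorem derivation_tower (D : Derivation F R R) {ρ : ℕ → ℕ} (I : ∀ m, Fin (ρ m) → Fin n)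
    (Γ : ∀ m, Fin (ρ m) → Fin n → R) (τ a : ℕ → Fin n → R) {i : ℕ}
    (hΓ : ∀ m b l, D (Γ m b l) = 0) (ha : ∀ m l, D (a m l) = 0)
    (hτ : ∀ m < i, ∀ l, D (τ m l) = 0) :
    (∀ m < i, ∀ l, D (tower t I Γ τ a m l) = 0) ∧ D (towerDet t I Γ τ a i) = 0 ∧
      ∀ l, D (tower t I Γ τ a i l) = towerDet t I Γ τ a i * D (τ i l) - ∑ b, D (pivotCoeff
        (baseMatrix t a i (tower t I Γ τ a)) (Γ i) (I i) (τ i) b) * Γ i b l := by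
  let B := D.constants
  let Γ' : ∀ m, Fin (ρ m) → Fin n → B := fun m b l => ⟨Γ m b l, hΓ m b l⟩
  let a' : ℕ → Fin n → B := fun m l => ⟨a m l, ha m l⟩
  let τ' : ℕ → Fin n → B := fun m l => if h : m < i then ⟨τ m l, hτ m h l⟩ else 0
  have hτ' : ∀ m < i, (fun l => B.val (τ' m l)) = τ m := fun m hm => by
    funext l
    simp only [τ', dif_pos hm]
    rfl
  have h1 : ∀ m < i, tower t I Γ τ a m = fun l => B.val (tower t I Γ' τ' a' m l) := by
    intro m hm
    rw [tower_map]
    exact tower_congr t I Γ a fun m' hm' => (hτ' m' (lt_of_le_of_lt hm' hm)).symm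
  have h2 : towerDet t I Γ τ a i = B.val (towerDet t I Γ' τ' a' i) := by
    rw [towerDet_map, towerDet, towerDet]
    rw [baseMatrix_congr t fun m hm => (h1 m hm).trans (tower_map t I Γ' τ' a' B.val m)]
    rfl
  have h3 : D (towerDet t I Γ τ a i) = 0 := by
    rw [h2]
    exact (towerDet t I Γ' τ' a' i).2
  refine ⟨fun m hm l => ?_, h3, fun l => ?_⟩
  · rw [h1 m hm]
    exact (tower t I Γ' τ' a' m l).2
  · rw [tower_eq, pivotStep]
    simp only [Pi.sub_apply, Pi.smul_apply, smul_eq_mul, Finset.sum_apply, map_sub, map_sum,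
      Derivation.leibniz, hΓ]
    have h4 : D (pivot (baseMatrix t a i (tower t I Γ τ a)) (Γ i) (I i)).det = 0 := h3
    rw [h4, mul_zero, add_zero]
    congr 1
    exact Finset.sum_congr rfl fun b _ => by rw [mul_zero, zero_add, mul_comm]

end ring

section polynomials
variable {ρ : ℕ → ℕ} (I J : ∀ m, Fin (ρ m) → Fin n) (a : ℕ → Fin n → F)

/-- The tower with generic parameters `X (m, l)` over the base sequence `a`. -/
noncomputable def genericTower : ℕ → Fin n → MvPolynomial (ℕ × Fin n) F :=
  tower t I (fun m b => Pi.single (J m b) 1) (fun m l => MvPolynomial.X (m, l))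
    (fun m l => MvPolynomial.C (a m l))

/-- The pivot determinants of `genericTower`. -/
noncomputable def genericDet : ℕ → MvPolynomial (ℕ × Fin n) F :=
  towerDet t I (fun m b => Pi.single (J m b) 1) (fun m l => MvPolynomial.X (m, l))
    (fun m l => MvPolynomial.C (a m l))

theorem isSplitSum_descend {i N : ℕ} (hi : i < k + 1) {h : MvPolynomial (ℕ × Fin n) F}
    (hh : IsSplitSum (i + 1) (k + 1) N fun j => h * mixedEntry t (genericTower t I J a) (i + 1) j) :
    IsSplitSum i (k + 1) (2 * N + ρ i)
      fun j => h ^ 2 * genericDet t I J a i * mixedEntry t (genericTower t I J a) i j := by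
  classical
  set W := genericTower t I J a with hW
  set c := pivotCoeff (baseMatrix t (fun m l => MvPolynomial.C (a m l)) i W)
    (fun b => Pi.single (J i b) 1) (I i) (fun l => MvPolynomial.X (i, l)) with hc
  have hD := fun l₀ => derivation_tower t (MvPolynomial.pderiv (R := F) ((i, l₀) : ℕ × Fin n)) I
    (fun m b => Pi.single (J m b) 1) (fun m l => MvPolynomial.X (m, l))
    (fun m l => MvPolynomial.C (a m l)) (i := i)
    (fun m b l => by rw [Pi.single_apply]; split_ifs <;> simp)
    (fun m l => MvPolynomial.pderiv_C)
    (fun m hm l => MvPolynomial.pderiv_X_of_ne fun h => hm.ne (congrArg Prod.fst h))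
  have key : ∀ j, MvPolynomial.pderiv (i, j i) (mixedEntry t W (i + 1) j)
      = genericDet t I J a i * mixedEntry t W i j - ∑ b, MvPolynomial.pderiv (i, j i) (c b) *
        mixedEntry t W i (Function.update j i (J i b)) := by
    intro j
    obtain ⟨h1, -, h3⟩ := hD (j i)
    rw [derivation_mixedEntry t W hi j _ h1]
    have h4 : ∀ l, MvPolynomial.pderiv (i, j i) (W i l) = (if l = j i then genericDet t I J a i
        else 0) - ∑ b, if l = J i b then MvPolynomial.pderiv (i, j i) (c b) else 0 := by
      intro l
      refine (h3 l).trans ?_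
      congr 1
      · rw [MvPolynomial.pderiv_X, Pi.single_apply]
        simp only [Prod.mk.injEq, true_and, mul_ite, mul_one, mul_zero]
        rfl
      · refine Finset.sum_congr rfl fun b _ => ?_
        rw [Pi.single_apply]
        simp only [mul_ite, mul_one, mul_zero]
        rfl
    simp only [h4, sub_mul, Finset.sum_sub_distrib, ite_mul, zero_mul, Finset.sum_ite_eq',
      Finset.mem_univ, if_true, Function.update_eq_self, Finset.sum_mul]
    congr 1
    rw [Finset.sum_comm]
    simp
  have h1 := hh.derivation (by omega) (fun l => MvPolynomial.pderiv (i, l)) h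
  have h2 : IsSplitSum i (k + 1) (ρ i) (∑ b : Fin (ρ i), fun j : ℕ → Fin n =>
      h ^ 2 * MvPolynomial.pderiv (i, j i) (c b) *
        mixedEntry t W i (Function.update j i (J i b))) := by
    have := isSplitSum_sum (i := i) (L := k + 1) Finset.univ (fun b : Fin (ρ i) => fun j : ℕ → Fin n =>
      h ^ 2 * MvPolynomial.pderiv (i, j i) (c b) *
        mixedEntry t W i (Function.update j i (J i b))) fun b _ => ?_
    · simpa using this
    refine ⟨{i}, Finset.Icc (i + 1) (k + 1), Finset.singleton_nonempty _,
      Finset.nonempty_Icc.2 (by omega), by simp, by simp; omega,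
      Finset.Icc_subset_Icc_left (by omega), fun j => h ^ 2 * MvPolynomial.pderiv (i, j i) (c b),
      fun j => mixedEntry t W i (Function.update j i (J i b)), ?_, ?_, rfl⟩
    · intro x y hxy
      beta_reduce
      rw [hxy i (by simp)]
    · intro x y hxy
      refine mixedEntry_dependsOn t W i hi.le fun m hm => ?_
      by_cases h : m = i
      · subst h; simp
      · have := Finset.mem_Icc.1 (Finset.mem_coe.1 hm)
        simp only [Function.update_of_ne h]
        exact hxy m (by simp; omega)
  convert h1.add h2 using 1
  funext j
  rw [Pi.add_apply, Finset.sum_apply]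
  have h3 : ∑ b, h ^ 2 * MvPolynomial.pderiv (i, j i) (c b) *
      mixedEntry t W i (Function.update j i (J i b)) = h ^ 2 * ∑ b,
        MvPolynomial.pderiv (i, j i) (c b) * mixedEntry t W i (Function.update j i (J i b)) := by
    rw [Finset.mul_sum]
    exact Finset.sum_congr rfl fun b _ => mul_assoc _ _ _
  rw [h3, Derivation.leibniz, key, smul_eq_mul, smul_eq_mul]
  ring

end polynomials

end polynomialTower

section degrees
variable {F : Type*} [Field F] {σ : Type*}

theorem eq_zero_of_aeval (E : Type*) [Field E] [Algebra F E] [Infinite E]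
    {P H : MvPolynomial σ F} (hH : H ≠ 0)
    (h : ∀ z : σ → E, MvPolynomial.aeval z H ≠ 0 → MvPolynomial.aeval z P = 0) : P = 0 := by
  have h1 : MvPolynomial.map (algebraMap F E) (P * H) = 0 := by
    refine MvPolynomial.funext fun z => ?_
    rw [MvPolynomial.eval_map, ← MvPolynomial.aeval_def, map_mul, map_zero]
    by_cases hz : MvPolynomial.aeval z H = 0
    · rw [hz, mul_zero]
    · rw [h z hz, zero_mul]
  have h2 := MvPolynomial.map_injective _ (algebraMap F E).injective (h1.trans (map_zero _).symm)
  exact (mul_eq_zero.1 h2).resolve_right hH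

theorem totalDegree_det_le {m d : ℕ} (M : Matrix (Fin m) (Fin m) (MvPolynomial σ F))
    (hM : ∀ i j, (M i j).totalDegree ≤ d) : M.det.totalDegree ≤ m * d := by
  rw [Matrix.det_apply]
  refine MvPolynomial.totalDegree_finsetSum_le fun π _ => ?_
  refine (MvPolynomial.totalDegree_smul_le _ _).trans ?_
  refine (MvPolynomial.totalDegree_finsetProd _ _).trans ?_
  refine (Finset.sum_le_card_nsmul _ _ d fun i _ => hM _ _).trans ?_
  simp

theorem totalDegree_vecMul_le {m m' : Type*} [Fintype m] (M : Matrix m m' (MvPolynomial σ F))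
    (v : m → MvPolynomial σ F) {d e : ℕ} (hM : ∀ i j, (M i j).totalDegree ≤ d)
    (hv : ∀ i, (v i).totalDegree ≤ e) (j : m') : (Matrix.vecMul v M j).totalDegree ≤ e + d := by
  refine MvPolynomial.totalDegree_finsetSum_le fun i _ => ?_
  exact (MvPolynomial.totalDegree_mul _ _).trans (Nat.add_le_add (hv i) (hM i j))

theorem totalDegree_adjugate_le {m d : ℕ} (M : Matrix (Fin m) (Fin m) (MvPolynomial σ F))
    (hM : ∀ i j, (M i j).totalDegree ≤ d) (i j : Fin m) :
    (M.adjugate i j).totalDegree ≤ m * d := by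
  rw [Matrix.adjugate_apply]
  refine totalDegree_det_le _ fun i' j' => ?_
  rw [Matrix.updateRow_apply]
  split_ifs
  · rw [Pi.single_apply]
    split_ifs <;> simp
  · exact hM _ _

variable {n : ℕ}

theorem totalDegree_pivot_det_le {ρ e : ℕ} (M : Matrix (Fin n) (Fin n) (MvPolynomial σ F))
    (Γ : Fin ρ → Fin n → MvPolynomial σ F) (I : Fin ρ → Fin n)
    (hM : ∀ i j, (M i j).totalDegree ≤ e) (hΓ : ∀ b l, (Γ b l).totalDegree = 0) :
    (pivot M Γ I).det.totalDegree ≤ ρ * e := by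
  refine totalDegree_det_le _ fun b c => ?_
  have := totalDegree_vecMul_le M (Γ b) hM (fun l => (hΓ b l).le) (I c)
  rwa [zero_add] at this

theorem totalDegree_pivotStep_le {ρ e : ℕ} (M : Matrix (Fin n) (Fin n) (MvPolynomial σ F))
    (Γ : Fin ρ → Fin n → MvPolynomial σ F) (I : Fin ρ → Fin n) (τ : Fin n → MvPolynomial σ F)
    (hM : ∀ i j, (M i j).totalDegree ≤ e) (hΓ : ∀ b l, (Γ b l).totalDegree = 0)
    (hτ : ∀ l, (τ l).totalDegree ≤ 1) (l : Fin n) :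
    (pivotStep M Γ I τ l).totalDegree ≤ (ρ + 1) * e + 1 := by
  have hp : ∀ b c, (pivot M Γ I b c).totalDegree ≤ e := fun b c => by
    have := totalDegree_vecMul_le M (Γ b) hM (fun l => (hΓ b l).le) (I c)
    rwa [zero_add] at this
  rw [pivotStep, Pi.sub_apply]
  refine (MvPolynomial.totalDegree_sub _ _).trans (max_le ?_ ?_)
  · rw [Pi.smul_apply, smul_eq_mul]
    refine (MvPolynomial.totalDegree_mul _ _).trans ?_
    have := totalDegree_pivot_det_le M Γ I hM hΓ
    have := hτ l
    nlinarith
  · rw [Finset.sum_apply]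
    refine MvPolynomial.totalDegree_finsetSum_le fun b _ => ?_
    rw [Pi.smul_apply, smul_eq_mul]
    refine (MvPolynomial.totalDegree_mul _ _).trans ?_
    rw [hΓ, add_zero]
    have := totalDegree_vecMul_le (pivot M Γ I).adjugate (fun c => Matrix.vecMul τ M (I c))
      (totalDegree_adjugate_le _ hp) (fun c => totalDegree_vecMul_le M τ hM hτ (I c)) b
    refine this.trans (le_of_eq ?_)
    ring

variable {k : ℕ} (t : (Fin (k + 1) → Fin n) → Fin n → F)

theorem totalDegree_contract_le (z : ℕ → Fin n → MvPolynomial σ F) (D : ℕ → ℕ)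
    (hz : ∀ m l, (z m l).totalDegree ≤ D m) (w : Fin n) :
    (contract t z w).totalDegree ≤ ∑ m : Fin (k + 1), D m := by
  refine MvPolynomial.totalDegree_finsetSum_le fun i _ => ?_
  refine (MvPolynomial.totalDegree_mul _ _).trans ?_
  rw [MvPolynomial.algebraMap_eq, MvPolynomial.totalDegree_C, zero_add]
  exact (MvPolynomial.totalDegree_finsetProd _ _).trans (Finset.sum_le_sum fun m _ => hz m _)

theorem totalDegree_baseMatrix_le (a x : ℕ → Fin n → MvPolynomial σ F) (i : ℕ) (D : ℕ → ℕ)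
    (ha : ∀ m l, (a m l).totalDegree = 0) (hx : ∀ m < i, ∀ l, (x m l).totalDegree ≤ D m)
    (l w : Fin n) : (baseMatrix t a i x l w).totalDegree ≤ ∑ m ∈ Finset.range i, D m := by
  refine (totalDegree_contract_le t _ (fun m => if m < i then D m else 0) (fun m l => ?_) w).trans ?_
  · by_cases hm : m = i
    · subst hm
      simp only [Function.update_self, Pi.single_apply]
      split_ifs <;> simp
    · simp only [Function.update_of_ne hm, mix]
      split_ifs with h
      · exact hx m h l
      · exact (ha m l).le
  · rw [Fin.sum_univ_eq_sum_range (fun m => if m < i then D m else 0), ← Finset.sum_filter]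
    refine Finset.sum_le_sum_of_subset fun m hm => ?_
    exact Finset.mem_range.2 (Finset.mem_filter.1 hm).2

variable {ρ : ℕ → ℕ} (I J : ∀ m, Fin (ρ m) → Fin n) (a : ℕ → Fin n → F)

theorem totalDegree_genericTower_le {T L : ℕ} (hρ : ∀ m < L, ρ m ≤ T) {m : ℕ} (hm : m < L)
    (l : Fin n) : (genericTower t I J a m l).totalDegree ≤ (T + 1) * (T + 2) ^ m := by
  have hsum : ∀ i, ∑ m ∈ Finset.range i, (T + 1) * (T + 2) ^ m + 1 = (T + 2) ^ i := by
    intro i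
    induction i with
    | zero => simp
    | succ i ih => rw [Finset.sum_range_succ, pow_succ, ← ih]; ring_nf
  induction m using Nat.strong_induction_on generalizing l with
  | _ m ih =>
    rw [genericTower, tower_eq]
    refine (totalDegree_pivotStep_le _ _ _ _ (totalDegree_baseMatrix_le t _ _ m
      (fun m => (T + 1) * (T + 2) ^ m) (fun m l => MvPolynomial.totalDegree_C _)
      fun m' hm' l => ih m' hm' (hm'.trans hm) l) ?_ ?_ l).trans ?_
    · intro b l
      rw [Pi.single_apply]
      split_ifs <;> simp
    · intro l
      exact (MvPolynomial.totalDegree_X _).le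
    · have h1 := hsum m
      have h2 := Nat.mul_le_mul_right (∑ m' ∈ Finset.range m, (T + 1) * (T + 2) ^ m')
        (Nat.add_le_add_right (hρ m hm) 1)
      rw [← h1]
      nlinarith

theorem totalDegree_genericDet_le {T : ℕ} (hρ : ∀ m ≤ k, ρ m ≤ T) {i : ℕ} (hi : i ≤ k) :
    (genericDet t I J a i).totalDegree ≤ (T + 2) ^ (k + 1) := by
  have hsum : ∀ i, ∑ m ∈ Finset.range i, (T + 1) * (T + 2) ^ m + 1 = (T + 2) ^ i := by
    intro i
    induction i with
    | zero => simp
    | succ i ih => rw [Finset.sum_range_succ, pow_succ, ← ih]; ring_nf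
  refine (totalDegree_pivot_det_le _ _ _ (totalDegree_baseMatrix_le t _ _ i
    (fun m => (T + 1) * (T + 2) ^ m) (fun m l => MvPolynomial.totalDegree_C _)
    fun m hm l => totalDegree_genericTower_le t I J a
      (fun m (hm : m < k + 1) => hρ m (by omega)) (by omega) l) ?_).trans ?_
  · intro b l
    beta_reduce
    rw [Pi.single_apply]
    split_ifs <;> simp
  · calc ρ i * ∑ m ∈ Finset.range i, (T + 1) * (T + 2) ^ m
        ≤ (T + 2) * (T + 2) ^ i := Nat.mul_le_mul ((hρ i hi).trans (by omega)) (by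
          rw [← hsum i]; omega)
      _ = (T + 2) ^ (i + 1) := by ring
      _ ≤ (T + 2) ^ (k + 1) := Nat.pow_le_pow_right (by omega) (by omega)

end degrees

section decomposition
variable {F : Type*} [Field F] {n k : ℕ} (t : (Fin (k + 1) → Fin n) → Fin n → F)
variable (E : Type*) [Field E] [Algebra F E]

theorem aeval_genericTower {ρ : ℕ → ℕ} (I J : ∀ m, Fin (ρ m) → Fin n) (a : ℕ → Fin n → F)
    (z : ℕ × Fin n → E) (m : ℕ) :
    (fun l => MvPolynomial.aeval z (genericTower t I J a m l))
      = tower t I (fun m b => Pi.single (J m b) 1) (fun m l => z (m, l))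
        (fun m => extendVec E (a m)) m ∧
    MvPolynomial.aeval z (genericDet t I J a m)
      = towerDet t I (fun m b => Pi.single (J m b) 1) (fun m l => z (m, l))
        (fun m => extendVec E (a m)) m := by
  have e1 : (fun m (b : Fin (ρ m)) l => MvPolynomial.aeval z
      ((Pi.single (J m b) 1 : Fin n → MvPolynomial (ℕ × Fin n) F) l))
      = fun m b => (Pi.single (J m b) 1 : Fin n → E) := by
    funext m b l
    rw [Pi.single_apply, Pi.single_apply]
    split_ifs <;> simp
  have e2 : (fun (m : ℕ) (l : Fin n) => MvPolynomial.aeval z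
      (MvPolynomial.X (m, l) : MvPolynomial (ℕ × Fin n) F)) = fun m l => z (m, l) := by
    funext m l; exact MvPolynomial.aeval_X _ _
  have e3 : (fun (m : ℕ) (l : Fin n) => MvPolynomial.aeval z
      (MvPolynomial.C (a m l) : MvPolynomial (ℕ × Fin n) F)) = fun m => extendVec E (a m) := by
    funext m l; exact MvPolynomial.aeval_C _ _
  constructor
  · have := tower_map t I (fun m b => Pi.single (J m b) 1) (fun m l => MvPolynomial.X (m, l))
      (fun m l => MvPolynomial.C (a m l)) (MvPolynomial.aeval z : _ →ₐ[F] E) m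
    rw [e1, e2, e3] at this
    exact this
  · have := towerDet_map t I (fun m b => Pi.single (J m b) 1) (fun m l => MvPolynomial.X (m, l))
      (fun m l => MvPolynomial.C (a m l)) (MvPolynomial.aeval z : _ →ₐ[F] E) m
    rw [e1, e2, e3] at this
    exact this

/-- For suitable coordinates the generic tower has nonzero pivots, and contracting all slots of `t`
but the last with it gives zero. -/
theorem exists_genericTower [Infinite E] [NeZero n] (a : ℕ → Fin n → F) :
    ∃ I J : ∀ m, Fin (maxRank t (fun m => extendVec E (a m)) m) → Fin n,
      (∀ i < k + 1, genericDet t I J a i ≠ 0) ∧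
      ∀ j, mixedEntry t (genericTower t I J a) (k + 1) j = 0 := by
  set aE : ℕ → Fin n → E := fun m => extendVec E (a m)
  obtain ⟨x, hx, J, I, h1, -⟩ := exists_extremal_with_minors t aE (ρ := maxRank t aE)
    (j := k + 1) (r := 0) (fun _ _ => rfl) (Nat.zero_le _)
  have hdet : ∀ i < k + 1, genericDet t I J a i ≠ 0 := by
    intro i hi h
    refine (tower_of_chain t aE I (fun m b => Pi.single (J m b) 1)
      (fun m hm => vecMul_eq_zero_of_mem_extremal t aE hm hx)
      (fun m hm => by rw [pivot_single]; exact h1 m hm) (τ := x) (fun m _ => rfl)).1 i hi ?_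
    have := (aeval_genericTower t E I J a (fun c => x c.1 c.2) i).2
    rw [h, map_zero] at this
    exact this.symm
  refine ⟨I, J, hdet, fun j => ?_⟩
  refine eq_zero_of_aeval E (H := ∏ m ∈ Finset.range (k + 1), genericDet t I J a m)
    (Finset.prod_ne_zero_iff.2 fun m hm => hdet m (Finset.mem_range.1 hm)) fun z hz => ?_
  rw [map_prod] at hz
  have hd := fun m (hm : m < k + 1) => Finset.prod_ne_zero_iff.1 hz m (Finset.mem_range.2 hm)
  simp only [(aeval_genericTower t E I J a z _).2] at hd
  have hmem := tower_mem_extremal t aE I (fun m b => Pi.single (J m b) 1)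
    (fun m (_ : m < k + 1) => rfl) hd
  have h0 := vecMul_eq_zero_of_mem_extremal t aE (Nat.lt_succ_self k) hmem
  rw [← contract_mix_succ t aE (Nat.lt_succ_self k)] at h0
  rw [mixedEntry, contract_map]
  refine (congrFun (contract_congr t fun m hm => ?_) _).trans (congrFun h0 _)
  simp only [mix, if_pos hm]
  exact (aeval_genericTower t E I J a z m).1

theorem exists_split_decomposition [Infinite E] [NeZero n] (a : ℕ → Fin n → F) {T : ℕ}
    (hT : ∀ i ≤ k, maxRank t (fun m => extendVec E (a m)) i ≤ T) :
    ∃ h : MvPolynomial (ℕ × Fin n) F, h ≠ 0 ∧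
      h.totalDegree ≤ 2 ^ (k + 1) * (T + 2) ^ (k + 1) ∧
      IsSplitSum 0 (k + 1) (2 ^ (k + 1) * T)
        fun j : ℕ → Fin n => h * MvPolynomial.C (t (fun m => j m) (j (k + 1))) := by
  obtain ⟨I, J, hdet, h0⟩ := exists_genericTower t E a
  have key : ∀ s i, i + s = k + 1 → ∃ (h : MvPolynomial (ℕ × Fin n) F) (N : ℕ), h ≠ 0 ∧
      h.totalDegree + (T + 2) ^ (k + 1) ≤ 2 ^ s * (T + 2) ^ (k + 1) ∧ N + T ≤ 2 ^ s * T ∧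
      IsSplitSum i (k + 1) N fun j => h * mixedEntry t (genericTower t I J a) i j := by
    intro s
    induction s with
    | zero =>
      rintro i rfl
      refine ⟨1, 0, one_ne_zero, by simp, by simp, ?_⟩
      have : (fun j => 1 * mixedEntry t (genericTower t I J a) (k + 1) j) = 0 := by
        funext j
        rw [h0, mul_zero, Pi.zero_apply]
      rw [this]
      exact isSplitSum_zero _ _
    | succ s ih =>
      intro i hi
      obtain ⟨h, N, hh, hdeg, hN, hs⟩ := ih (i + 1) (by omega)
      refine ⟨h ^ 2 * genericDet t I J a i, 2 * N + maxRank t (fun m => extendVec E (a m)) i,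
        mul_ne_zero (pow_ne_zero _ hh) (hdet i (by omega)), ?_, ?_,
        isSplitSum_descend t I J a (by omega) hs⟩
      · have h1 := MvPolynomial.totalDegree_mul (h ^ 2) (genericDet t I J a i)
        have h2 := MvPolynomial.totalDegree_pow h 2
        have h3 := totalDegree_genericDet_le t I J a hT (i := i) (by omega)
        rw [pow_succ 2 s, mul_right_comm]
        linarith
      · have := hT i (by omega)
        rw [pow_succ 2 s, mul_right_comm]
        linarith
  obtain ⟨h, N, hh, hdeg, hN, hs⟩ := key (k + 1) 0 (zero_add _)
  refine ⟨h, hh, by omega, ?_⟩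
  simp only [mixedEntry_zero, MvPolynomial.algebraMap_eq] at hs
  exact hs.mono (by omega)

end decomposition

section descent
variable {F : Type*} [Field F]

theorem exists_aeval_ne_zero {σ : Type*} (K : Type*) [Field K] [Algebra F K] [Fintype K]
    {h : MvPolynomial σ F} (hh : h ≠ 0) (hd : h.totalDegree < Fintype.card K) :
    ∃ z : σ → K, MvPolynomial.aeval z h ≠ 0 := by
  classical
  obtain ⟨s, q, rfl⟩ := MvPolynomial.exists_finset_rename h
  have hq : MvPolynomial.map (algebraMap F K) q ≠ 0 := by
    intro h0
    rw [MvPolynomial.map_injective _ (algebraMap F K).injective (h0.trans (map_zero _).symm)] at hh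
    exact hh (map_zero _)
  by_contra! hcon
  refine hq (MvPolynomial.eq_zero_of_eval_zero_at_prod_finset _ (fun _ => Finset.univ)
    (fun i => ?_) fun x _ => ?_)
  · refine lt_of_le_of_lt (le_trans ?_ (MvPolynomial.degreeOf_le_totalDegree _ (i : σ))) hd
    rw [MvPolynomial.degreeOf_rename_of_injective Subtype.val_injective]
    rw [MvPolynomial.degreeOf_def, MvPolynomial.degreeOf_def]
    exact Multiset.count_le_of_le _ MvPolynomial.degrees_map_le
  · have := hcon fun i => if hi : i ∈ s then x ⟨i, hi⟩ else 0
    rw [MvPolynomial.aeval_rename] at this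
    rw [MvPolynomial.eval_map, ← MvPolynomial.aeval_def, ← this]
    congr 2
    funext i
    simp

variable {n : ℕ}

variable {K : Type*} [Field K] [Algebra F K]

theorem IsSplit.descend [FiniteDimensional F K] {i L : ℕ} {f : (ℕ → Fin n) → K}
    (hf : IsSplit i L f) (lam : K →ₗ[F] F) :
    IsSplitSum i L (Module.finrank F K) fun j => lam (f j) := by
  obtain ⟨S, S', h1, h2, h3, h4, h5, u, v, hu, hv, rfl⟩ := hf
  let B := Module.finBasis F K
  have := isSplitSum_sum (i := i) (L := L) Finset.univ
    (fun b (j : ℕ → Fin n) => B.repr (u j) b * lam (B b * v j)) fun b _ =>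
      ⟨S, S', h1, h2, h3, h4, h5, fun j => B.repr (u j) b, fun j => lam (B b * v j),
        fun _ _ h => by beta_reduce; rw [hu h], fun _ _ h => by beta_reduce; rw [hv h], rfl⟩
  rw [Finset.card_univ, Fintype.card_fin] at this
  convert this using 1
  funext j
  rw [Finset.sum_apply, Pi.mul_apply]
  calc lam (u j * v j) = lam ((∑ c, B.repr (u j) c • B c) * v j) := by rw [B.sum_repr]
    _ = _ := by
      rw [Finset.sum_mul, map_sum]
      exact Finset.sum_congr rfl fun c _ => by rw [smul_mul_assoc, map_smul, smul_eq_mul]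

theorem IsSplitSum.descend [FiniteDimensional F K] {i L N : ℕ} {f : (ℕ → Fin n) → K}
    (hf : IsSplitSum i L N f) (lam : K →ₗ[F] F) :
    IsSplitSum i L (N * Module.finrank F K) fun j => lam (f j) := by
  obtain ⟨l, h1, h2, rfl⟩ := hf
  refine IsSplitSum.mono ?_ (Nat.mul_le_mul_right _ h1)
  clear h1
  induction l with
  | nil =>
    have e : (fun j : ℕ → Fin n => lam (([] : List ((ℕ → Fin n) → K)).sum j)) = 0 := by
      funext j
      simp
    rw [e, List.length_nil, zero_mul]
    exact isSplitSum_zero i L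
  | cons g l ih =>
    have e : (fun j => lam ((g :: l).sum j)) = (fun j => lam (g j)) + fun j => lam (l.sum j) := by
      funext j
      simp
    rw [e, List.length_cons, add_one_mul, add_comm]
    exact ((h2 g List.mem_cons_self).descend lam).add
      (ih fun g hg => h2 g (List.mem_cons_of_mem _ hg))

theorem isSplitSum_of_extension [FiniteDimensional F K] [Fintype K] {i L N : ℕ}
    {h : MvPolynomial (ℕ × Fin n) F} (hh : h ≠ 0) (hd : h.totalDegree < Fintype.card K)
    {f : (ℕ → Fin n) → F} (hf : IsSplitSum i L N fun j => h * MvPolynomial.C (f j)) :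
    IsSplitSum i L (N * Module.finrank F K) f := by
  obtain ⟨z, hz⟩ := exists_aeval_ne_zero K hh hd
  obtain ⟨lam, hlam⟩ := (Algebra.linearMap F K).exists_leftInverse_of_injective
    (LinearMap.ker_eq_bot.2 (algebraMap F K).injective)
  have h1 := (hf.map (MvPolynomial.aeval z : MvPolynomial (ℕ × Fin n) F →ₐ[F] K).toRingHom).descend
    (lam ∘ₗ LinearMap.mulLeft F (MvPolynomial.aeval z h)⁻¹)
  convert h1 using 1
  funext j
  have := LinearMap.congr_fun hlam (f j)
  simp only [LinearMap.comp_apply, Algebra.linearMap_apply, LinearMap.id_apply] at this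
  simp [inv_mul_cancel_left₀ hz, this]

end descent

section arrays
variable {F : Type*} [Field F] {n : ℕ} {ι : Type*} [Fintype ι] [DecidableEq ι]

/-- The multilinear form with a given array of coefficients. -/
noncomputable def arrayForm (g : (ι → Fin n) → F) :
    MultilinearMap F (fun _ : ι => Fin n → F) F :=
  ∑ j : ι → Fin n, g j • (MultilinearMap.mkPiAlgebra F ι F).compLinearMap
    fun m => LinearMap.proj (j m)

theorem arrayForm_apply (g : (ι → Fin n) → F) (x : ι → Fin n → F) :
    arrayForm g x = ∑ j : ι → Fin n, g j * ∏ m, x m (j m) := by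
  simp [arrayForm]

theorem arrayForm_coeff (T : MultilinearMap F (fun _ : ι => Fin n → F) F) :
    arrayForm (fun j => T fun m => Pi.single (j m) 1) = T := by
  refine Module.Basis.ext_multilinear (fun _ => Pi.basisFun F (Fin n)) fun j => ?_
  rw [arrayForm_apply, Finset.sum_eq_single j]
  · simp
  · intro j' _ hj
    obtain ⟨m, hm⟩ := Function.ne_iff.1 hj
    rw [Finset.prod_eq_zero (Finset.mem_univ m), mul_zero]
    simp [hm]
  · simp

theorem arrayForm_add (g g' : (ι → Fin n) → F) :
    arrayForm (g + g') = arrayForm g + arrayForm g' := by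
  ext x
  simp [arrayForm_apply, add_mul, Finset.sum_add_distrib]

theorem arrayForm_mul (A : Finset ι) (u : ({i // i ∈ A} → Fin n) → F)
    (v : ({i // i ∉ A} → Fin n) → F) (x : ι → Fin n → F) :
    arrayForm (fun j : ι → Fin n => u (fun m : {i // i ∈ A} => j m) *
      v fun m : {i // i ∉ A} => j m) x
      = arrayForm u (fun m : {i // i ∈ A} => x m) * arrayForm v fun m : {i // i ∉ A} => x m := by
  rw [arrayForm_apply, arrayForm_apply, arrayForm_apply, Finset.sum_mul_sum,
    ← Fintype.sum_prod_type' (f := fun (p : {i // i ∈ A} → Fin n) (q : {i // i ∉ A} → Fin n) =>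
      u p * (∏ m : {i // i ∈ A}, x m (p m)) * (v q * ∏ m : {i // i ∉ A}, x m (q m)))]
  refine Fintype.sum_equiv (Equiv.piEquivPiSubtypeProd (fun i => i ∈ A) fun _ => Fin n) _ _
    fun j => ?_
  have : ∏ m, x m (j m) = (∏ m : {i // i ∈ A}, x m (j m)) * ∏ m : {i // i ∉ A}, x m (j m) := by
    convert (Fintype.prod_subtype_mul_prod_subtype (fun i => i ∈ A) fun m => x m (j m)).symm
  rw [this, mul_mul_mul_comm]
  rfl

end arrays

section partitionRank
variable {p n k : ℕ} [Fact p.Prime] [NeZero n]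

/-- Extension of a finite sequence of indices. -/
def extendIndex {L : ℕ} (j : Fin (L + 1) → Fin n) : ℕ → Fin n :=
  fun m => if h : m < L + 1 then j ⟨m, h⟩ else 0

theorem pRankOne_of_isSplit {f : (ℕ → Fin n) → ZMod p} (hf : IsSplit 0 (k + 1) f) :
    PRankOne (arrayForm fun j => f (extendIndex j) : Tensor p n (k + 2)) := by
  classical
  obtain ⟨S, S', ⟨s, hs⟩, ⟨s', hs'⟩, h3, h4, h5, u, v, hu, hv, rfl⟩ := hf
  have hlt : ∀ m ∈ Finset.Icc 0 (k + 1), m < k + 2 := fun m hm => by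
    have := Finset.mem_Icc.1 hm
    omega
  let A : Finset (Fin (k + 2)) := Finset.univ.filter fun m => (m : ℕ) ∈ S
  let ext : ∀ B : Finset (Fin (k + 2)), ({i // i ∈ B} → Fin n) → ℕ → Fin n := fun B j m =>
    if h : ∃ h : m < k + 2, ⟨m, h⟩ ∈ B then j ⟨⟨m, h.1⟩, h.2⟩ else 0
  let ext' : ∀ B : Finset (Fin (k + 2)), ({i // i ∉ B} → Fin n) → ℕ → Fin n := fun B j m =>
    if h : ∃ h : m < k + 2, ⟨m, h⟩ ∉ B then j ⟨⟨m, h.1⟩, h.2⟩ else 0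
  refine ⟨A, ⟨⟨s, hlt s (h4 hs)⟩, by simpa [A] using hs⟩, fun hA => ?_,
    arrayForm fun j => u (ext A j), arrayForm fun j => v (ext' A j), fun x => ?_⟩
  · have : (⟨s', hlt s' (h5 hs')⟩ : Fin (k + 2)) ∈ A := hA ▸ Finset.mem_univ _
    exact Finset.disjoint_left.1 h3 (Finset.mem_filter.1 this).2 hs'
  · rw [← arrayForm_mul]
    refine congrArg (fun g => arrayForm g x) (funext fun j => ?_)
    rw [Pi.mul_apply]
    congr 1
    · refine hu fun m hm => ?_
      have hm' := hlt m (h4 hm)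
      have hmA : (⟨m, hm'⟩ : Fin (k + 2)) ∈ A := by simpa [A] using hm
      have hex : ∃ h : m < k + 2, (⟨m, h⟩ : Fin (k + 2)) ∈ A := ⟨hm', hmA⟩
      simp only [extendIndex, ext, dif_pos hm', dif_pos hex]
    · refine hv fun m hm => ?_
      have hm' := hlt m (h5 hm)
      have hmA : (⟨m, hm'⟩ : Fin (k + 2)) ∉ A := fun h =>
        Finset.disjoint_left.1 h3 (Finset.mem_filter.1 h).2 hm
      have hex : ∃ h : m < k + 2, (⟨m, h⟩ : Fin (k + 2)) ∉ A := ⟨hm', hmA⟩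
      simp only [extendIndex, ext', dif_pos hm', dif_pos hex]

theorem prank_le_of_isSplitSum {N : ℕ} {f : (ℕ → Fin n) → ZMod p}
    (hf : IsSplitSum 0 (k + 1) N f) :
    prank (arrayForm fun j => f (extendIndex j) : Tensor p n (k + 2)) ≤ N := by
  obtain ⟨l, h1, h2, rfl⟩ := hf
  refine le_trans (Nat.sInf_le ⟨fun i => arrayForm fun j => l.get i (extendIndex j),
    fun i => pRankOne_of_isSplit (h2 _ (l.get_mem i)), ?_⟩) h1
  clear h1 h2
  induction l with
  | nil =>
    ext x
    simp [arrayForm_apply]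
  | cons g l ih =>
    refine Eq.trans ?_ (Fin.sum_univ_succ (n := l.length) _).symm
    have : (fun j : Fin (k + 1 + 1) → Fin n => (g :: l).sum (extendIndex j))
        = (fun j => g (extendIndex j)) + fun j => l.sum (extendIndex j) := by
      funext j
      simp
    rw [this, arrayForm_add, ih]
    rfl

end partitionRank

section density
variable {F V X : Type*} [Field F] [Fintype F] [AddCommGroup V] [Module F V] [Fintype V]
  [AddCommGroup X] [Module F X]

open Classical in
theorem LinearMap.card_apply_eq_zero_mul_le {g : V →ₗ[F] X} (hg : g ≠ 0) :
    (Finset.univ.filter fun v => g v = 0).card * Fintype.card F ≤ Fintype.card V := by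
  obtain ⟨a, ha⟩ : ∃ a, g a ≠ 0 := by
    by_contra! h
    exact hg (LinearMap.ext h)
  rw [← Fintype.card_subtype, ← Fintype.card_prod]
  refine Fintype.card_le_of_injective
    (fun p : {v // g v = 0} × F => (p.1 : V) + p.2 • a) fun p p' h => ?_
  have h1 := congrArg g h
  simp only [map_add, map_smul, p.1.2, p'.1.2, zero_add] at h1
  have h2 : p.2 = p'.2 := smul_left_injective F ha h1
  have h3 : (p.1 : V) = p'.1 := by simpa [h2] using h
  exact Prod.ext (Subtype.ext h3) h2

open Classical in
theorem LinearMap.card_apply_ne_zero_ge {g : V →ₗ[F] X} (hg : g ≠ 0) :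
    (1 - 1 / (Fintype.card F : ℝ)) * Fintype.card V
      ≤ (Finset.univ.filter fun v => g v ≠ 0).card := by
  have h1 : ((Finset.univ.filter fun v => g v = 0).card : ℝ) * Fintype.card F ≤ Fintype.card V :=
    mod_cast LinearMap.card_apply_eq_zero_mul_le hg
  have h2 : ((Finset.univ.filter fun v => g v = 0).card : ℝ)
      + (Finset.univ.filter fun v => g v ≠ 0).card = Fintype.card V :=
    mod_cast Finset.card_filter_add_card_filter_not (s := (Finset.univ : Finset V)) _
  have hq : (0 : ℝ) < Fintype.card F := mod_cast Fintype.card_pos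
  rw [← le_div_iff₀ hq] at h1
  rw [sub_mul, one_mul, one_div_mul_eq_div]
  linarith

open Classical in
/-- A nonzero multilinear map in `m` arguments is nonzero on a fraction at least `(1 - 1 / q) ^ m`
of its domain. -/
theorem MultilinearMap.card_apply_ne_zero_ge {m : ℕ}
    {M : MultilinearMap F (fun _ : Fin m => V) X} (hM : M ≠ 0) :
    (1 - 1 / (Fintype.card F : ℝ)) ^ m * Fintype.card (Fin m → V)
      ≤ (Finset.univ.filter fun x => M x ≠ 0).card := by
  have hq : (0 : ℝ) ≤ 1 - 1 / (Fintype.card F : ℝ) := by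
    rw [sub_nonneg, div_le_one (mod_cast Fintype.card_pos)]
    exact_mod_cast Fintype.card_pos
  induction m with
  | zero =>
    obtain ⟨x, hx⟩ : ∃ x, M x ≠ 0 := by
      by_contra! h
      exact hM (MultilinearMap.ext h)
    rw [Finset.filter_true_of_mem fun y _ => Subsingleton.elim x y ▸ hx]
    simp
  | succ m ih =>
    have hg : M.curryLeft ≠ 0 := fun h => hM (by
      rw [← M.uncurry_curryLeft, h]
      rfl)
    have h1 : (Finset.univ.filter fun x => M x ≠ 0).card
        = ∑ v : V, (Finset.univ.filter fun y => M.curryLeft v y ≠ 0).card := by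
      simp_rw [Finset.card_filter]
      rw [← Fintype.sum_prod_type' (f := fun (v : V) (y : Fin m → V) =>
        if M.curryLeft v y ≠ 0 then 1 else 0)]
      exact (Fintype.sum_equiv (Fin.consEquiv fun _ => V) _ _ fun _ => rfl).symm
    have h2 := LinearMap.card_apply_ne_zero_ge hg
    rw [h1, Nat.cast_sum]
    calc (1 - 1 / (Fintype.card F : ℝ)) ^ (m + 1) * Fintype.card (Fin (m + 1) → V)
        = ((1 - 1 / (Fintype.card F : ℝ)) * Fintype.card V)
          * ((1 - 1 / (Fintype.card F : ℝ)) ^ m * Fintype.card (Fin m → V)) := by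
          simp only [Fintype.card_pi_const, Nat.cast_pow]
          ring
      _ ≤ (Finset.univ.filter fun v => M.curryLeft v ≠ 0).card
          * ((1 - 1 / (Fintype.card F : ℝ)) ^ m * Fintype.card (Fin m → V)) :=
          mul_le_mul_of_nonneg_right (h2.trans_eq (by congr!)) (by positivity)
      _ = ∑ v ∈ Finset.univ.filter fun v => M.curryLeft v ≠ 0,
          (1 - 1 / (Fintype.card F : ℝ)) ^ m * Fintype.card (Fin m → V) := by
          rw [Finset.sum_const, nsmul_eq_mul]
      _ ≤ ∑ v ∈ Finset.univ.filter fun v => M.curryLeft v ≠ 0,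
          ((Finset.univ.filter fun y => M.curryLeft v y ≠ 0).card : ℝ) :=
          Finset.sum_le_sum fun v hv => ih (Finset.mem_filter.1 hv).2
      _ ≤ _ := Finset.sum_le_sum_of_subset_of_nonneg (Finset.filter_subset _ _)
          fun _ _ _ => Nat.cast_nonneg _

end density

section biasFormula
variable {p n k : ℕ} [Fact p.Prime]

open Classical in
theorem sum_addChar_linearMap {χ : AddChar (ZMod p) ℂ} (hχ : χ ≠ 1)
    (g : (Fin n → ZMod p) →ₗ[ZMod p] ZMod p) :
    ∑ v, χ (g v) = if g = 0 then (Fintype.card (Fin n → ZMod p) : ℂ) else 0 := by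
  have h1 := AddChar.sum_eq_ite (χ.compAddMonoidHom g.toAddMonoidHom)
  rw [show ∑ v, χ (g v) = ∑ v, χ.compAddMonoidHom g.toAddMonoidHom v from rfl, h1]
  refine if_congr ⟨fun h => ?_, fun h => ?_⟩ rfl rfl
  · by_contra hg
    obtain ⟨v, hv⟩ : ∃ v, g v ≠ 0 := by
      by_contra! h
      exact hg (LinearMap.ext h)
    refine hχ (DFunLike.ext _ _ fun a => ?_)
    have := DFunLike.congr_fun h ((a / g v) • v)
    simpa [hv] using this
  · subst h
    ext v
    simp

open Classical in
theorem bias_eq {χ : AddChar (ZMod p) ℂ} (hχ : χ ≠ 1) (T : Tensor p n (k + 1)) :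
    bias T χ = ((Finset.univ.filter fun y : Fin k → Fin n → ZMod p => T.curryRight y = 0).card : ℂ)
      / Fintype.card (Fin k → Fin n → ZMod p) := by
  have h1 : ∑ x, χ (T x) = ∑ y : Fin k → Fin n → ZMod p, ∑ v : Fin n → ZMod p,
      χ (T.curryRight y v) := by
    rw [← Fintype.sum_prod_type_right' (f := fun (v : Fin n → ZMod p)
      (y : Fin k → Fin n → ZMod p) => χ (T.curryRight y v))]
    exact (Fintype.sum_equiv (Fin.snocEquiv fun _ => Fin n → ZMod p) _ _ fun _ => rfl).symm
  have h2 : (Fintype.card (Fin (k + 1) → Fin n → ZMod p) : ℂ)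
      = Fintype.card (Fin k → Fin n → ZMod p) * Fintype.card (Fin n → ZMod p) := by
    simp only [Fintype.card_pi_const, Nat.cast_mul, pow_succ]
  have h3 : (Fintype.card (Fin n → ZMod p) : ℂ) ≠ 0 := mod_cast Fintype.card_ne_zero
  rw [bias, h1, h2]
  simp_rw [sum_addChar_linearMap hχ]
  rw [← Finset.sum_filter, Finset.sum_const, nsmul_eq_mul, mul_div_mul_right _ _ h3]

open Classical in
theorem bias_re_eq {χ : AddChar (ZMod p) ℂ} (hχ : χ ≠ 1) (T : Tensor p n (k + 1)) :
    (bias T χ).re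
      = ((Finset.univ.filter fun y : Fin k → Fin n → ZMod p => T.curryRight y = 0).card : ℝ)
        / Fintype.card (Fin k → Fin n → ZMod p) := by
  rw [bias_eq hχ, ← Complex.ofReal_natCast, ← Complex.ofReal_natCast, ← Complex.ofReal_div,
    Complex.ofReal_re]

theorem bias_re_pos {χ : AddChar (ZMod p) ℂ} (hχ : χ ≠ 1) (T : Tensor p n (k + 2)) :
    0 < (bias T χ).re := by
  classical
  rw [bias_re_eq hχ]
  refine div_pos (Nat.cast_pos.2 (Finset.card_pos.2 ⟨0, ?_⟩)) (mod_cast Fintype.card_pos)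
  simp [T.curryRight.map_zero]

theorem bias_re_le {χ : AddChar (ZMod p) ℂ} (hχ : χ ≠ 1) {T : Tensor p n (k + 1)} (hT : T ≠ 0) :
    (bias T χ).re ≤ 1 - (1 - 1 / (p : ℝ)) ^ k := by
  classical
  have hM : T.curryRight ≠ 0 := fun h => hT (by
    rw [← T.uncurry_curryRight, h]
    rfl)
  have h1 := MultilinearMap.card_apply_ne_zero_ge hM
  rw [ZMod.card] at h1
  have h2 : ((Finset.univ.filter fun y => T.curryRight y = 0).card : ℝ)
      + (Finset.univ.filter fun y => T.curryRight y ≠ 0).card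
        = Fintype.card (Fin k → Fin n → ZMod p) :=
    mod_cast Finset.card_filter_add_card_filter_not (s := Finset.univ) _
  rw [bias_re_eq hχ, div_le_iff₀ (mod_cast Fintype.card_pos), sub_mul, one_mul,
    ← h2, add_sub_assoc, le_add_iff_nonneg_right, h2, sub_nonneg]
  exact h1.trans_eq (by congr!)

theorem rpow_neg_arank {χ : AddChar (ZMod p) ℂ} (hχ : χ ≠ 1) (T : Tensor p n (k + 2)) :
    (p : ℝ) ^ (-arank T χ) = (bias T χ).re := by
  have hp : (1 : ℝ) < p := mod_cast (Fact.out : p.Prime).one_lt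
  rw [arank, neg_neg, Real.rpow_logb (by linarith) hp.ne' (bias_re_pos hχ T)]

/-- The analytic rank of a nonzero tensor is bounded away from zero. -/
theorem le_arank {χ : AddChar (ZMod p) ℂ} (hχ : χ ≠ 1) {T : Tensor p n (k + 2)} (hT : T ≠ 0) :
    1 / (2 ^ (k + 1) * ((k + 1 : ℕ) : ℝ) ^ 2) ≤ arank T χ := by
  have hp : (2 : ℝ) ≤ p := mod_cast (Fact.out : p.Prime).two_le
  have hβ := bias_re_pos hχ T
  have hβ' := bias_re_le hχ hT
  have hlog : 0 < Real.log p := Real.log_pos (by linarith)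
  have har : arank T χ * Real.log p = -Real.log (bias T χ).re := by
    rw [arank, Real.logb, neg_mul, div_mul_cancel₀ _ hlog.ne']
  have hinv : 1 / (p : ℝ) ≤ 1 / 2 := one_div_le_one_div_of_le two_pos hp
  generalize hD : ((k + 1 : ℕ) : ℝ) = D at *
  have hD1 : 1 ≤ D := by
    rw [← hD]
    exact_mod_cast Nat.le_add_left 1 k
  have h2D : (2 : ℝ) ≤ 2 ^ (k + 1) := le_self_pow₀ one_le_two (Nat.succ_ne_zero k)
  rcases le_total (D ^ 2) p with hcase | hcase
  · have h1 : 1 - D / p ≤ (1 - 1 / (p : ℝ)) ^ (k + 1) := by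
      have := one_add_mul_le_pow (a := -(1 / (p : ℝ))) (by linarith) (k + 1)
      rw [hD] at this
      calc 1 - D / p = 1 + D * -(1 / (p : ℝ)) := by ring
        _ ≤ _ := this
        _ = _ := by rw [← sub_eq_add_neg]
    have h2 : 2 * Real.log D ≤ Real.log p := by
      have := Real.log_le_log (by positivity) hcase
      rwa [Real.log_pow, Nat.cast_two] at this
    have h3 : Real.log (bias T χ).re ≤ Real.log D - Real.log p := by
      rw [← Real.log_div (by positivity) (by positivity)]
      exact Real.log_le_log hβ (by linarith)
    have h4 : 1 / 2 ≤ arank T χ := by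
      by_contra! h
      nlinarith [mul_lt_mul_of_pos_right h hlog]
    refine le_trans (one_div_le_one_div_of_le two_pos ?_) h4
    nlinarith [one_le_pow₀ hD1 (n := 2)]
  · have h1 : 1 / 2 ^ (k + 1) ≤ (1 - 1 / (p : ℝ)) ^ (k + 1) := by
      rw [← one_div_pow]
      exact pow_le_pow_left₀ (by norm_num) (by linarith) _
    have h2 := Real.log_le_sub_one_of_pos hβ
    have h3 : Real.log p ≤ D ^ 2 := (Real.log_le_self (by linarith)).trans hcase
    have h4 : 1 / 2 ^ (k + 1) ≤ arank T χ * Real.log p := by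
      rw [har]
      linarith
    have h5 : 0 < arank T χ := by
      by_contra! h
      have : 0 < (1 : ℝ) / 2 ^ (k + 1) := by positivity
      nlinarith
    rw [← div_div, div_le_iff₀ (by positivity)]
    exact h4.trans (mul_le_mul_of_nonneg_left h3 h5.le)

end biasFormula

section combination
variable {p n k : ℕ} [Fact p.Prime]

/-- The coefficients of a tensor, the last index being separated. -/
def tensorArray (T : Tensor p n (k + 2)) (i : Fin (k + 1) → Fin n) (w : Fin n) : ZMod p :=
  T.curryRight (fun m => Pi.single (i m) 1) (Pi.single w 1)

theorem contract_tensorArray (T : Tensor p n (k + 2)) (y : Fin (k + 1) → Fin n → ZMod p)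
    (w : Fin n) : contract (tensorArray T) (extendSeq y) w = T.curryRight y (Pi.single w 1) := by
  have h := MultilinearMap.congr_fun (arrayForm_coeff
    ((LinearMap.applyₗ (R := ZMod p) (M₂ := ZMod p) (Pi.single w 1 : Fin n → ZMod p)
      ).compMultilinearMap T.curryRight)) y
  rw [arrayForm_apply] at h
  refine Eq.trans (Finset.sum_congr rfl fun i _ => ?_) h
  congr 1
  exact Finset.prod_congr rfl fun m _ => by rw [extendSeq, dif_pos m.2]

theorem contract_tensorArray_eq_zero_iff (T : Tensor p n (k + 2))
    (y : Fin (k + 1) → Fin n → ZMod p) :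
    contract (tensorArray T) (extendSeq y) = 0 ↔ T.curryRight y = 0 := by
  constructor
  · intro h
    refine (Pi.basisFun (ZMod p) (Fin n)).ext fun w => ?_
    rw [Pi.basisFun_apply, ← contract_tensorArray, h]
    rfl
  · intro h
    funext w
    rw [contract_tensorArray, h]
    rfl

theorem arrayForm_tensorArray [NeZero n] (T : Tensor p n (k + 2)) :
    (arrayForm fun j => tensorArray T (fun m => extendIndex j m) (extendIndex j (k + 1))) = T := by
  refine Eq.trans (congrArg arrayForm (funext fun j => ?_)) (arrayForm_coeff T)
  rw [tensorArray, MultilinearMap.curryRight_apply]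
  congr 1
  funext m
  refine Fin.lastCases ?_ (fun m => ?_) m
  · rw [Fin.snoc_last]
    simp [extendIndex, Fin.last]
  · rw [Fin.snoc_castSucc]
    have : (m : ℕ) < k + 1 + 1 := by omega
    simp only [extendIndex, dif_pos this]
    rfl

/-- The partition rank is bounded through the degree of a polynomial certificate over an extension
of degree `l`. -/
theorem prank_le_of_arank_le [NeZero n] {χ : AddChar (ZMod p) ℂ} (hχ : χ ≠ 1)
    (T : Tensor p n (k + 2)) {r l : ℕ} (hr : arank T χ ≤ r)
    (hl : 2 ^ (k + 1) * (rankConst k (k + 1) * (r + 1) + 2) ^ (k + 1) < 2 ^ l) :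
    prank T ≤ 2 ^ (k + 1) * (rankConst k (k + 1) * (r + 1)) * l := by
  classical
  have hp : (1 : ℝ) < p := mod_cast (Fact.out : p.Prime).one_lt
  have hl0 : l ≠ 0 := by
    rintro rfl
    have : 0 < 2 ^ (k + 1) * (rankConst k (k + 1) * (r + 1) + 2) ^ (k + 1) := by positivity
    omega
  have hcount : Fintype.card (Fin (k + 1) → Fin n → ZMod p) ≤ (Finset.univ.filter fun x :
      Fin (k + 1) → Fin n → ZMod p => contract (tensorArray T) (extendSeq x) = 0).card
        * Fintype.card (ZMod p) ^ r := by
    simp_rw [contract_tensorArray_eq_zero_iff]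
    have h1 : (p : ℝ) ^ (-(r : ℝ)) ≤ (bias T χ).re := by
      rw [← rpow_neg_arank hχ]
      exact Real.rpow_le_rpow_of_exponent_le hp.le (neg_le_neg hr)
    rw [bias_re_eq hχ, Real.rpow_neg (by linarith), Real.rpow_natCast,
      le_div_iff₀ (mod_cast Fintype.card_pos), inv_mul_le_iff₀ (by positivity), mul_comm] at h1
    rw [ZMod.card]
    exact_mod_cast h1
  obtain ⟨a, ha⟩ := exists_base_of_bounded_rank (tensorArray T) (AlgebraicClosure (ZMod p)) hcount
  obtain ⟨h, hh, hdeg, hsplit⟩ := exists_split_decomposition _ _ a ha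
  let := Fintype.ofFinite (GaloisField p l)
  have hcard : h.totalDegree < Fintype.card (GaloisField p l) := by
    rw [Fintype.card_eq_nat_card, GaloisField.card p l hl0]
    exact (hdeg.trans_lt hl).trans_le (Nat.pow_le_pow_left (Fact.out : p.Prime).two_le l)
  have hmain := prank_le_of_isSplitSum (isSplitSum_of_extension hh hcard hsplit)
  rwa [arrayForm_tensorArray, GaloisField.finrank p hl0] at hmain

theorem natLog_two_le {x : ℕ} (hx : 1 ≤ x) : (Nat.log 2 x : ℝ) ≤ 2 * Real.log x := by
  have h1 : ((2 ^ Nat.log 2 x : ℕ) : ℝ) ≤ x := mod_cast Nat.pow_log_le_self 2 (by omega)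
  have h2 := Real.log_le_log (by positivity) h1
  rw [Nat.cast_pow, Real.log_pow, Nat.cast_two] at h2
  have h3 := Real.log_two_gt_d9
  nlinarith [(Nat.log 2 x).cast_nonneg (α := ℝ)]

/-- Growth estimate turning the bound in terms of the integer part of the analytic rank into the
quasi-linear bound. -/
theorem quasilinear_estimate {D κ : ℕ} {c ρ : ℝ} (hc : 0 < c) (hρ : c ≤ ρ) :
    (2 : ℝ) ^ D * (κ * (⌈ρ⌉₊ + 1)) * (D + D * (Nat.log 2 (κ * (⌈ρ⌉₊ + 1) + 2) + 1) : ℝ)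
      ≤ (2 ^ D * (κ * (1 + 2 / c)) * (D * (4 * κ + 4))) * ρ * (Real.log (1 + ρ) + 1) := by
  have hρ0 : 0 < ρ := hc.trans_le hρ
  have hceil : (⌈ρ⌉₊ : ℝ) ≤ ρ + 1 := (Nat.ceil_lt_add_one hρ0.le).le
  have hκ : (0 : ℝ) ≤ κ := κ.cast_nonneg
  have hlog0 : 0 ≤ Real.log (1 + ρ) := Real.log_nonneg (by linarith)
  have h1 : (κ : ℝ) * (⌈ρ⌉₊ + 1) ≤ κ * (1 + 2 / c) * ρ := by
    rw [mul_assoc]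
    refine mul_le_mul_of_nonneg_left ?_ hκ
    have : 1 ≤ ρ / c := (one_le_div hc).2 hρ
    calc (⌈ρ⌉₊ + 1 : ℝ) ≤ ρ + 2 * 1 := by linarith
      _ ≤ ρ + 2 * (ρ / c) := by linarith
      _ = _ := by ring
  have h2 : (Nat.log 2 (κ * (⌈ρ⌉₊ + 1) + 2) : ℝ) ≤ 2 * (2 * κ + 1 + Real.log (1 + ρ)) := by
    refine (natLog_two_le (by omega)).trans ?_
    have h3 : (((κ * (⌈ρ⌉₊ + 1) + 2 : ℕ)) : ℝ) ≤ (2 * κ + 2) * (1 + ρ) := by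
      push_cast
      nlinarith
    have h4 := Real.log_le_log (by positivity) h3
    rw [Real.log_mul (by positivity) (by positivity)] at h4
    have h5 := Real.log_le_sub_one_of_pos (show (0 : ℝ) < 2 * κ + 2 by positivity)
    linarith
  have h6 : (D + D * (Nat.log 2 (κ * (⌈ρ⌉₊ + 1) + 2) + 1) : ℝ)
      ≤ D * (4 * κ + 4) * (Real.log (1 + ρ) + 1) := by
    have : (D : ℝ) * (1 + (Nat.log 2 (κ * (⌈ρ⌉₊ + 1) + 2) + 1))
        ≤ D * ((4 * κ + 4) * (Real.log (1 + ρ) + 1)) := by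
      refine mul_le_mul_of_nonneg_left ?_ D.cast_nonneg
      nlinarith [mul_nonneg hκ hlog0]
    linarith
  calc _ ≤ (2 : ℝ) ^ D * (κ * (1 + 2 / c) * ρ)
        * (D * (4 * κ + 4) * (Real.log (1 + ρ) + 1)) := by gcongr
    _ = _ := by ring

end combination

/-- For every `d ≥ 2` there is `α_d ≥ 1` such that for every prime `p`, every `n ≥ 1`, and
every nonzero `d`-tensor `T` on `𝔽_p^n`,
`prank(T) ≤ α_d · arank(T) · (log(1 + arank(T)) + 1)` (natural logarithm). -/
theorem stmt5 (d : ℕ) (hd : 2 ≤ d) :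
    ∃ α : ℝ, 1 ≤ α ∧
      ∀ (p n : ℕ) [hp : Fact p.Prime], 1 ≤ n →
        ∀ χ : AddChar (ZMod p) ℂ, χ ≠ 1 →
          ∀ T : Tensor p n d, T ≠ 0 →
            (prank T : ℝ) ≤ α * arank T χ * (Real.log (1 + arank T χ) + 1) := by
  obtain ⟨k, rfl⟩ := Nat.exists_eq_add_of_le' hd
  have hc : (0 : ℝ) < 1 / (2 ^ (k + 1) * ((k + 1 : ℕ) : ℝ) ^ 2) := by positivity
  refine ⟨2 ^ (k + 1) * (rankConst k (k + 1)
    * (1 + 2 / (1 / (2 ^ (k + 1) * ((k + 1 : ℕ) : ℝ) ^ 2))))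
    * ((k + 1 : ℕ) * (4 * rankConst k (k + 1) + 4)) + 1, le_add_of_nonneg_left (by positivity),
    fun p n _ hn χ hχ T hT => ?_⟩
  have : NeZero n := ⟨by omega⟩
  have hρ := le_arank hχ hT
  have hlog := Real.log_nonneg (le_add_of_nonneg_right (hc.le.trans hρ) : 1 ≤ 1 + arank T χ)
  set κ := rankConst k (k + 1)
  set x := κ * (⌈arank T χ⌉₊ + 1) + 2 with hx
  have hl : 2 ^ (k + 1) * x ^ (k + 1) < 2 ^ ((k + 1) + (k + 1) * (Nat.log 2 x + 1)) := by
    rw [pow_add 2 (k + 1), mul_comm (k + 1) (Nat.log 2 x + 1), pow_mul 2 (Nat.log 2 x + 1)]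
    exact Nat.mul_lt_mul_of_pos_left
      (Nat.pow_lt_pow_left (Nat.lt_pow_succ_log_self one_lt_two x) (Nat.succ_ne_zero k))
      (by positivity)
  have h1 := prank_le_of_arank_le hχ T (Nat.le_ceil _) hl
  have h2 := quasilinear_estimate (D := k + 1) (κ := κ) hc hρ
  have h3 : (prank T : ℝ) ≤ (2 : ℝ) ^ (k + 1) * (κ * (⌈arank T χ⌉₊ + 1))
      * ((k + 1 : ℕ) + (k + 1 : ℕ) * (Nat.log 2 x + 1) : ℝ) := by
    exact_mod_cast h1
  refine (h3.trans h2).trans ?_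
  have : 0 ≤ arank T χ := hc.le.trans hρ
  gcongr
  exact le_add_of_nonneg_right zero_le_one
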